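/- Nonlinear Markov property (Proposition 3.2): Assume additionally the Markovian structure Θ(t,ω) = Θ₀(ω(t)). For every bounded upper semianalytic ψ : Ω → ℝ, every t ≥ 0 and every x ∈ F, sup_{P ∈ ℛ(x)} ∫ ψ(θ_t ω′) P(dω′) = sup_{P ∈ ℛ(x)} ∫ ℰ^{ω′(t)}(ψ) P(dω′), where ℰ^y(ψ) := sup_{Q ∈ ℛ(y)} E^Q[ψ] for y ∈ F. -/

import Mathlib

open MeasureTheory Set Filter Topology
open scoped NNReal ENNReal

noncomputable section

namespace NLSP

/-- Lebesgue measure on `ℝ≥0`, obtained from Lebesgue measure on `ℝ`. -/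
def leb : Measure ℝ≥0 := (volume : Measure ℝ).comap Subtype.val

section PathSpace

variable {F : Type*} [TopologicalSpace F]

/-- The shift map `θ_t ω = ω (· + t)` on the path space `C(ℝ≥0, F)`. -/
def theta (t : ℝ≥0) (ω : C(ℝ≥0, F)) : C(ℝ≥0, F) :=
  ω.comp ⟨fun s => s + t, by fun_prop⟩

/-- The map `γ_t ω = ω ((· - t)⁺)` on the path space `C(ℝ≥0, F)`. -/
def gammaShift (t : ℝ≥0) (ω : C(ℝ≥0, F)) : C(ℝ≥0, F) :=
  ω.comp ⟨fun s => s - t, by fun_prop⟩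

/-- The canonical σ-algebra `𝓕_t = σ(X_s : s ≤ t)` on the path space. -/
def canonicalSig (F : Type*) [TopologicalSpace F] (t : ℝ≥0) :
    MeasurableSpace C(ℝ≥0, F) :=
  ⨆ s ∈ Set.Iic t, MeasurableSpace.comap (fun ω : C(ℝ≥0, F) => ω s) (borel F)

/-- The right-continuous σ-algebra `𝒢^t_s = ⋂_{r > s} σ(X_{v+t} : v ≤ r)` generated by the
shifted coordinate process. -/
def shiftSig (F : Type*) [TopologicalSpace F] (t s : ℝ≥0) :
    MeasurableSpace C(ℝ≥0, F) :=
  ⨅ r ∈ Set.Ioi s, ⨆ v ∈ Set.Iic r,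
    MeasurableSpace.comap (fun ω : C(ℝ≥0, F) => ω (v + t)) (borel F)

end PathSpace

/-- A function `ℝ≥0 → E` is càdlàg if it is right-continuous and has left limits. -/
def Cadlag {E : Type*} [TopologicalSpace E] (f : ℝ≥0 → E) : Prop :=
  (∀ t, ContinuousWithinAt f (Set.Ici t) t) ∧
    ∀ t : ℝ≥0, 0 < t → ∃ l : E, Tendsto f (nhdsWithin t (Set.Iio t)) (nhds l)

/-- A function is upper semianalytic if its strict superlevel sets are analytic. -/
def UpperSemianalytic {α : Type*} [TopologicalSpace α] (ψ : α → ℝ) : Prop :=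
  ∀ c : ℝ, MeasureTheory.AnalyticSet {x | c < ψ x}

section Mart

variable {Ω' : Type*}

/-- `τ` is a stopping time for the filtration `𝒢`. -/
def IsStoppingTimeOn (𝒢 : ℝ≥0 → MeasurableSpace Ω') (τ : Ω' → ℝ≥0) : Prop :=
  ∀ t, MeasurableSet[𝒢 t] {ω | τ ω ≤ t}

/-- `N` is a `P`-martingale for the filtration `𝒢`. -/
def IsMartingaleOn [MeasurableSpace Ω'] (P : Measure Ω')
    (𝒢 : ℝ≥0 → MeasurableSpace Ω') {E : Type*} [NormedAddCommGroup E] [NormedSpace ℝ E]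
    (N : ℝ≥0 → Ω' → E) : Prop :=
  (∀ s, StronglyMeasurable[𝒢 s] (N s)) ∧ (∀ s, Integrable (N s) P) ∧
    ∀ s t : ℝ≥0, s ≤ t → ∀ A : Set Ω', MeasurableSet[𝒢 s] A →
      ∫ ω in A, N t ω ∂P = ∫ ω in A, N s ω ∂P

/-- `N` is a local `P`-martingale for the filtration `𝒢`: there is a localizing
nondecreasing sequence of `𝒢`-stopping times increasing `P`-a.s. to `∞` such that every
stopped process is a `P`-martingale. -/
def IsLocalMartingaleOn [MeasurableSpace Ω'] (P : Measure Ω')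
    (𝒢 : ℝ≥0 → MeasurableSpace Ω') {E : Type*} [NormedAddCommGroup E] [NormedSpace ℝ E]
    (N : ℝ≥0 → Ω' → E) : Prop :=
  ∃ σ : ℕ → Ω' → ℝ≥0,
    (∀ n, IsStoppingTimeOn 𝒢 (σ n)) ∧ (∀ n ω, σ n ω ≤ σ (n + 1) ω) ∧
      (∀ᵐ ω ∂P, Tendsto (fun n => σ n ω) atTop atTop) ∧
      ∀ n, IsMartingaleOn P 𝒢 fun s ω => N (min s (σ n ω)) ω

/-- Progressive measurability of `a` with respect to the filtration `𝒢`. -/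
def ProgMeasOn (𝒢 : ℝ≥0 → MeasurableSpace Ω') {E : Type*} [MeasurableSpace E]
    (a : ℝ≥0 → Ω' → E) : Prop :=
  ∀ s : ℝ≥0,
    @Measurable (ℝ≥0 × Ω') E ((inferInstance : MeasurableSpace ℝ≥0).prod (𝒢 s)) _
      fun p => a (min p.1 s) p.2

end Mart

section Main

variable {F : Type*} [TopologicalSpace F] {𝕂 : Type*} [RCLike 𝕂]
  [MeasurableSpace 𝕂] {U : Type*}

/-- The set `𝒞(t, ω)` of laws under which every test process `Y^u` is a special semimartingale
(after time `t`) with absolutely continuous compensator whose densities lie in `Θ`. -/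
def CSet [MeasurableSpace C(ℝ≥0, F)] (Y : U → ℝ≥0 → C(ℝ≥0, F) → 𝕂)
    (Θ : ℝ≥0 → C(ℝ≥0, F) → Set (U → 𝕂)) (t : ℝ≥0) (ω : C(ℝ≥0, F)) :
    Set (ProbabilityMeasure C(ℝ≥0, F)) :=
  {P | (P : Measure C(ℝ≥0, F)) {ω' | ∀ s ≤ t, ω' s = ω s} = 1 ∧
    ∃ a : U → ℝ≥0 → C(ℝ≥0, F) → 𝕂,
      (∀ u, ProgMeasOn (shiftSig F t) (a u)) ∧
      (∀ u, ∀ᵐ ω' ∂(P : Measure C(ℝ≥0, F)), ∀ s : ℝ≥0,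
        IntegrableOn (fun r => a u r ω') (Set.Iic s) leb) ∧
      (∀ u, IsLocalMartingaleOn (P : Measure C(ℝ≥0, F)) (shiftSig F t)
        fun s ω' => Y u (s + t) ω' - Y u t ω' - ∫ r in Set.Iic s, a u r ω' ∂leb) ∧
      ∀ᵐ p ∂(leb.prod (P : Measure C(ℝ≥0, F))),
        (fun u => a u p.1 p.2) ∈ Θ (p.1 + t) p.2}

/-- The set `ℛ(x) = 𝒞(0, x)` for the Markovian specification `Θ(t, ω) = Θ₀(ω t)`. -/
def RSet [MeasurableSpace C(ℝ≥0, F)] (Y : U → ℝ≥0 → C(ℝ≥0, F) → 𝕂)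
    (Θ₀ : F → Set (U → 𝕂)) (x : F) : Set (ProbabilityMeasure C(ℝ≥0, F)) :=
  CSet Y (fun s ω' => Θ₀ (ω' s)) 0 (ContinuousMap.const ℝ≥0 x)

/-- The set `𝒦(t, x)` for the Markovian specification `Θ(t, ω) = Θ₀(ω t)`. -/
def KSet [MeasurableSpace C(ℝ≥0, F)] (Y : U → ℝ≥0 → C(ℝ≥0, F) → 𝕂)
    (Θ₀ : F → Set (U → 𝕂)) (t : ℝ≥0) (x : F) : Set (ProbabilityMeasure C(ℝ≥0, F)) :=
  CSet Y (fun s ω' => Θ₀ (ω' s)) t (ContinuousMap.const ℝ≥0 x)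

end Main

end NLSP

namespace NLSP

section Markov

variable {F : Type*} [TopologicalSpace F] [PolishSpace F]
  [MeasurableSpace C(ℝ≥0, F)] [BorelSpace C(ℝ≥0, F)]
  {𝕂 : Type*} [RCLike 𝕂] [MeasurableSpace 𝕂] [BorelSpace 𝕂]
  {U : Type*} [Countable U]

/-- The nonlinear expectation `ℰ^x(ψ) = sup_{P ∈ ℛ(x)} E^P[ψ]`. -/
def nlExp (Y : U → ℝ≥0 → C(ℝ≥0, F) → 𝕂) (Θ₀ : F → Set (U → 𝕂))
    (ψ : C(ℝ≥0, F) → ℝ) (x : F) : ℝ :=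
  sSup ((fun P : ProbabilityMeasure C(ℝ≥0, F) =>
    ∫ ω', ψ ω' ∂(P : Measure C(ℝ≥0, F))) '' RSet Y Θ₀ x)

end Markov

end NLSP

namespace NLSP

set_option linter.all false
set_option linter.deprecated false

section PartA

section Analytic

/-- Bounded cylinders in the Baire space. -/
def bcyl (n : ℕ) (σ : ℕ → ℕ) : Set (ℕ → ℕ) := {τ | ∀ i < n, τ i ≤ σ i}

lemma bcyl_congr {n : ℕ} {σ σ' : ℕ → ℕ} (h : ∀ i < n, σ i = σ' i) : bcyl n σ = bcyl n σ' := by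
  ext τ
  simp only [bcyl, mem_setOf_eq]
  exact forall₂_congr fun i hi => by rw [h i hi]

lemma bcyl_antitone (σ : ℕ → ℕ) : Antitone fun n => bcyl n σ := by
  intro m n hmn τ hτ i hi
  exact hτ i (lt_of_lt_of_le hi hmn)

variable {X : Type*} [TopologicalSpace X]

lemma exists_bcyl [MeasurableSpace X] (f : (ℕ → ℕ) → X) (μ : Measure X) (c : ℝ≥0∞)
    (hc : c < μ (range f)) : ∃ σ : ℕ → ℕ, ∀ n, c < μ (f '' bcyl n σ) := by
  have step : ∀ (n : ℕ) (g : ℕ → ℕ), c < μ (f '' bcyl n g) →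
      ∃ m, c < μ (f '' bcyl (n + 1) (Function.update g n m)) := by
    intro n g hg
    have h1 : f '' bcyl n g = ⋃ m, f '' bcyl (n + 1) (Function.update g n m) := by
      rw [← image_iUnion]
      congr 1
      ext τ
      simp only [bcyl, mem_setOf_eq, mem_iUnion]
      constructor
      · intro h
        refine ⟨τ n, fun i hi => ?_⟩
        by_cases hin : i = n
        · subst hin; simp
        · rw [Function.update_of_ne hin]; exact h i (by omega)
      · rintro ⟨m, h⟩ i hi
        have := h i (by omega)
        rwa [Function.update_of_ne (by omega)] at this
    have hmono : Monotone fun m => f '' bcyl (n + 1) (Function.update g n m) := by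
      intro m m' hmm
      apply image_mono
      intro τ hτ i hi
      refine (hτ i hi).trans ?_
      by_cases hin : i = n
      · subst hin; simpa using hmm
      · rw [Function.update_of_ne hin, Function.update_of_ne hin]
    rw [h1, hmono.measure_iUnion, lt_iSup_iff] at hg
    exact hg
  let G : (n : ℕ) → {g : ℕ → ℕ // c < μ (f '' bcyl n g)} := fun n =>
    Nat.rec ⟨fun _ => 0, by
      have : bcyl 0 (fun _ => 0) = univ := by ext; simp [bcyl]
      rw [this, image_univ]; exact hc⟩
      (fun n g => ⟨Function.update g.1 n (step n g.1 g.2).choose, (step n g.1 g.2).choose_spec⟩) n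
  have hG : ∀ n, (G (n + 1)).1 = Function.update (G n).1 n (step n (G n).1 (G n).2).choose :=
    fun n => rfl
  have hG2 : ∀ i n, i < n → (G n).1 i = (G (i + 1)).1 i := by
    intro i n hin
    induction n, hin using Nat.le_induction with
    | base => rfl
    | succ n hn ih =>
      rw [hG n, Function.update_of_ne (by omega)]
      exact ih
  refine ⟨fun i => (G (i + 1)).1 i, fun n => ?_⟩
  rw [← bcyl_congr (fun i hi => hG2 i n hi)]
  exact (G n).2

lemma iInter_closure_subset [TopologicalSpace.MetrizableSpace X] (f : (ℕ → ℕ) → X)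
    (hf : Continuous f) (σ : ℕ → ℕ) : (⋂ n, closure (f '' bcyl n σ)) ⊆ range f := by
  intro y hy
  letI := TopologicalSpace.metrizableSpaceMetric X
  rw [mem_iInter] at hy
  have h1 : ∀ n : ℕ, ∃ τ ∈ bcyl n σ, dist y (f τ) < 1 / ((n : ℝ) + 1) := by
    intro n
    obtain ⟨_, ⟨τ, hτ, rfl⟩, hd⟩ := Metric.mem_closure_iff.1 (hy n) (1 / ((n : ℝ) + 1)) (by positivity)
    exact ⟨τ, hτ, hd⟩
  choose τ hτ hd using h1
  have hK : IsCompact (Set.pi univ fun i => Iic (σ i) : Set (ℕ → ℕ)) :=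
    isCompact_univ_pi fun i => (finite_Iic (σ i)).isCompact
  obtain ⟨τ', -, φ, hφ, hlim⟩ := hK.tendsto_subseq (x := fun (n : ℕ) (i : ℕ) => min (τ n i) (σ i))
    (fun n i _ => min_le_right (τ n i) (σ i))
  have hlim2 : Tendsto (τ ∘ φ) atTop (𝓝 τ') := by
    rw [tendsto_pi_nhds] at hlim ⊢
    intro i
    refine (hlim i).congr' ?_
    filter_upwards [eventually_gt_atTop i] with n hn
    have : i < φ n := lt_of_lt_of_le hn (hφ.id_le n)
    simp only [Function.comp]
    exact min_eq_left (hτ _ i this)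
  have h2 : Tendsto (fun n => f (τ (φ n))) atTop (𝓝 (f τ')) := (hf.tendsto τ').comp hlim2
  have h3 : Tendsto (fun n => f (τ n)) atTop (𝓝 y) := by
    rw [tendsto_iff_dist_tendsto_zero]
    refine squeeze_zero (fun _ => dist_nonneg) (fun n => ?_) tendsto_one_div_add_atTop_nhds_zero_nat
    rw [dist_comm]; exact (hd n).le
  exact ⟨τ', tendsto_nhds_unique h2 (h3.comp hφ.tendsto_atTop)⟩

variable [MeasurableSpace X] [BorelSpace X]

lemma lt_measure_range_iff [TopologicalSpace.MetrizableSpace X] (f : (ℕ → ℕ) → X)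
    (hf : Continuous f) (μ : Measure X) [IsFiniteMeasure μ] {c : ℝ≥0∞} (hc : c < μ (range f)) :
    ∃ σ : ℕ → ℕ, ∀ n, c < μ (closure (f '' bcyl n σ)) := by
  obtain ⟨σ, hσ⟩ := exists_bcyl f μ c hc
  exact ⟨σ, fun n => (hσ n).trans_le (measure_mono subset_closure)⟩

lemma le_measure_iInter [TopologicalSpace.MetrizableSpace X] (f : (ℕ → ℕ) → X)
    (μ : Measure X) [IsFiniteMeasure μ] {c : ℝ≥0∞} {σ : ℕ → ℕ}
    (hσ : ∀ n, c ≤ μ (closure (f '' bcyl n σ))) : c ≤ μ (⋂ n, closure (f '' bcyl n σ)) := by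
  have ha : Antitone fun n => closure (f '' bcyl n σ) :=
    fun m n hmn => closure_mono (image_mono (bcyl_antitone σ hmn))
  have := tendsto_measure_iInter_atTop (μ := μ)
    (fun n => (isClosed_closure (s := f '' bcyl n σ)).measurableSet.nullMeasurableSet) ha
    ⟨0, measure_ne_top _ _⟩
  exact ge_of_tendsto' this hσ

lemma _root_.MeasureTheory.AnalyticSet.nullMeas [TopologicalSpace.MetrizableSpace X] {A : Set X}
    (hA : AnalyticSet A) (μ : Measure X) [IsFiniteMeasure μ] : NullMeasurableSet A μ := by
  rw [AnalyticSet] at hA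
  rcases hA with rfl | ⟨f, hf, rfl⟩
  · exact nullMeasurableSet_empty
  have h1 : ∀ k : ℚ, ∃ K : Set X, MeasurableSet K ∧ K ⊆ range f ∧
      (ENNReal.ofReal k < μ (range f) → ENNReal.ofReal k ≤ μ K) := by
    intro k
    by_cases hk : ENNReal.ofReal k < μ (range f)
    · obtain ⟨σ, hσ⟩ := lt_measure_range_iff f hf μ hk
      exact ⟨_, MeasurableSet.iInter fun n => isClosed_closure.measurableSet,
        iInter_closure_subset f hf σ, fun _ => le_measure_iInter f μ fun n => (hσ n).le⟩
    · exact ⟨∅, MeasurableSet.empty, empty_subset _, fun h => absurd h hk⟩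
  choose K hKm hKs hK using h1
  have hm : MeasurableSet (⋃ k, K k) := MeasurableSet.iUnion hKm
  have hle : μ (range f) ≤ μ (⋃ k, K k) := by
    by_contra! hlt
    obtain ⟨q, -, h1, h2⟩ := ENNReal.lt_iff_exists_rat_btwn.1 hlt
    exact absurd (h1.trans_le (hK _ h2)) (not_lt.2 (measure_mono (subset_iUnion _ _)))
  exact (hm.nullMeasurableSet).congr
    (ae_eq_of_subset_of_measure_ge (iUnion_subset hKs) hle hm.nullMeasurableSet (measure_ne_top _ _))

variable {Z : Type*} [TopologicalSpace Z] [PolishSpace Z] [MeasurableSpace Z] [BorelSpace Z]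

lemma analyticSet_measure_gt [TopologicalSpace.MetrizableSpace X] {A : Set X}
    (hA : AnalyticSet A) (m : Z → Measure X) (hm : Measurable m) [∀ z, IsFiniteMeasure (m z)]
    (c : ℝ≥0∞) : AnalyticSet {z | c < m z A} := by
  rw [AnalyticSet] at hA
  rcases hA with rfl | ⟨f, hf, rfl⟩
  · simp [analyticSet_empty]
  have e : {z | c < m z (range f)} = ⋃ q : ℚ, Prod.snd ''
      {p : (ℕ → ℕ) × Z | c < ENNReal.ofReal q ∧
        ∀ n, ENNReal.ofReal q ≤ m p.2 (closure (f '' bcyl n p.1))} := by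
    ext z
    simp only [mem_setOf_eq, mem_iUnion, mem_image, Prod.exists, exists_eq_right]
    constructor
    · intro h
      obtain ⟨q, -, h1, h2⟩ := ENNReal.lt_iff_exists_rat_btwn.1 h
      obtain ⟨σ, hσ⟩ := lt_measure_range_iff f hf (m z) h2
      exact ⟨q, σ, h1, fun n => (hσ n).le⟩
    · rintro ⟨q, σ, h1, h2⟩
      exact h1.trans_le ((le_measure_iInter f _ h2).trans
        (measure_mono (iInter_closure_subset f hf σ)))
  rw [e]
  refine AnalyticSet.iUnion fun q => ?_
  refine AnalyticSet.image_of_continuous ?_ continuous_snd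
  apply MeasurableSet.analyticSet
  refine measurableSet_setOf.2 (Measurable.and measurable_const (Measurable.forall fun n =>
    measurableSet_setOf.1 ?_))
  have e2 : {p : (ℕ → ℕ) × Z | ENNReal.ofReal q ≤ m p.2 (closure (f '' bcyl n p.1))} =
      ⋃ l : Fin n → ℕ, ({σ : ℕ → ℕ | ∀ i : Fin n, σ i = l i} ×ˢ
        {z | ENNReal.ofReal q ≤ m z (closure (f '' bcyl n
          (fun i => if h : i < n then l ⟨i, h⟩ else 0)))}) := by
    ext ⟨σ, z⟩
    simp only [mem_setOf_eq, mem_iUnion, mem_prod]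
    constructor
    · intro h
      refine ⟨fun i => σ i, fun i => rfl, ?_⟩
      rw [bcyl_congr (σ' := σ)]
      · exact h
      · intro i hi; simp [hi]
    · rintro ⟨l, hl, h⟩
      rw [bcyl_congr (σ' := σ)] at h
      · exact h
      · intro i hi; simp only [hi, dif_pos]; exact (hl ⟨i, hi⟩).symm
  rw [e2]
  refine MeasurableSet.iUnion fun l => MeasurableSet.prod ?_ ?_
  · refine measurableSet_setOf.2 (Measurable.forall fun i => measurableSet_setOf.1 ?_)
    exact measurableSet_eq_fun (measurable_pi_apply _) measurable_const
  · exact measurableSet_le measurable_const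
      ((Measure.measurable_coe isClosed_closure.measurableSet).comp hm)

end Analytic

end PartA

section PartA2

section Analytic2

variable {X : Type*} [TopologicalSpace X] [MeasurableSpace X] [BorelSpace X]
variable {Z : Type*} [TopologicalSpace Z] [PolishSpace Z] [MeasurableSpace Z] [BorelSpace Z]

lemma aemeas_of_analytic [TopologicalSpace.MetrizableSpace X] {ψ : X → ℝ}
    (hψ : ∀ c : ℝ, AnalyticSet {x | c < ψ x}) (μ : Measure X) [IsFiniteMeasure μ] :
    AEMeasurable ψ μ := by
  apply NullMeasurable.aemeasurable
  have : @Measurable (NullMeasurableSpace X μ) ℝ _ _ ψ := by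
    apply measurable_of_Ioi
    intro c
    exact (hψ c).nullMeas μ
  exact this

lemma analyticSet_lt_integral [PolishSpace X] {ψ : X → ℝ}
    (hψ : ∀ c : ℝ, AnalyticSet {x | c < ψ x}) {M : ℝ} (hM : ∀ x, |ψ x| ≤ M)
    (m : Z → Measure X) (hm : Measurable m) [∀ z, IsProbabilityMeasure (m z)]
    (c : ℝ) : AnalyticSet {z | c < ∫ x, ψ x ∂(m z)} := by
  classical
  have hint : ∀ z, Integrable ψ (m z) := fun z =>
    Integrable.of_bound (aemeas_of_analytic hψ (m z)).aestronglyMeasurable M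
      (Eventually.of_forall hM)
  have hge : ∀ z, 0 ≤ ∫ x, (ψ x - (-M)) ∂(m z) := fun z =>
    integral_nonneg fun x => by have := (abs_le.1 (hM x)).1; simp; linarith
  have hI : ∀ z, ∫ x, (ψ x - (-M)) ∂(m z) = ∫ x, ψ x ∂(m z) + M := fun z => by
    rw [integral_sub (hint z) (integrable_const _)]; simp
  by_cases hc : 0 ≤ c + M
  swap
  · have : {z | c < ∫ x, ψ x ∂(m z)} = univ := by
      ext z
      have := hge z
      rw [hI z] at this
      simp only [mem_setOf_eq, mem_univ, iff_true]; linarith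
    rw [this]; exact isClosed_univ.analyticSet
  let H : Set (X × ℝ) := regionBetween (fun _ => -M) ψ univ
  have hH : AnalyticSet H := by
    have e : H = ⋃ q : ℚ, (Prod.fst ⁻¹' {x | (q : ℝ) < ψ x}) ∩ {p : X × ℝ | -M < p.2 ∧ p.2 ≤ q} := by
      ext ⟨x, r⟩
      simp only [H, regionBetween, mem_setOf_eq, mem_univ, true_and, mem_Ioo, mem_iUnion, mem_inter_iff,
        mem_preimage]
      constructor
      · rintro ⟨h1, h2⟩
        obtain ⟨q, h3, h4⟩ := exists_rat_btwn h2
        exact ⟨q, h4, h1, h3.le⟩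
      · rintro ⟨q, h4, h1, h3⟩
        exact ⟨h1, h3.trans_lt h4⟩
    rw [e]
    refine AnalyticSet.iUnion fun q => ?_
    rw [inter_eq_iInter]
    refine AnalyticSet.iInter fun b => ?_
    cases b
    · refine MeasurableSet.analyticSet ?_
      refine measurableSet_setOf.2 (Measurable.and (measurableSet_setOf.1 ?_) (measurableSet_setOf.1 ?_))
      · exact measurableSet_lt measurable_const measurable_snd
      · exact measurableSet_le measurable_snd measurable_const
    · exact (hψ q).preimage continuous_fst
  let ν : Measure ℝ := volume.restrict (Ioo (-M) (M+1))
  let κ : ProbabilityTheory.Kernel Z X := ⟨m, hm⟩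
  haveI : ProbabilityTheory.IsMarkovKernel κ := ⟨fun z => inferInstanceAs (IsProbabilityMeasure (m z))⟩
  let κ2 : ProbabilityTheory.Kernel Z (X × ℝ) := κ.prod (ProbabilityTheory.Kernel.const Z ν)
  haveI : IsFiniteMeasure ν := ⟨by simp [ν]⟩
  have h2 : ∀ z, κ2 z H = ENNReal.ofReal (∫ x, ψ x ∂(m z) + M) := by
    intro z
    have e1 : κ2 z = ((m z).prod volume).restrict (univ ×ˢ (Ioo (-M) (M+1))) := by
      simp only [κ2, ProbabilityTheory.Kernel.prod_apply, ProbabilityTheory.Kernel.const_apply, ν]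
      rw [← Measure.prod_restrict, Measure.restrict_univ]; rfl
    rw [e1, Measure.restrict_apply' (MeasurableSet.univ.prod measurableSet_Ioo), inter_eq_left.2,
      ← hI z]
    · have := volume_regionBetween_eq_integral (μ := m z) (s := univ) (f := fun _ => -M) (g := ψ)
        (integrable_const _).integrableOn (hint z).integrableOn MeasurableSet.univ
        (fun x _ => (abs_le.1 (hM x)).1)
      simp only [Measure.restrict_univ] at this
      rw [this]; rfl
    · rintro ⟨x, r⟩ hr
      have h3 := (abs_le.1 (hM x)).2
      have h4 : -M < r ∧ r < ψ x := hr.2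
      refine ⟨mem_univ _, h4.1, ?_⟩
      show r < M + 1
      linarith [h4.2]
  have h3 : {z | c < ∫ x, ψ x ∂(m z)} = {z | ENNReal.ofReal (c + M) < κ2 z H} := by
    ext z
    simp only [mem_setOf_eq, h2]
    rw [ENNReal.ofReal_lt_ofReal_iff_of_nonneg hc]
    constructor <;> intro h <;> linarith
  rw [h3]
  exact analyticSet_measure_gt hH (fun z => κ2 z) κ2.measurable _

/-- Cylinders of finite words. -/
def lcyl (l : List ℕ) : Set (ℕ → ℕ) := {τ | ∀ i < l.length, τ i = l.getD i 0}

open Classical in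
/-- Next letter chosen in the selection. -/
def nxt (φ : (ℕ → ℕ) → X) (l : List ℕ) (y : X) : ℕ :=
  Nat.find (p := fun j => y ∈ φ '' lcyl (l ++ [j]) ∨ ∀ i, y ∉ φ '' lcyl (l ++ [i])) (by
    by_cases h : ∃ j, y ∈ φ '' lcyl (l ++ [j])
    · obtain ⟨j, hj⟩ := h; exact ⟨j, Or.inl hj⟩
    · push Not at h; exact ⟨0, Or.inr h⟩)

/-- Words chosen in the selection. -/
def wrd (φ : (ℕ → ℕ) → X) (y : X) : ℕ → List ℕ
  | 0 => []
  | n + 1 => wrd φ y n ++ [nxt φ (wrd φ y n) y]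

lemma analytic_lcyl (φ : (ℕ → ℕ) → X) (hφ : Continuous φ) (l : List ℕ) :
    AnalyticSet (φ '' lcyl l) := by
  refine AnalyticSet.image_of_continuous ?_ hφ
  refine MeasurableSet.analyticSet ?_
  refine measurableSet_setOf.2 (Measurable.forall fun i => Measurable.imp measurable_const
    (measurableSet_setOf.1 ?_))
  exact measurableSet_eq_fun (measurable_pi_apply _) measurable_const

lemma wrd_length (φ : (ℕ → ℕ) → X) (y : X) (n : ℕ) : (wrd φ y n).length = n := by
  induction n with
  | zero => rfl
  | succ n ih => simp [wrd, ih]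

lemma wrd_getD (φ : (ℕ → ℕ) → X) (y : X) (i n : ℕ) (h : i < n) :
    (wrd φ y n).getD i 0 = (wrd φ y (i + 1)).getD i 0 := by
  induction n, h using Nat.le_induction with
  | base => rfl
  | succ n hn ih =>
    rw [wrd, List.getD_append _ _ _ _ (by rw [wrd_length]; omega)]
    exact ih

lemma wrd_mem (φ : (ℕ → ℕ) → X) (y : X) (hy : y ∈ range φ) (n : ℕ) :
    y ∈ φ '' lcyl (wrd φ y n) := by
  induction n with
  | zero =>
    obtain ⟨τ, rfl⟩ := hy
    exact ⟨τ, by intro i hi; simp [wrd] at hi, rfl⟩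
  | succ n ih =>
    classical
    obtain ⟨τ, hτ, hτy⟩ := ih
    have hex : y ∈ φ '' lcyl (wrd φ y n ++ [τ n]) := by
      refine ⟨τ, fun i hi => ?_, hτy⟩
      rw [List.length_append, wrd_length] at hi
      by_cases hin : i < n
      · rw [List.getD_append _ _ _ _ (by rw [wrd_length]; omega)]
        exact hτ i (by rw [wrd_length]; omega)
      · have : i = n := by simp at hi; omega
        subst this
        rw [List.getD_append_right _ _ _ _ (by rw [wrd_length])]
        simp [wrd_length]
    have hs := Nat.find_spec (p := fun j => y ∈ φ '' lcyl (wrd φ y n ++ [j]) ∨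
      ∀ i, y ∉ φ '' lcyl (wrd φ y n ++ [i])) ⟨τ n, Or.inl hex⟩
    rcases hs with hs | hs
    · exact hs
    · exact absurd hex (hs _)

lemma measurable_selection [TopologicalSpace.MetrizableSpace X] [Nonempty Z] {S : Set (X × Z)}
    (hS : AnalyticSet S) (μ : Measure X) [IsFiniteMeasure μ]
    (h : ∀ᵐ y ∂μ, ∃ z, (y, z) ∈ S) :
    ∃ f : X → Z, Measurable f ∧ ∀ᵐ y ∂μ, (y, f y) ∈ S := by
  classical
  rw [AnalyticSet] at hS
  rcases hS with rfl | ⟨g, hg, rfl⟩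
  · refine ⟨fun _ => Classical.arbitrary Z, measurable_const, ?_⟩
    filter_upwards [h] with y hy
    simp at hy
  let φ : (ℕ → ℕ) → X := fun τ => (g τ).1
  have hφ : Continuous φ := continuous_fst.comp hg
  letI : MeasurableSpace (List ℕ) := ⊤
  let X' := NullMeasurableSpace X μ
  have hn : ∀ l, Measurable (fun y : X' => nxt (X := X) φ l y) := by
    intro l
    refine measurable_find _ fun k => ?_
    refine measurableSet_setOf.2 (Measurable.or (measurableSet_setOf.1 ?_) (Measurable.forall
      fun i => Measurable.not (measurableSet_setOf.1 ?_)))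
    · exact (analytic_lcyl φ hφ _).nullMeas μ
    · exact (analytic_lcyl φ hφ _).nullMeas μ
  have hw : ∀ n, Measurable (fun y : X' => wrd (X := X) φ y n) := by
    intro n
    induction n with
    | zero => exact measurable_const
    | succ n ih =>
      have h1 : Measurable (fun p : X' × List ℕ => p.2 ++ [nxt (X := X) φ p.2 p.1]) := by
        apply measurable_from_prod_countable_left
        intro l
        exact (measurable_from_top (f := fun j : ℕ => l ++ [j])).comp (hn l)
      exact h1.comp (measurable_id.prodMk ih)
  let hh : X → ℕ → ℕ := fun y i => (wrd φ y (i + 1)).getD i 0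
  have hhm : @Measurable X' (ℕ → ℕ) _ _ hh := by
    apply measurable_pi_lambda
    intro i
    exact (measurable_from_top (f := fun l : List ℕ => l.getD i 0)).comp (hw (i + 1))
  have hha : AEMeasurable hh μ := NullMeasurable.aemeasurable hhm
  have hkey : ∀ y ∈ range φ, φ (hh y) = y := by
    intro y hy
    have h1 := fun n => wrd_mem φ y hy n
    choose τ hτ hτy using h1
    have hlim : Tendsto τ atTop (𝓝 (hh y)) := by
      rw [tendsto_pi_nhds]
      intro i
      refine tendsto_const_nhds.congr' ?_
      filter_upwards [eventually_gt_atTop i] with n hn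
      rw [hτ n i (by rwa [wrd_length]), wrd_getD _ _ _ _ hn]
    have h2 := (hφ.tendsto _).comp hlim
    refine tendsto_nhds_unique h2 ?_
    simp only [Function.comp_def, hτy]
    exact tendsto_const_nhds
  have hfa : AEMeasurable (fun y => (g (hh y)).2) μ :=
    (continuous_snd.comp hg).measurable.comp_aemeasurable hha
  refine ⟨hfa.mk _, hfa.measurable_mk, ?_⟩
  filter_upwards [h, hfa.ae_eq_mk] with y hy hmk
  rw [← hmk]
  obtain ⟨z, τ, hτ⟩ := hy
  have : y ∈ range φ := ⟨τ, by simp [φ, hτ]⟩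
  refine ⟨hh y, ?_⟩
  exact Prod.ext (hkey y this) rfl

end Analytic2

end PartA2

section PartP

section Paths

variable {F : Type*} [TopologicalSpace F]

/-- Stopped path. -/
def stp (s : ℝ≥0) (ω : C(ℝ≥0, F)) : C(ℝ≥0, F) :=
  ω.comp ⟨fun r => min r s, by fun_prop⟩

@[simp] lemma stp_apply (s r : ℝ≥0) (ω : C(ℝ≥0, F)) : stp s ω r = ω (min r s) := rfl
@[simp] lemma theta_apply (t s : ℝ≥0) (ω : C(ℝ≥0, F)) : theta t ω s = ω (s + t) := rfl

lemma stp_stp (s r : ℝ≥0) (ω : C(ℝ≥0, F)) : stp s (stp r ω) = stp (min s r) ω := by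
  ext v; simp [min_assoc]

lemma stp_stp_of_le {s r : ℝ≥0} (h : s ≤ r) (ω : C(ℝ≥0, F)) : stp s (stp r ω) = stp s ω := by
  rw [stp_stp, min_eq_left h]

open Classical in
/-- Concatenation of paths at time `t`. -/
def cat (t : ℝ≥0) (η ω : C(ℝ≥0, F)) : C(ℝ≥0, F) :=
  if h : η t = ω 0 then
    ⟨fun s => if s ≤ t then η s else ω (s - t), by
      refine Continuous.if_le (by fun_prop) (by fun_prop) continuous_id continuous_const ?_
      intro s hs
      have hs' : s = t := hs
      subst hs'
      simpa using h⟩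
  else η

lemma cat_apply_le {t s : ℝ≥0} (h : s ≤ t) (η ω : C(ℝ≥0, F)) : cat t η ω s = η s := by
  unfold cat
  split_ifs with h1
  · simp [h]
  · rfl

lemma cat_apply_add {t : ℝ≥0} {η ω : C(ℝ≥0, F)} (h : η t = ω 0) (s : ℝ≥0) :
    cat t η ω (s + t) = ω s := by
  unfold cat
  rw [dif_pos h]
  by_cases hs : s = 0
  · subst hs; simp [h]
  · have : ¬ (s + t ≤ t) := by
      simpa using hs
    simp [this]

lemma theta_cat {t : ℝ≥0} {η ω : C(ℝ≥0, F)} (h : η t = ω 0) : theta t (cat t η ω) = ω := by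
  ext s; simp [cat_apply_add h]

lemma stp_cat (t s : ℝ≥0) (hs : s ≤ t) (η ω : C(ℝ≥0, F)) : stp s (cat t η ω) = stp s η := by
  ext v; simp [cat_apply_le ((min_le_right v s).trans hs)]

lemma cat_stp_theta (t : ℝ≥0) (ω : C(ℝ≥0, F)) : cat t (stp t ω) (theta t ω) = ω := by
  ext s
  rcases le_total s t with h | h
  · rw [cat_apply_le h]; simp [h]
  · obtain ⟨r, rfl⟩ := exists_add_of_le h
    rw [add_comm t r, cat_apply_add (by simp)]; simp

lemma stp_cat_stp (t s : ℝ≥0) (η ω : C(ℝ≥0, F)) :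
    stp (s + t) (cat t η (stp s ω)) = stp (s + t) (cat t η ω) := by
  ext v
  simp only [stp_apply]
  by_cases h : η t = ω 0
  · rcases le_total (min v (s + t)) t with h1 | h1
    · rw [cat_apply_le h1, cat_apply_le h1]
    · obtain ⟨r, hr⟩ := exists_add_of_le h1
      have hrs : r ≤ s := by
        have := min_le_right v (s + t)
        rw [hr, add_comm t r] at this
        exact le_of_add_le_add_right this
      rw [hr, add_comm t r, cat_apply_add h, cat_apply_add (by simpa using h)]
      simp [hrs]
  · have h' : ¬ (η t = stp s ω 0) := by simpa using h
    unfold cat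
    rw [dif_neg h, dif_neg h']

lemma theta_stp (t s : ℝ≥0) (ω : C(ℝ≥0, F)) : theta t (stp (s + t) ω) = stp s (theta t ω) := by
  ext v; simp [min_add_add_right]

instance instPolishPath [PolishSpace F] : PolishSpace C(ℝ≥0, F) := by
  letI := TopologicalSpace.upgradeIsCompletelyMetrizable F
  haveI : TopologicalSpace.IsCompletelyMetrizableSpace C(ℝ≥0, F) := inferInstance
  exact PolishSpace.mk

variable [PolishSpace F] [MeasurableSpace F] [BorelSpace F]
  [MeasurableSpace C(ℝ≥0, F)] [BorelSpace C(ℝ≥0, F)]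

lemma measurable_evalp : Measurable fun p : ℝ≥0 × C(ℝ≥0, F) => p.2 p.1 :=
  (by fun_prop : Continuous fun p : ℝ≥0 × C(ℝ≥0, F) => p.2 p.1).measurable

lemma measurable_eval (s : ℝ≥0) : Measurable fun ω : C(ℝ≥0, F) => ω s :=
  (by fun_prop : Continuous fun ω : C(ℝ≥0, F) => ω s).measurable

lemma measurable_path {α : Type*} [MeasurableSpace α] {g : α → C(ℝ≥0, F)}
    (h : ∀ s, Measurable fun a => g a s) : Measurable g := by
  let e : C(ℝ≥0, F) → ℕ → F := fun ω i => ω (TopologicalSpace.denseSeq ℝ≥0 i)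
  have he : MeasurableEmbedding e := by
    apply Continuous.measurableEmbedding
    · exact continuous_pi fun i => by fun_prop
    · intro ω ω' hh
      apply ContinuousMap.coe_injective
      refine Continuous.ext_on (TopologicalSpace.denseRange_denseSeq ℝ≥0) ω.continuous ω'.continuous ?_
      rintro _ ⟨i, rfl⟩
      exact congrFun hh i
  rw [← he.measurable_comp_iff]
  exact measurable_pi_lambda _ fun i => h _

lemma measurable_stp2 : Measurable fun p : ℝ≥0 × C(ℝ≥0, F) => stp p.1 p.2 := by
  refine measurable_path fun s => ?_
  simp only [stp_apply]
  exact measurable_evalp.comp ((measurable_const.min measurable_fst).prodMk measurable_snd)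

lemma measurable_stp (s : ℝ≥0) : Measurable (stp (F := F) s) :=
  measurable_stp2.comp (measurable_const.prodMk measurable_id)

lemma measurable_theta (t : ℝ≥0) : Measurable (theta (F := F) t) :=
  measurable_path fun s => measurable_eval _

lemma measurable_cat (t : ℝ≥0) :
    Measurable fun p : C(ℝ≥0, F) × C(ℝ≥0, F) => cat t p.1 p.2 := by
  classical
  refine measurable_path fun s => ?_
  rcases le_total s t with h | h
  · simp only [cat_apply_le h]; exact (measurable_eval s).comp measurable_fst
  · obtain ⟨r, rfl⟩ := exists_add_of_le h
    have : (fun p : C(ℝ≥0, F) × C(ℝ≥0, F) => cat t p.1 p.2 (t + r)) =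
        fun p => if p.1 t = p.2 0 then p.2 r else p.1 (t + r) := by
      ext p
      split_ifs with h1
      · rw [add_comm t r, cat_apply_add h1]
      · unfold cat; rw [dif_neg h1]
    rw [this]
    refine Measurable.ite ?_ ((measurable_eval r).comp measurable_snd)
      ((measurable_eval (t + r)).comp measurable_fst)
    exact measurableSet_eq_fun ((measurable_eval t).comp measurable_fst)
      ((measurable_eval 0).comp measurable_snd)

lemma measurable_stp_canon (s : ℝ≥0) : Measurable[canonicalSig F s] (stp (F := F) s) := by
  refine @measurable_path F _ _ _ _ _ _ _ (canonicalSig F s) _ fun v => ?_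
  have h1 : MeasurableSpace.comap (fun ω : C(ℝ≥0, F) => ω (min v s)) (borel F) ≤ canonicalSig F s := by
    unfold canonicalSig
    exact le_iSup₂_of_le (min v s) (mem_Iic.2 (min_le_right v s)) le_rfl
  refine Measurable.mono (ma := MeasurableSpace.comap (fun ω : C(ℝ≥0, F) => ω (min v s)) (borel F))
    ?_ h1 le_rfl
  rw [← BorelSpace.measurable_eq (α := F)]
  exact comap_measurable _

lemma canon_le_comap {s r : ℝ≥0} (h : s ≤ r) : canonicalSig F s ≤
    MeasurableSpace.comap (stp (F := F) r) inferInstance := by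
  unfold canonicalSig
  refine iSup₂_le fun v hv => ?_
  have hv' : v ≤ s := hv
  have e : (fun ω : C(ℝ≥0, F) => ω v) = (fun ω : C(ℝ≥0, F) => ω v) ∘ stp r := by
    ext ω; simp [min_eq_left (hv'.trans h)]
  rw [e, ← MeasurableSpace.comap_comp]
  apply MeasurableSpace.comap_mono
  rw [← BorelSpace.measurable_eq (α := F)]
  exact (measurable_eval v).comap_le

lemma canon_le (s : ℝ≥0) : canonicalSig F s ≤ (inferInstance : MeasurableSpace C(ℝ≥0, F)) :=
  (canon_le_comap le_rfl).trans (measurable_stp s).comap_le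

lemma canon_mono {s r : ℝ≥0} (h : s ≤ r) : canonicalSig F s ≤ canonicalSig F r :=
  (canon_le_comap h).trans (measurable_stp_canon r).comap_le

lemma canon_mem {s : ℝ≥0} {A : Set C(ℝ≥0, F)} (hA : MeasurableSet[canonicalSig F s] A)
    {r : ℝ≥0} (h : s ≤ r) (ω : C(ℝ≥0, F)) : stp r ω ∈ A ↔ ω ∈ A := by
  obtain ⟨A', -, rfl⟩ := canon_le_comap h A hA
  simp [stp_stp]

lemma canon_of_stp {s : ℝ≥0} {A : Set C(ℝ≥0, F)} (hA : MeasurableSet A)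
    (h : ∀ ω, stp s ω ∈ A ↔ ω ∈ A) : MeasurableSet[canonicalSig F s] A := by
  have : A = stp s ⁻¹' A := by ext ω; exact (h ω).symm
  rw [this]
  exact measurable_stp_canon s hA

lemma canon_fun {E : Type*} [MeasurableSpace E] [MeasurableSingletonClass E] {s : ℝ≥0}
    {g : C(ℝ≥0, F) → E} (hg : Measurable[canonicalSig F s] g) {r : ℝ≥0} (h : s ≤ r)
    (ω : C(ℝ≥0, F)) : g (stp r ω) = g ω := by
  have := (canon_mem (hg (measurableSet_singleton (g ω))) h ω).2 rfl
  exact this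

lemma canon_fun_of_stp {E : Type*} [MeasurableSpace E] {s : ℝ≥0}
    {g : C(ℝ≥0, F) → E} (hg : Measurable g) (h : ∀ ω, g (stp s ω) = g ω) :
    Measurable[canonicalSig F s] g := by
  have : g = g ∘ stp s := by ext ω; exact (h ω).symm
  rw [this]
  exact hg.comp (measurable_stp_canon s)

lemma shiftSig_zero (s : ℝ≥0) : shiftSig F 0 s = ⨅ r ∈ Ioi s, canonicalSig F r := by
  simp [shiftSig, canonicalSig]

lemma canon_le_shift (s : ℝ≥0) : canonicalSig F s ≤ shiftSig F 0 s := by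
  rw [shiftSig_zero]
  exact le_iInf₂ fun r hr => canon_mono (le_of_lt hr)

lemma shift_le_canon {s r : ℝ≥0} (h : s < r) : shiftSig F 0 s ≤ canonicalSig F r := by
  rw [shiftSig_zero]
  exact iInf₂_le r h

lemma shift_le (s : ℝ≥0) : shiftSig F 0 s ≤ (inferInstance : MeasurableSpace C(ℝ≥0, F)) :=
  (shift_le_canon (lt_add_one s)).trans (canon_le _)

end Paths

end PartP

section PartQ

section Leb

lemma coe_emb : MeasurableEmbedding ((↑) : ℝ≥0 → ℝ) := MeasurableEmbedding.subtype_coe measurableSet_Ici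

lemma leb_mp : MeasurePreserving ((↑) : ℝ≥0 → ℝ) leb (volume.restrict (Ici 0)) := by
  refine ⟨measurable_coe_nnreal_real, ?_⟩
  have hl : leb = Measure.comap NNReal.toReal volume := rfl
  have hr : range NNReal.toReal = Ici (0:ℝ) := by
    ext x; constructor
    · rintro ⟨y, rfl⟩; exact NNReal.coe_nonneg y
    · intro h; exact ⟨⟨x, h⟩, rfl⟩
  rw [hl, coe_emb.map_comap, hr]

instance : NullSingletonClass leb := by
  refine ⟨fun x => ?_⟩
  have := leb_mp.measure_preimage_emb coe_emb {(x : ℝ)}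
  have e : ((↑) : ℝ≥0 → ℝ) ⁻¹' {(x : ℝ)} = {x} := by ext; simp
  rw [e] at this
  rw [this]; simp

lemma leb_Iic (s : ℝ≥0) : leb (Iic s) = s := by
  have := leb_mp.measure_preimage_emb coe_emb (Iic (s : ℝ))
  have e : ((↑) : ℝ≥0 → ℝ) ⁻¹' (Iic (s : ℝ)) = Iic s := by ext; simp
  rw [e, Measure.restrict_apply measurableSet_Iic] at this
  rw [this]
  have : Iic (s : ℝ) ∩ Ici 0 = Icc 0 (s : ℝ) := by ext; simp [and_comm]
  rw [this]; simp

instance instSFLeb : SigmaFinite leb := by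
  refine ⟨⟨⟨fun n => Iic (n : ℝ≥0), fun _ => trivial, fun n => ?_, ?_⟩⟩⟩
  · rw [leb_Iic]; exact ENNReal.coe_lt_top
  · ext x; simp only [mem_iUnion, mem_Iic, mem_univ, iff_true]; exact exists_nat_ge x

variable {E : Type*} [NormedAddCommGroup E] [NormedSpace ℝ E]

lemma leb_restrict (s : ℝ≥0) :
    MeasurePreserving ((↑) : ℝ≥0 → ℝ) (leb.restrict (Iic s)) (volume.restrict (Icc 0 (s : ℝ))) := by
  have := leb_mp.restrict_preimage_emb coe_emb (Iic (s : ℝ))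
  have e : ((↑) : ℝ≥0 → ℝ) ⁻¹' (Iic (s : ℝ)) = Iic s := by ext; simp
  rw [e, Measure.restrict_restrict measurableSet_Iic] at this
  have e2 : Iic (s : ℝ) ∩ Ici 0 = Icc 0 (s : ℝ) := by ext; simp [and_comm]
  rwa [e2] at this

lemma leb_integral (f : ℝ≥0 → E) (s : ℝ≥0) :
    ∫ r in Iic s, f r ∂leb = ∫ x in (0:ℝ)..s, f x.toNNReal := by
  rw [intervalIntegral.integral_of_le (NNReal.coe_nonneg s), ← integral_Icc_eq_integral_Ioc,
    ← (leb_restrict s).integral_comp coe_emb]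
  simp

lemma leb_intOn (f : ℝ≥0 → E) (s : ℝ≥0) :
    IntegrableOn f (Iic s) leb ↔ IntervalIntegrable (fun x : ℝ => f x.toNNReal) volume 0 s := by
  rw [intervalIntegrable_iff_integrableOn_Icc_of_le (NNReal.coe_nonneg s) (by simp), IntegrableOn, IntegrableOn,
    ← (leb_restrict s).integrable_comp_emb coe_emb]
  simp [Function.comp_def]

/-- Local integrability on the half line. -/
def LocInt (f : ℝ≥0 → E) : Prop := ∀ n : ℕ, IntegrableOn f (Iic (n : ℝ≥0)) leb

lemma LocInt.on {f : ℝ≥0 → E} (h : LocInt f) (s : ℝ≥0) : IntegrableOn f (Iic s) leb := by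
  obtain ⟨n, hn⟩ := exists_nat_ge s
  exact (h n).mono_set (Iic_subset_Iic.2 hn)

lemma LocInt.locallyIntegrable {f : ℝ≥0 → E} (h : LocInt f) :
    LocallyIntegrable ((Ici 0).indicator (fun x : ℝ => f x.toNNReal)) volume := by
  rw [locallyIntegrable_iff]
  intro K hK
  obtain ⟨R, hR⟩ := hK.isBounded.subset_closedBall 0
  have h1 : IntegrableOn (fun x : ℝ => f x.toNNReal) (Icc 0 (R.toNNReal : ℝ)) volume := by
    have := (leb_intOn f R.toNNReal).1 (h.on _)
    rwa [intervalIntegrable_iff_integrableOn_Icc_of_le (NNReal.coe_nonneg _) (by simp)] at this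
  rw [IntegrableOn, integrable_indicator_iff measurableSet_Ici, IntegrableOn,
    Measure.restrict_restrict measurableSet_Ici]
  refine h1.mono_set ?_
  rintro x ⟨hx0, hxK⟩
  have := hR hxK
  simp only [Metric.mem_closedBall, dist_zero_right, Real.norm_eq_abs] at this
  exact ⟨hx0, (le_abs_self x).trans (this.trans (Real.le_coe_toNNReal R))⟩

lemma LocInt.integral_eq {f : ℝ≥0 → E} (s : ℝ≥0) :
    ∫ r in Iic s, f r ∂leb = ∫ x in (0:ℝ)..s, (Ici 0).indicator (fun x : ℝ => f x.toNNReal) x := by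
  rw [leb_integral]
  refine intervalIntegral.integral_congr fun x hx => ?_
  rw [uIcc_of_le (NNReal.coe_nonneg s)] at hx
  exact (indicator_of_mem (show x ∈ Ici (0:ℝ) from hx.1) (fun x : ℝ => f x.toNNReal)).symm

lemma LocInt.continuous {f : ℝ≥0 → E} (h : LocInt f) :
    Continuous fun s => ∫ r in Iic s, f r ∂leb := by
  simp_rw [LocInt.integral_eq]
  have : Continuous fun s : ℝ => ∫ x in (0:ℝ)..s, (Ici 0).indicator (fun x : ℝ => f x.toNNReal) x :=
    intervalIntegral.continuous_primitive (fun a b => MeasureTheory.IntegrableOn.intervalIntegrable ((LocInt.locallyIntegrable h).integrableOn_isCompact isCompact_uIcc)) 0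
  exact this.comp NNReal.continuous_coe

lemma LocInt.diff [CompleteSpace E] {f : ℝ≥0 → E} (h : LocInt f) :
    ∀ᵐ s ∂leb, Tendsto (fun n : ℕ => ((n : ℝ) + 1) • ((∫ r in Iic (s - ((n : ℝ≥0) + 1)⁻¹), f r ∂leb)
      - ∫ r in Iic (s - 2 * ((n : ℝ≥0) + 1)⁻¹), f r ∂leb)) atTop (𝓝 (f s)) := by
  have h1 := LocallyIntegrable.ae_hasDerivAt_integral (LocInt.locallyIntegrable h)
  have h2 : ∀ᵐ (s : ℝ≥0) ∂leb, ∀ (c : ℝ), HasDerivAt (fun x => ∫ (t : ℝ) in c..x,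
      (Ici 0).indicator (fun x : ℝ => f x.toNNReal) t)
      ((Ici 0).indicator (fun x : ℝ => f x.toNNReal) (s : ℝ)) s :=
    leb_mp.quasiMeasurePreserving.ae (ae_restrict_of_ae (s := Ici (0:ℝ)) h1)
  have h0 : ∀ᵐ s ∂leb, s ≠ 0 := by
    rw [ae_iff]; simp
  filter_upwards [h2, h0] with s hs hs0
  have hs := hs 0
  simp only [LocInt.integral_eq]
  set G := fun x : ℝ => ∫ (t : ℝ) in (0:ℝ)..x, (Ici 0).indicator (fun x : ℝ => f x.toNNReal) t
  rw [indicator_of_mem (show (s : ℝ) ∈ Ici (0:ℝ) from NNReal.coe_nonneg s), Real.toNNReal_coe] at hs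
  have hsl := hasDerivAt_iff_tendsto_slope.1 hs
  have hz : Tendsto (fun n : ℕ => 1 / ((n : ℝ) + 1)) atTop (𝓝 0) :=
    tendsto_one_div_add_atTop_nhds_zero_nat
  have key : ∀ c : ℝ, 0 < c → Tendsto (fun n : ℕ => slope G s (s - c * (1 / ((n : ℝ) + 1)))) atTop
      (𝓝 (f s)) := by
    intro c hc
    refine hsl.comp (tendsto_nhdsWithin_iff.2 ⟨?_, Eventually.of_forall fun n => ?_⟩)
    · have := (hz.const_mul c).const_sub (s : ℝ)
      simpa using this
    · have : 0 < c * (1 / ((n : ℝ) + 1)) := by positivity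
      simp only [mem_compl_iff, mem_singleton_iff]
      intro h; linarith
  have h3 := ((key 2 two_pos).const_smul (2 : ℝ)).sub (key 1 one_pos)
  have e0 : (2 : ℝ) • f s - f s = f s := by rw [two_smul]; abel
  rw [e0] at h3
  refine h3.congr' ?_
  have hs0' : (0:ℝ) < s := by positivity
  have hev : ∀ᶠ n : ℕ in atTop, 2 * (1 / ((n : ℝ) + 1)) < s := by
    have := hz.const_mul 2
    rw [mul_zero] at this
    exact this.eventually_lt_const hs0'
  filter_upwards [hev] with n hn
  have hp : (0 : ℝ) < (n : ℝ) + 1 := by positivity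
  have c1 : ((s - ((n : ℝ≥0) + 1)⁻¹ : ℝ≥0) : ℝ) = s - 1 * (1 / ((n : ℝ) + 1)) := by
    rw [NNReal.coe_sub]
    · simp
    · rw [← NNReal.coe_le_coe]; simp only [NNReal.coe_inv, NNReal.coe_add, NNReal.coe_natCast, NNReal.coe_one]
      rw [← one_div]; have : 0 < 1 / ((n : ℝ) + 1) := by positivity
      linarith
  have c2 : ((s - 2 * ((n : ℝ≥0) + 1)⁻¹ : ℝ≥0) : ℝ) = s - 2 * (1 / ((n : ℝ) + 1)) := by
    rw [NNReal.coe_sub]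
    · simp
    · rw [← NNReal.coe_le_coe]; simp only [NNReal.coe_mul, NNReal.coe_ofNat, NNReal.coe_inv, NNReal.coe_add, NNReal.coe_natCast, NNReal.coe_one]
      rw [← one_div]; linarith
  rw [c1, c2]
  change _ = ((n : ℝ) + 1) • (G _ - G _)
  simp only [slope, vsub_eq_sub]
  have d1 : ((s : ℝ) - 2 * (1 / ((n : ℝ) + 1)) - s)⁻¹ = - (((n : ℝ) + 1) / 2) := by
    field_simp; ring
  have d2 : ((s : ℝ) - 1 * (1 / ((n : ℝ) + 1)) - s)⁻¹ = - ((n : ℝ) + 1) := by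
    field_simp; ring
  rw [d1, d2, smul_smul]
  module

lemma leb_shift (t : ℝ≥0) : MeasurePreserving (fun r : ℝ≥0 => r + t) leb (leb.restrict (Ici t)) := by
  have hm : Measurable (fun r : ℝ≥0 => r + t) := measurable_id.add_const t
  refine ⟨hm, ?_⟩
  have hinj : Function.Injective fun μ : Measure ℝ≥0 => μ.map ((↑) : ℝ≥0 → ℝ) := by
    intro μ ν h
    have := congrArg (Measure.comap ((↑) : ℝ≥0 → ℝ)) h
    simpa [coe_emb.comap_map] using this
  apply hinj
  show Measure.map _ (Measure.map _ leb) = Measure.map _ _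
  rw [Measure.map_map measurable_coe_nnreal_real hm]
  have e1 : ((↑) : ℝ≥0 → ℝ) ∘ (fun r : ℝ≥0 => r + t) = (fun x : ℝ => x + t) ∘ (↑) := by
    ext; simp
  rw [e1, ← Measure.map_map (measurable_add_const (t:ℝ)) measurable_coe_nnreal_real, leb_mp.map_eq]
  have e2 : Ici t = ((↑) : ℝ≥0 → ℝ) ⁻¹' (Ici (t : ℝ)) := by ext; simp
  rw [e2, ← (leb_mp.restrict_preimage_emb coe_emb (Ici (t:ℝ))).map_eq.symm,
    Measure.restrict_restrict measurableSet_Ici]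
  have e3 : Ici (t : ℝ) ∩ Ici 0 = Ici (t : ℝ) := by
    apply inter_eq_left.2; exact Ici_subset_Ici.2 (NNReal.coe_nonneg t)
  have := ((measurePreserving_add_right (volume : Measure ℝ) (t : ℝ)).restrict_preimage_emb
    (MeasurableEquiv.addRight (t:ℝ)).measurableEmbedding (Ici (t : ℝ))).map_eq
  rw [e3, ← this]
  congr 2
  ext x; simp

lemma shift_emb (t : ℝ≥0) : MeasurableEmbedding (fun r : ℝ≥0 => r + t) :=
  (measurable_id.add_const t).measurableEmbedding (add_left_injective t)

lemma leb_shift_Iic (s t : ℝ≥0) :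
    MeasurePreserving (fun r : ℝ≥0 => r + t) (leb.restrict (Iic s)) (leb.restrict (Icc t (s + t))) := by
  have := (leb_shift t).restrict_preimage_emb (shift_emb t) (Iic (s + t))
  rw [Measure.restrict_restrict measurableSet_Iic] at this
  have e : (fun r : ℝ≥0 => r + t) ⁻¹' Iic (s + t) = Iic s := by ext; simp
  have e2 : Iic (s + t) ∩ Ici t = Icc t (s + t) := by ext; simp [and_comm]
  rwa [e, e2] at this

lemma intOn_shift {f : ℝ≥0 → E} {s t : ℝ≥0} :
    IntegrableOn f (Iic (s + t)) leb ↔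
      IntegrableOn f (Iic t) leb ∧ IntegrableOn (fun r => f (r + t)) (Iic s) leb := by
  have e : Iic (s + t) = Iic t ∪ Icc t (s + t) := by
    ext x; simp only [mem_Iic, mem_union, mem_Icc]
    constructor
    · intro h; rcases le_total x t with h1 | h1
      · exact Or.inl h1
      · exact Or.inr ⟨h1, h⟩
    · rintro (h | h)
      · exact h.trans le_add_self
      · exact h.2
  rw [e, integrableOn_union]
  have := (leb_shift_Iic s t).integrable_comp_emb (shift_emb t) (g := f)
  exact and_congr_right fun _ => this.symm

lemma integral_shift {f : ℝ≥0 → E} {s t : ℝ≥0} (h : IntegrableOn f (Iic (s + t)) leb) :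
    ∫ r in Iic (s + t), f r ∂leb = ∫ r in Iic t, f r ∂leb + ∫ r in Iic s, f (r + t) ∂leb := by
  have e : Iic (s + t) = Iic t ∪ Ioc t (s + t) := by
    rw [Iic_union_Ioc_eq_Iic]; exact le_add_self
  have h2 : ∫ r in Iic s, f (r + t) ∂leb = ∫ r in Ioc t (s + t), f r ∂leb := by
    rw [(leb_shift_Iic s t).integral_comp (shift_emb t) f, integral_Icc_eq_integral_Ioc]
  rw [h2, e, setIntegral_union (Iic_disjoint_Ioc le_rfl) measurableSet_Ioc]
  · exact h.mono_set (by rw [e]; exact subset_union_left)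
  · exact h.mono_set (by rw [e]; exact subset_union_right)

lemma ae_shift {p : ℝ≥0 → Prop} {t : ℝ≥0} :
    (∀ᵐ r ∂leb, p r) ↔ (∀ᵐ r ∂leb, r ≤ t → p r) ∧ (∀ᵐ r ∂leb, p (r + t)) := by
  have h : (∀ᵐ r ∂leb, p (r + t)) ↔ ∀ᵐ r ∂leb, r ∈ Ici t → p r := by
    rw [← ae_restrict_iff' measurableSet_Ici, ← (leb_shift t).map_eq,
      (shift_emb t).ae_map_iff]
  rw [h]
  constructor
  · intro h1
    exact ⟨h1.mono fun r hr _ => hr, h1.mono fun r hr _ => hr⟩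
  · rintro ⟨h1, h2⟩
    filter_upwards [h1, h2] with r hr1 hr2
    rcases le_total r t with h3 | h3
    · exact hr1 h3
    · exact hr2 h3

end Leb

end PartQ

section PartR

section Coding

lemma exists_alg (T : Type*) [MeasurableSpace T] [MeasurableSpace.CountablyGenerated T] :
    ∃ A : ℕ → Set T, IsSetAlgebra (range A) ∧
      (inferInstance : MeasurableSpace T) = MeasurableSpace.generateFrom (range A) := by
  have hc := MeasureTheory.countable_generateSetAlgebra
    (MeasurableSpace.countable_countableGeneratingSet (α := T))
  have hne : (generateSetAlgebra (MeasurableSpace.countableGeneratingSet T)).Nonempty :=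
    ⟨univ, isSetAlgebra_generateSetAlgebra.univ_mem⟩
  obtain ⟨A, hA⟩ := hc.exists_eq_range hne
  refine ⟨A, hA ▸ isSetAlgebra_generateSetAlgebra, ?_⟩
  rw [← hA, generateFrom_generateSetAlgebra_eq, MeasurableSpace.generateFrom_countableGeneratingSet]

/-- A countable generating algebra. -/
def alg (T : Type*) [MeasurableSpace T] [MeasurableSpace.CountablyGenerated T] : ℕ → Set T :=
  (exists_alg T).choose

variable {T : Type*} [MeasurableSpace T] [MeasurableSpace.CountablyGenerated T]

lemma alg_isAlg : IsSetAlgebra (range (alg T)) := (exists_alg T).choose_spec.1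
lemma alg_gen : (inferInstance : MeasurableSpace T) = MeasurableSpace.generateFrom (range (alg T)) :=
  (exists_alg T).choose_spec.2
lemma alg_meas (n : ℕ) : MeasurableSet (alg T n) := by
  have := MeasurableSpace.measurableSet_generateFrom (mem_range_self (f := alg T) n)
  rw [← alg_gen] at this
  exact this
lemma alg_pi : IsPiSystem (range (alg T)) := fun s hs t ht _ => alg_isAlg.inter_mem hs ht

/-- decoding of sets -/
def decS (κ : ℕ → ℕ) : Set T := {p | ∃ᶠ n in atTop, p ∈ alg T (κ n)}

lemma decS_surj (ν : Measure T) [IsFiniteMeasure ν] {S : Set T} (hS : MeasurableSet S) :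
    ∃ κ : ℕ → ℕ, ∀ᵐ p ∂ν, p ∈ decS κ ↔ p ∈ S := by
  have hd := Measure.MeasureDense.of_generateFrom_isSetAlgebra_finite ν (alg_isAlg (T := T)) alg_gen
  have : ∀ n : ℕ, ∃ k, ν (symmDiff S (alg T k)) < ENNReal.ofReal ((1/2)^n) := by
    intro n
    obtain ⟨t, ⟨k, rfl⟩, h⟩ := hd.approx S hS (measure_ne_top _ _) ((1/2)^n) (by positivity)
    exact ⟨k, h⟩
  choose κ hκ using this
  refine ⟨κ, ?_⟩
  have hsum : (∑' n, ν (symmDiff S (alg T (κ n)))) ≠ ∞ := by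
    refine ne_top_of_le_ne_top ?_ (ENNReal.tsum_le_tsum fun n => (hκ n).le)
    rw [← ENNReal.ofReal_tsum_of_nonneg (fun n => by positivity)
      (summable_geometric_of_lt_one (by norm_num) (by norm_num))]
    exact ENNReal.ofReal_ne_top
  filter_upwards [ae_eventually_notMem hsum] with p hp
  have hp' : ∀ᶠ n in atTop, (p ∈ alg T (κ n) ↔ p ∈ S) := by
    filter_upwards [hp] with n hn
    rw [Set.mem_symmDiff] at hn
    tauto
  constructor
  · intro h
    obtain ⟨n, h1, h2⟩ := (h.and_eventually hp').exists
    exact h2.1 h1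
  · intro h
    exact (hp'.mono fun n hn => hn.2 h).frequently

lemma decS_meas : MeasurableSet {p : (ℕ → ℕ) × T | p.2 ∈ decS p.1} := by
  have : {p : (ℕ → ℕ) × T | p.2 ∈ decS p.1} =
      ⋂ i : ℕ, ⋃ n : ℕ, ⋃ k : ℕ, {p | i ≤ n ∧ p.1 n = k ∧ p.2 ∈ alg T k} := by
    ext p
    simp [decS, frequently_atTop]
  rw [this]
  refine MeasurableSet.iInter fun i => MeasurableSet.iUnion fun n => MeasurableSet.iUnion fun k => ?_
  by_cases h : i ≤ n
  · simp only [h, true_and]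
    exact ((measurableSet_eq_fun ((measurable_pi_apply n).comp measurable_fst) measurable_const)).inter
      (measurable_snd (alg_meas k))
  · simp [h]

open Classical in
/-- decoding into the Cantor space -/
def decB (k : ℕ → ℕ → ℕ) (p : T) : ℕ → Bool := fun j => decide (p ∈ decS (k j))

lemma decB_meas : Measurable fun p : (ℕ → ℕ → ℕ) × T => decB p.1 p.2 := by
  classical
  refine measurable_pi_lambda _ fun j => ?_
  refine measurable_to_bool ?_
  have : (fun p : (ℕ → ℕ → ℕ) × T => decB p.1 p.2 j) ⁻¹' {true} =
    (fun p : (ℕ → ℕ → ℕ) × T => (p.1 j, p.2)) ⁻¹' {p : (ℕ → ℕ) × T | p.2 ∈ decS p.1} := by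
    ext p; simp [decB]
  rw [this]
  exact (((measurable_pi_apply j).comp measurable_fst).prodMk measurable_snd) decS_meas

lemma decB_surj (ν : Measure T) [IsFiniteMeasure ν] {f : T → ℕ → Bool} (hf : Measurable f) :
    ∃ k, ∀ᵐ p ∂ν, decB k p = f p := by
  classical
  have : ∀ j, ∃ κ : ℕ → ℕ, ∀ᵐ p ∂ν, p ∈ decS κ ↔ p ∈ (fun p => f p j) ⁻¹' {true} :=
    fun j => decS_surj ν (((measurable_pi_apply j).comp hf) (measurableSet_singleton _))
  choose k hk using this
  refine ⟨k, ?_⟩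
  filter_upwards [ae_all_iff.2 hk] with p hp
  funext j
  have := hp j
  simp only [mem_preimage, mem_singleton_iff] at this
  simp only [decB]
  rw [Bool.eq_iff_iff, decide_eq_true_iff, this]

lemma exists_dec (T : Type*) [MeasurableSpace T] [MeasurableSpace.CountablyGenerated T]
    (X : Type*) [MeasurableSpace X] [StandardBorelSpace X] [Nonempty X] :
    ∃ dec : (ℕ → ℕ → ℕ) → T → X, (Measurable fun p : (ℕ → ℕ → ℕ) × T => dec p.1 p.2) ∧
      ∀ (ν : Measure T) [IsFiniteMeasure ν] (f : T → X), Measurable f →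
        ∃ k, ∀ᵐ p ∂ν, dec k p = f p := by
  obtain ⟨e, he, hi⟩ := MeasurableSpace.measurable_injection_nat_bool_of_countablySeparated X
  have hemb : MeasurableEmbedding e := he.measurableEmbedding hi
  obtain ⟨g, hg, hge⟩ := hemb.exists_measurable_extend (measurable_id (α := X)) (fun _ => inferInstance)
  refine ⟨fun k p => g (decB k p), hg.comp decB_meas, fun ν _ f hf => ?_⟩
  obtain ⟨k, hk⟩ := decB_surj ν (he.comp hf)
  refine ⟨k, ?_⟩
  filter_upwards [hk] with p hp
  rw [hp]
  exact congrFun hge (f p)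

/-- universal decoding -/
def dec (T : Type*) [MeasurableSpace T] [MeasurableSpace.CountablyGenerated T]
    (X : Type*) [MeasurableSpace X] [StandardBorelSpace X] [Nonempty X] :
    (ℕ → ℕ → ℕ) → T → X := (exists_dec T X).choose

variable {X : Type*} [MeasurableSpace X] [StandardBorelSpace X] [Nonempty X]

lemma dec_meas : Measurable fun p : (ℕ → ℕ → ℕ) × T => dec T X p.1 p.2 :=
  (exists_dec T X).choose_spec.1

lemma dec_surj (ν : Measure T) [IsFiniteMeasure ν] {f : T → X} (hf : Measurable f) :
    ∃ k, ∀ᵐ p ∂ν, dec T X k p = f p :=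
  (exists_dec T X).choose_spec.2 ν f hf

/-- coding of probability measures -/
def mc (X : Type*) [MeasurableSpace X] [StandardBorelSpace X] [Nonempty X]
    (c : ℕ → ℕ → ℕ) : Measure X := (volume : Measure unitInterval).map (dec unitInterval X c)

instance (c : ℕ → ℕ → ℕ) : IsProbabilityMeasure (mc X c) := by
  unfold mc
  exact Measure.isProbabilityMeasure_map (dec_meas.comp measurable_prodMk_left).aemeasurable

lemma mc_meas : Measurable (mc X) := by
  refine Measure.measurable_of_measurable_coe _ fun B hB => ?_
  have : (fun c => mc X c B) = fun c => (volume : Measure unitInterval)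
      (Prod.mk c ⁻¹' ((fun p : (ℕ → ℕ → ℕ) × unitInterval => dec unitInterval X p.1 p.2) ⁻¹' B)) := by
    funext c
    have hd : Measurable (dec unitInterval X c) := dec_meas.comp measurable_prodMk_left
    rw [mc, Measure.map_apply hd hB]
    rfl
  rw [this]
  exact measurable_measure_prodMk_left (dec_meas hB)

lemma mc_surj (P : Measure X) [IsProbabilityMeasure P] : ∃ c, mc X c = P := by
  obtain ⟨f, hf, h⟩ := P.exists_measurable_map_eq
  obtain ⟨c, hc⟩ := dec_surj (volume : Measure unitInterval) hf
  exact ⟨c, by rw [mc, Measure.map_congr hc, h]⟩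

/-- vanishing set integrals on an algebra -/
lemma setIntegral_alg {Ω' : Type*} [MeasurableSpace Ω'] {P : Measure Ω'}
    {E : Type*} [NormedAddCommGroup E] [NormedSpace ℝ E] {f : Ω' → E} (hf : Integrable f P)
    {g : Ω' → T} (hg : Measurable g) (h : ∀ k, ∫ ω in g ⁻¹' (alg T k), f ω ∂P = 0)
    {B : Set T} (hB : MeasurableSet B) : ∫ ω in g ⁻¹' B, f ω ∂P = 0 := by
  have huniv : ∫ ω, f ω ∂P = 0 := by
    obtain ⟨k, hk⟩ := (alg_isAlg (T := T)).univ_mem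
    have := h k
    rwa [hk, preimage_univ, setIntegral_univ] at this
  refine MeasurableSpace.induction_on_inter (C := fun B _ => ∫ ω in g ⁻¹' B, f ω ∂P = 0)
    alg_gen alg_pi ?_ ?_ ?_ ?_ B hB
  · simp
  · rintro t ⟨k, rfl⟩; exact h k
  · intro t ht ih
    have := integral_add_compl (hg ht) hf
    rw [ih, huniv, zero_add] at this
    exact this
  · intro s hd hs ih
    rw [preimage_iUnion, integral_iUnion (fun i => hg (hs i))
      (fun i j hij => (hd hij).preimage g) hf.integrableOn]
    simp [ih]

end Coding

end PartR

section PartS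

section Tau

/-- Exhaustion time attached to a path of a control process. -/
def tau (b : ℝ≥0 → ℝ≥0) (n : ℕ) : ℝ≥0 := sSup {v | ∀ᵐ r ∂leb, r ≤ v → b r ≤ n}

/-- growth condition -/
def Gr (b : ℝ≥0 → ℝ≥0) : Prop := ∃ c, ∀ r, r ≤ b r + c

lemma ae_le_zero {p : ℝ≥0 → Prop} : ∀ᵐ r ∂leb, r ≤ 0 → p r := by
  have : ∀ᵐ r ∂leb, r ≠ 0 := by rw [ae_iff]; simp
  filter_upwards [this] with r hr h
  exact absurd (le_antisymm h zero_le) hr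

lemma tau_bdd {b : ℝ≥0 → ℝ≥0} (hb : Gr b) (n : ℕ) :
    BddAbove {v | ∀ᵐ r ∂leb, r ≤ v → b r ≤ n} := by
  obtain ⟨c, hc⟩ := hb
  refine ⟨n + c, fun v hv => ?_⟩
  have hv' : ∀ᵐ r ∂leb, r ≤ v → b r ≤ n := hv
  have h : leb (Iic v) ≤ leb (Iic ((n : ℝ≥0) + c)) := by
    refine measure_mono_ae ?_
    filter_upwards [hv'] with r hr h
    exact (hc r).trans (add_le_add_left (hr h) c)
  rw [leb_Iic, leb_Iic] at h
  exact_mod_cast h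

lemma le_tau_iff {b : ℝ≥0 → ℝ≥0} (hb : Gr b) {n : ℕ} {v : ℝ≥0} :
    v ≤ tau b n ↔ ∀ᵐ r ∂leb, r ≤ v → b r ≤ n := by
  constructor
  · intro h
    have h1 : ∀ᵐ r ∂leb, r < tau b n → b r ≤ n := by
      have hex : ∀ k : ℕ, ∀ᵐ r ∂leb, r ≤ tau b n - ((k : ℝ≥0) + 1)⁻¹ → b r ≤ n := by
        intro k
        by_cases h0 : tau b n - ((k : ℝ≥0) + 1)⁻¹ = 0
        · rw [h0]; exact ae_le_zero
        have hpos : 0 < tau b n := by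
          by_contra hh
          have : tau b n = 0 := le_antisymm (not_lt.1 hh) zero_le
          rw [this] at h0; simp at h0
        have hlt : tau b n - ((k : ℝ≥0) + 1)⁻¹ < sSup {v | ∀ᵐ r ∂leb, r ≤ v → b r ≤ n} :=
          tsub_lt_self hpos (by positivity)
        obtain ⟨w, hw, hw2⟩ := exists_lt_of_lt_csSup (show {v | ∀ᵐ r ∂leb, r ≤ v → b r ≤ n}.Nonempty from ⟨0, (ae_le_zero : ∀ᵐ r ∂leb, r ≤ 0 → b r ≤ n)⟩) hlt
        have hw' : ∀ᵐ r ∂leb, r ≤ w → b r ≤ n := hw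
        filter_upwards [hw'] with r hr h2
        exact hr (h2.trans hw2.le)
      filter_upwards [ae_all_iff.2 hex] with r hr h2
      obtain ⟨k, hk⟩ := exists_nat_one_div_lt (K := ℝ≥0) (tsub_pos_of_lt h2)
      refine hr k ?_
      rw [one_div] at hk
      refine le_tsub_of_add_le_left ?_
      exact (lt_tsub_iff_right.1 hk).le
    have h2 : ∀ᵐ r ∂leb, r ≠ tau b n := by rw [ae_iff]; simp
    filter_upwards [h1, h2] with r hr1 hr2 hr3
    exact hr1 (lt_of_le_of_ne (hr3.trans h) hr2)
  · intro h
    exact le_csSup (tau_bdd hb n) h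

lemma tau_mono {b : ℝ≥0 → ℝ≥0} (hb : Gr b) {n m : ℕ} (h : n ≤ m) : tau b n ≤ tau b m := by
  rw [le_tau_iff hb]
  filter_upwards [(le_tau_iff hb).1 (le_refl (tau b n))] with r hr h2
  exact (hr h2).trans (by exact_mod_cast h)

lemma tau_congr {b b' : ℝ≥0 → ℝ≥0} (h : ∀ᵐ r ∂leb, b r = b' r) (n : ℕ) : tau b n = tau b' n := by
  unfold tau
  congr 1
  ext v
  simp only [mem_setOf_eq]
  refine eventually_congr ?_
  filter_upwards [h] with r hr
  rw [hr]

lemma tau_min {b b' : ℝ≥0 → ℝ≥0} (hb : Gr b) (hb' : Gr b') {s : ℝ≥0}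
    (h : ∀ᵐ r ∂leb, r ≤ s → b r = b' r) (n : ℕ) : min s (tau b n) = min s (tau b' n) := by
  refine eq_of_forall_le_iff fun v => ?_
  simp only [le_min_iff]
  refine and_congr_right fun hv => ?_
  rw [le_tau_iff hb, le_tau_iff hb']
  refine eventually_congr ?_
  filter_upwards [h] with r hr
  refine forall_congr' fun h2 => ?_
  rw [hr (h2.trans hv)]

lemma Gr.shift {b : ℝ≥0 → ℝ≥0} (hb : Gr b) (t : ℝ≥0) : Gr fun r => b (r + t) := by
  obtain ⟨c, hc⟩ := hb
  exact ⟨c, fun r => le_self_add.trans (hc (r + t))⟩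

lemma tau_shift {b : ℝ≥0 → ℝ≥0} (hb : Gr b) {t : ℝ≥0} {n : ℕ} (h : t ≤ tau b n) :
    tau b n = tau (fun r => b (r + t)) n + t := by
  have h0 := (le_tau_iff hb).1 h
  obtain ⟨w, hw⟩ := exists_add_of_le h
  rw [hw, add_comm t w]
  congr 1
  refine eq_of_forall_le_iff fun v => ?_
  have : v ≤ w ↔ v + t ≤ tau b n := by rw [hw, add_comm t w]; simp
  rw [this, le_tau_iff hb, le_tau_iff (hb.shift t), ae_shift (t := t)]
  simp only [add_le_add_iff_right]
  refine and_iff_right ?_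
  filter_upwards [h0] with r hr h1 _
  exact hr h1

lemma tau_meas {W : Type*} [MeasurableSpace W] {b : W → ℝ≥0 → ℝ≥0}
    (hb : Measurable fun p : W × ℝ≥0 => b p.1 p.2) (hg : ∀ w, Gr (b w)) (n : ℕ) :
    Measurable fun w => tau (b w) n := by
  refine measurable_of_Ici fun v => ?_
  have : (fun w => tau (b w) n) ⁻¹' Ici v =
      (fun w => leb (Prod.mk w ⁻¹' {p : W × ℝ≥0 | ¬ (p.2 ≤ v → b p.1 p.2 ≤ n)})) ⁻¹' {0} := by
    ext w
    simp only [mem_preimage, mem_Ici, mem_singleton_iff, le_tau_iff (hg w), ae_iff]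
    rfl
  rw [this]
  refine measurable_measure_prodMk_left ?_ (measurableSet_singleton _)
  refine MeasurableSet.compl (s := {p : W × ℝ≥0 | (p.2 ≤ v → b p.1 p.2 ≤ n)}) ?_
  exact measurableSet_setOf.2 (Measurable.imp
    (measurableSet_setOf.1 (measurableSet_le measurable_snd measurable_const))
    (measurableSet_setOf.1 (measurableSet_le hb measurable_const)))

end Tau

section NN

variable {F : Type*} [TopologicalSpace F] {𝕂 : Type*} [RCLike 𝕂]

/-- the compensated process -/
def NN (y : F → 𝕂) (a : ℝ≥0 → 𝕂) (ω : C(ℝ≥0, F)) (s : ℝ≥0) : 𝕂 :=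
  y (ω s) - y (ω 0) - ∫ r in Iic s, a r ∂leb

/-- the stopped compensated process -/
def NS (y : F → 𝕂) (a : ℝ≥0 → 𝕂) (b : ℝ≥0 → ℝ≥0) (ω : C(ℝ≥0, F)) (n : ℕ) (s : ℝ≥0) : 𝕂 :=
  NN y a ω (min s (tau b n))

variable {y : F → 𝕂} {a a' : ℝ≥0 → 𝕂} {b b' : ℝ≥0 → ℝ≥0} {ω ω' : C(ℝ≥0, F)} {n : ℕ} {s t : ℝ≥0}

lemma leb_Iic_zero : leb.restrict (Iic 0) = 0 := by
  rw [Measure.restrict_eq_zero, leb_Iic]; simp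

lemma NN_zero : NN y a ω 0 = 0 := by simp [NN, leb_Iic_zero]

lemma NS_zero : NS y a b ω n 0 = 0 := by simp [NS, NN_zero]

lemma NN_congr_le {v : ℝ≥0} (hv : v ≤ s) (h : ∀ᵐ r ∂leb, r ≤ s → a r = a' r)
    (hω : ∀ r ≤ s, ω r = ω' r) : NN y a ω v = NN y a' ω' v := by
  unfold NN
  rw [hω v hv, hω 0 zero_le]
  congr 1
  refine setIntegral_congr_ae measurableSet_Iic ?_
  filter_upwards [h] with r hr h2
  exact hr (h2.trans hv)

lemma NS_congr_le (hb : Gr b) (hb' : Gr b') (h : ∀ᵐ r ∂leb, r ≤ s → a r = a' r)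
    (h2 : ∀ᵐ r ∂leb, r ≤ s → b r = b' r)
    (hω : ∀ r ≤ s, ω r = ω' r) : NS y a b ω n s = NS y a' b' ω' n s := by
  unfold NS
  rw [tau_min hb hb' h2]
  exact NN_congr_le (min_le_left _ _) h hω

lemma NN_shift (h : LocInt a) :
    NN y a ω (s + t) = NN y a ω t + NN y (fun r => a (r + t)) (theta t ω) s := by
  unfold NN
  rw [integral_shift (h.on _)]
  simp only [theta_apply, zero_add]
  ring

lemma NS_shift (h : LocInt a) (hb : Gr b) (ht : t ≤ tau b n) :
    NS y a b ω n (s + t) = NS y a b ω n t +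
      NS y (fun r => a (r + t)) (fun r => b (r + t)) (theta t ω) n s := by
  unfold NS
  rw [min_eq_left ht, tau_shift hb ht, min_add_add_right, NN_shift h]

lemma NS_shift_lt (ht : tau b n ≤ t) : NS y a b ω n (s + t) = NS y a b ω n t := by
  unfold NS
  rw [min_eq_right ht, min_eq_right (ht.trans le_add_self)]

lemma NS_const (ht : tau b n ≤ t) (hs : t ≤ s) : NS y a b ω n s = NS y a b ω n t := by
  unfold NS
  rw [min_eq_right ht, min_eq_right (ht.trans hs)]

variable [PolishSpace F] [MeasurableSpace F] [BorelSpace F]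
  [MeasurableSpace C(ℝ≥0, F)] [BorelSpace C(ℝ≥0, F)] [MeasurableSpace 𝕂] [BorelSpace 𝕂]

lemma NN_meas {W : Type*} [MeasurableSpace W] (hy : Measurable y) {a : W → ℝ≥0 → 𝕂}
    (ha : Measurable fun p : W × ℝ≥0 => a p.1 p.2) {ω : W → C(ℝ≥0, F)} (hω : Measurable ω)
    {s : W → ℝ≥0} (hs : Measurable s) : Measurable fun w => NN y (a w) (ω w) (s w) := by
  unfold NN
  have h1 : Measurable fun w => y (ω w (s w)) := hy.comp (measurable_evalp.comp (hs.prodMk hω))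
  have h2 : Measurable fun w => y (ω w 0) := hy.comp (measurable_evalp.comp (measurable_const.prodMk hω))
  refine (h1.sub h2).sub ?_
  have : (fun w => ∫ r in Iic (s w), a w r ∂leb) =
      fun w => ∫ r, ({p : W × ℝ≥0 | p.2 ≤ s p.1}.indicator (fun p => a p.1 p.2)) (w, r) ∂leb := by
    funext w
    rw [← integral_indicator measurableSet_Iic]
    rfl
  rw [this]
  have hm : Measurable ({p : W × ℝ≥0 | p.2 ≤ s p.1}.indicator (fun p => a p.1 p.2)) :=
    ha.indicator (measurableSet_le measurable_snd (hs.comp measurable_fst))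
  exact (hm.stronglyMeasurable.integral_prod_right').measurable

lemma NS_meas {W : Type*} [MeasurableSpace W] (hy : Measurable y) {a : W → ℝ≥0 → 𝕂}
    (ha : Measurable fun p : W × ℝ≥0 => a p.1 p.2) {b : W → ℝ≥0 → ℝ≥0}
    (hb : Measurable fun p : W × ℝ≥0 => b p.1 p.2) (hg : ∀ w, Gr (b w))
    {ω : W → C(ℝ≥0, F)} (hω : Measurable ω) (n : ℕ)
    {s : W → ℝ≥0} (hs : Measurable s) : Measurable fun w => NS y (a w) (b w) (ω w) n (s w) :=
  NN_meas hy ha hω (hs.min (tau_meas hb hg n))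

end NN

end PartS

section PartT1

open TopologicalSpace (denseSeq denseRange_denseSeq)
section Rev

variable {Ω' : Type*} {m0 : MeasurableSpace Ω'} {P : Measure Ω'} [IsProbabilityMeasure P]
  {E : Type*} [NormedAddCommGroup E] [NormedSpace ℝ E] [CompleteSpace E]

lemma norm_mart_le {m : MeasurableSpace Ω'} (hm : m ≤ m0) {X M : Ω' → E} (hX : Integrable X P)
    (hMm : StronglyMeasurable[m] M) (hMi : Integrable M P)
    (h : ∀ A, MeasurableSet[m] A → ∫ ω in A, M ω ∂P = ∫ ω in A, X ω ∂P) :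
    (‖M ·‖) ≤ᵐ[P] P[(‖X ·‖) | m] := by
  have h1 : M =ᵐ[P] P[X | m] := ae_eq_condExp_of_forall_setIntegral_eq hm hX
    (fun s _ _ => hMi.integrableOn) (fun s hs _ => h s hs) hMm.aestronglyMeasurable
  filter_upwards [h1, norm_condExp_le (μ := P) (m := m) X] with ω hω h2
  rw [hω]; exact h2

lemma integral_norm_mart_le {m : MeasurableSpace Ω'} (hm : m ≤ m0) {X M : Ω' → E} (hX : Integrable X P)
    (hMm : StronglyMeasurable[m] M) (hMi : Integrable M P)
    (h : ∀ A, MeasurableSet[m] A → ∫ ω in A, M ω ∂P = ∫ ω in A, X ω ∂P) :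
    ∫ ω, ‖M ω‖ ∂P ≤ ∫ ω, ‖X ω‖ ∂P := by
  have e := integral_condExp (μ := P) hm (f := fun ω => ‖X ω‖)
  have h1 : Integrable (P[(fun ω => ‖X ω‖) | m]) P := integrable_condExp
  have h2 := norm_mart_le hm hX hMm hMi h
  rw [← e]
  exact integral_mono_ae hMi.norm h1 h2

lemma rev_mart {X : Ω' → E} (hX : Integrable X P) {m : ℕ → MeasurableSpace Ω'}
    (hm : ∀ n, m n ≤ m0) {M : ℕ → Ω' → E} (hMm : ∀ n, StronglyMeasurable[m n] (M n))
    (hMi : ∀ n, Integrable (M n) P)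
    (h : ∀ n A, MeasurableSet[m n] A → ∫ ω in A, M n ω ∂P = ∫ ω in A, X ω ∂P)
    {L : Ω' → E} (hL : ∀ᵐ ω ∂P, Tendsto (fun n => M n ω) atTop (𝓝 (L ω))) :
    Integrable L P ∧ ∀ A, (∀ n, MeasurableSet[m n] A) → ∫ ω in A, L ω ∂P = ∫ ω in A, X ω ∂P := by
  have hui : UniformIntegrable (fun n => P[(‖X ·‖) | m n]) 1 P := hX.norm.uniformIntegrable_condExp hm
  have hle : ∀ n, (‖M n ·‖) ≤ᵐ[P] P[(‖X ·‖) | m n] := fun n => norm_mart_le (hm n) hX (hMm n) (hMi n) (h n)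
  have hui2 : UniformIntegrable M 1 P := by
    obtain ⟨h1, h2, C, h3⟩ := hui
    refine ⟨fun n => (hMi n).1, fun ε hε => ?_, C, fun n => ?_⟩
    · obtain ⟨δ, hδ, h4⟩ := h2 hε
      refine ⟨δ, hδ, fun n s hs hμ => (eLpNorm_mono_ae ?_).trans (h4 n s hs hμ)⟩
      filter_upwards [hle n] with ω hω
      by_cases hωs : ω ∈ s
      · simp only [hωs, indicator_of_mem]
        exact hω.trans (le_abs_self _)
      · simp [hωs]
    · refine (eLpNorm_mono_ae ?_).trans (h3 n)
      filter_upwards [hle n] with ω hω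
      exact hω.trans (le_abs_self _)
  have hLi : MemLp L 1 P := hui2.memLp_of_ae_tendsto hL
  have hLi' := memLp_one_iff_integrable.1 hLi
  refine ⟨hLi', fun A hA => ?_⟩
  have ht := tendsto_Lp_finite_of_tendsto_ae le_rfl (by simp) (fun n => (hMi n).1) hLi hui2.2.1 hL
  have := tendsto_setIntegral_of_L1' L hLi'.1 (Eventually.of_forall hMi) ht A
  refine tendsto_nhds_unique this ?_
  simp only [h _ A (hA _)]
  exact tendsto_const_nhds

end Rev

lemma exists_dense_right (s : ℝ≥0) : ∃ i : ℕ → ℕ, (∀ n, s < denseSeq ℝ≥0 (i n)) ∧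
    Tendsto (fun n => denseSeq ℝ≥0 (i n)) atTop (𝓝 s) := by
  have : ∀ n : ℕ, ∃ i, denseSeq ℝ≥0 i ∈ Ioo s (s + ((n : ℝ≥0) + 1)⁻¹) := by
    intro n
    exact (denseRange_denseSeq ℝ≥0).exists_mem_open isOpen_Ioo
      (nonempty_Ioo.2 (lt_add_of_pos_right _ (by positivity)))
  choose i hi using this
  refine ⟨i, fun n => (hi n).1, ?_⟩
  refine tendsto_of_tendsto_of_tendsto_of_le_of_le tendsto_const_nhds ?_ (fun n => (hi n).1.le)
    (fun n => (hi n).2.le)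
  have h : Tendsto (fun n : ℕ => ((n : ℝ≥0) + 1)⁻¹) atTop (𝓝 0) := by
    simpa [one_div] using (tendsto_one_div_add_atTop_nhds_zero_nat (𝕜 := ℝ≥0))
  simpa using h.const_add s

lemma shiftSig_mono {F : Type*} [TopologicalSpace F] {s t : ℝ≥0} (h : s ≤ t) :
    shiftSig F 0 s ≤ shiftSig F 0 t := by
  unfold shiftSig
  exact biInf_mono fun r (hr : t < r) => show s < r from h.trans_lt hr

section GDs

variable {F : Type*} [TopologicalSpace F] [PolishSpace F] [MeasurableSpace F] [BorelSpace F]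
  [MeasurableSpace C(ℝ≥0, F)] [BorelSpace C(ℝ≥0, F)]
  {𝕂 : Type*} [RCLike 𝕂] [MeasurableSpace 𝕂] [BorelSpace 𝕂]

/-- predictable pairs -/
structure PD (a : ℝ≥0 → C(ℝ≥0, F) → 𝕂) (b : ℝ≥0 → C(ℝ≥0, F) → ℝ≥0) : Prop where
  am : Measurable fun p : C(ℝ≥0, F) × ℝ≥0 => a p.2 p.1
  aa : ∀ r ω, a r (stp r ω) = a r ω
  bm : Measurable fun p : C(ℝ≥0, F) × ℝ≥0 => b p.2 p.1
  ba : ∀ r ω, b r (stp r ω) = b r ω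
  bg : ∀ ω, Gr fun r => b r ω

/-- the stopped process of a pair -/
abbrev NP (y : F → 𝕂) (a : ℝ≥0 → C(ℝ≥0, F) → 𝕂) (b : ℝ≥0 → C(ℝ≥0, F) → ℝ≥0) (n : ℕ) (s : ℝ≥0)
    (ω : C(ℝ≥0, F)) : 𝕂 := NS y (fun r => a r ω) (fun r => b r ω) ω n s

/-- good data -/
structure GD (y : F → 𝕂) (P : Measure C(ℝ≥0, F)) (a : ℝ≥0 → C(ℝ≥0, F) → 𝕂)
    (b : ℝ≥0 → C(ℝ≥0, F) → ℝ≥0) : Prop extends PD a b where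
  ai : ∀ᵐ ω ∂P, LocInt fun r => a r ω
  lim : ∀ᵐ ω ∂P, Tendsto (fun n => tau (fun r => b r ω) n) atTop atTop
  int : ∀ n i, Integrable (NP y a b n (denseSeq ℝ≥0 i)) P
  mart : ∀ n i j, denseSeq ℝ≥0 i ≤ denseSeq ℝ≥0 j → ∀ k,
    ∫ ω in stp (denseSeq ℝ≥0 i) ⁻¹' (alg C(ℝ≥0, F) k), NP y a b n (denseSeq ℝ≥0 j) ω ∂P =
    ∫ ω in stp (denseSeq ℝ≥0 i) ⁻¹' (alg C(ℝ≥0, F) k), NP y a b n (denseSeq ℝ≥0 i) ω ∂P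

variable {y : F → 𝕂} {P : Measure C(ℝ≥0, F)} [IsProbabilityMeasure P]
  {a : ℝ≥0 → C(ℝ≥0, F) → 𝕂} {b : ℝ≥0 → C(ℝ≥0, F) → ℝ≥0}

lemma PD.stp_eq (h : PD a b) (n : ℕ) (s : ℝ≥0) (ω : C(ℝ≥0, F)) :
    NP y a b n s (stp s ω) = NP y a b n s ω := by
  refine NS_congr_le (h.bg _) (h.bg _) (Eventually.of_forall fun r hr => ?_)
    (Eventually.of_forall fun r hr => ?_) (fun r hr => ?_)
  · rw [← h.aa r (stp s ω), stp_stp_of_le hr, h.aa]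
  · rw [← h.ba r (stp s ω), stp_stp_of_le hr, h.ba]
  · simp [hr]

lemma PD.meas (h : PD a b) (hy : Measurable y) (n : ℕ) (s : ℝ≥0) : Measurable (NP y a b n s) :=
  NS_meas hy (a := fun ω r => a r ω) (b := fun ω r => b r ω) h.am h.bm h.bg measurable_id n measurable_const

lemma PD.canon (h : PD a b) (hy : Measurable y) (n : ℕ) (s : ℝ≥0) :
    Measurable[canonicalSig F s] (NP y a b n s) :=
  canon_fun_of_stp (h.meas hy n s) (fun ω => (h.stp_eq n s ω))

lemma GD.mart_dense (h : GD y P a b) (n : ℕ) {i j : ℕ} (hij : denseSeq ℝ≥0 i ≤ denseSeq ℝ≥0 j)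
    {A : Set C(ℝ≥0, F)} (hA : MeasurableSet[canonicalSig F (denseSeq ℝ≥0 i)] A) :
    ∫ ω in A, NP y a b n (denseSeq ℝ≥0 j) ω ∂P = ∫ ω in A, NP y a b n (denseSeq ℝ≥0 i) ω ∂P := by
  have e : stp (denseSeq ℝ≥0 i) ⁻¹' A = A := by
    ext ω; exact canon_mem hA le_rfl ω
  have hAm := canon_le _ A hA
  have := setIntegral_alg ((h.int n j).sub (h.int n i)) (measurable_stp (denseSeq ℝ≥0 i))
    (fun k => by
      simp only [Pi.sub_apply]
      rw [integral_sub (h.int n j).integrableOn (h.int n i).integrableOn, h.mart n i j hij k, sub_self]) hAm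
  rw [e] at this
  simp only [Pi.sub_apply] at this
  rw [integral_sub (h.int n j).integrableOn (h.int n i).integrableOn] at this
  exact sub_eq_zero.1 this

lemma NS_right (hyc : ∀ ω : C(ℝ≥0, F), ∀ s, ContinuousWithinAt (fun s => y (ω s)) (Ici s) s)
    {a : ℝ≥0 → 𝕂} (ha : LocInt a) (b : ℝ≥0 → ℝ≥0) (ω : C(ℝ≥0, F)) (n : ℕ) {s : ℝ≥0} {q : ℕ → ℝ≥0}
    (hq : ∀ n, s ≤ q n) (hq2 : Tendsto q atTop (𝓝 s)) :
    Tendsto (fun k => NS y a b ω n (q k)) atTop (𝓝 (NS y a b ω n s)) := by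
  unfold NS NN
  have h1 : Tendsto (fun k => min (q k) (tau b n)) atTop (𝓝 (min s (tau b n))) :=
    hq2.min tendsto_const_nhds
  refine Tendsto.sub (Tendsto.sub ?_ tendsto_const_nhds) (ha.continuous.continuousAt.tendsto.comp h1)
  exact (hyc ω (min s (tau b n))).tendsto.comp (tendsto_nhdsWithin_iff.2
    ⟨h1, Eventually.of_forall fun k => min_le_min_right _ (hq k)⟩)

lemma GD.full (h : GD y P a b) (hy : Measurable y)
    (hyc : ∀ ω : C(ℝ≥0, F), ∀ s, ContinuousWithinAt (fun s => y (ω s)) (Ici s) s) (n : ℕ) :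
    (∀ s, Integrable (NP y a b n s) P) ∧ ∀ s t, s ≤ t → ∀ A, MeasurableSet[shiftSig F 0 s] A →
      ∫ ω in A, NP y a b n t ω ∂P = ∫ ω in A, NP y a b n s ω ∂P := by
  have key : ∀ s T, s < denseSeq ℝ≥0 T → Integrable (NP y a b n s) P ∧
      ∀ A, MeasurableSet[shiftSig F 0 s] A →
      ∫ ω in A, NP y a b n s ω ∂P = ∫ ω in A, NP y a b n (denseSeq ℝ≥0 T) ω ∂P := by
    intro s T hT
    obtain ⟨i, hi1, hi2⟩ := exists_dense_right s
    obtain ⟨k, hk⟩ := eventually_atTop.1 (hi2.eventually_lt_const hT)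
    have hmeas : ∀ m, StronglyMeasurable[canonicalSig F (denseSeq ℝ≥0 (i (m + k)))]
        (NP y a b n (denseSeq ℝ≥0 (i (m + k)))) :=
      fun m => (h.canon hy n _).stronglyMeasurable
    have := rev_mart (h.int n T) (m := fun m => canonicalSig F (denseSeq ℝ≥0 (i (m + k))))
      (fun m => canon_le _) hmeas (fun m => h.int n _)
      (fun m A hA => (h.mart_dense n (hk (m + k) (by omega)).le hA).symm)
      (L := NP y a b n s) (by
        filter_upwards [h.ai] with ω hω
        exact NS_right hyc hω _ ω n (fun m => (hi1 (m + k)).le) (hi2.comp (tendsto_add_atTop_nat k)))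
    refine ⟨this.1, fun A hA => this.2 A fun m => ?_⟩
    exact shift_le_canon (hi1 _) A hA
  have hex : ∀ s : ℝ≥0, ∃ T, s < denseSeq ℝ≥0 T := fun s =>
    ⟨_, (exists_dense_right s).choose_spec.1 0⟩
  refine ⟨fun s => (key s _ (hex s).choose_spec).1, fun s t hst A hA => ?_⟩
  obtain ⟨T, hT⟩ := hex t
  rw [(key s T (hst.trans_lt hT)).2 A hA, (key t T hT).2 A]
  exact shiftSig_mono hst A hA

end GDs

end PartT1

section PartT2

open TopologicalSpace (denseSeq denseRange_denseSeq)
section Adms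

variable {F : Type*} [TopologicalSpace F] [PolishSpace F] [MeasurableSpace F] [BorelSpace F]
  [MeasurableSpace C(ℝ≥0, F)] [BorelSpace C(ℝ≥0, F)]
  {𝕂 : Type*} [RCLike 𝕂] [MeasurableSpace 𝕂] [BorelSpace 𝕂] {U : Type*} [Countable U]

/-- the graph condition -/
def ThC (Θ₀ : F → Set (U → 𝕂)) (P : Measure C(ℝ≥0, F)) (a : U → ℝ≥0 → C(ℝ≥0, F) → 𝕂) : Prop :=
  ∀ᵐ ω ∂P, ∀ᵐ r ∂leb, (fun u => a u r ω) ∈ Θ₀ (ω r)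

/-- admissible data -/
def Adm (y : U → F → 𝕂) (Θ₀ : F → Set (U → 𝕂)) (x : F) (P : Measure C(ℝ≥0, F))
    (a : U → ℝ≥0 → C(ℝ≥0, F) → 𝕂) (b : U → ℝ≥0 → C(ℝ≥0, F) → ℝ≥0) : Prop :=
  P {ω | ω 0 = x} = 1 ∧ (∀ u, GD (y u) P (a u) (b u)) ∧ ThC Θ₀ P a

/-- standing hypotheses on the test functions -/
structure Std (Y : U → ℝ≥0 → C(ℝ≥0, F) → 𝕂) (y : U → F → 𝕂) (Θ₀ : F → Set (U → 𝕂)) : Prop where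
  eq : ∀ u s ω, Y u s ω = y u (ω s)
  meas : ∀ u, Measurable (y u)
  rc : ∀ u, ∀ ω : C(ℝ≥0, F), ∀ s, ContinuousWithinAt (fun s => y u (ω s)) (Ici s) s
  gr : MeasurableSet {p : ℝ≥0 × C(ℝ≥0, F) × (U → 𝕂) | p.2.2 ∈ Θ₀ (p.2.1 p.1)}

variable {Y : U → ℝ≥0 → C(ℝ≥0, F) → 𝕂} {y : U → F → 𝕂} {Θ₀ : F → Set (U → 𝕂)}

lemma Std.gr_meas (h : Std Y y Θ₀) {W : Type*} [MeasurableSpace W] {a : U → W → 𝕂}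
    (ha : ∀ u, Measurable (a u)) {r : W → ℝ≥0} (hr : Measurable r) {ω : W → C(ℝ≥0, F)}
    (hω : Measurable ω) : MeasurableSet {w | (fun u => a u w) ∈ Θ₀ (ω w (r w))} := by
  have : Measurable fun w => (r w, ω w, fun u => a u w) :=
    hr.prodMk (hω.prodMk (measurable_pi_lambda _ ha))
  exact this h.gr

lemma ae_swap {P : Measure C(ℝ≥0, F)} [SFinite P] {p : ℝ≥0 × C(ℝ≥0, F) → Prop} (hp : MeasurableSet {q | p q}) :
    (∀ᵐ q ∂(leb.prod P), p q) ↔ ∀ᵐ ω ∂P, ∀ᵐ r ∂leb, p (r, ω) := by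
  rw [Measure.ae_prod_iff_ae_ae hp, Measure.ae_ae_comm hp]

lemma PD.prog {a : ℝ≥0 → C(ℝ≥0, F) → 𝕂} {b : ℝ≥0 → C(ℝ≥0, F) → ℝ≥0} (h : PD a b) :
    ProgMeasOn (shiftSig F 0) a := by
  intro s
  have e : (fun p : ℝ≥0 × C(ℝ≥0, F) => a (min p.1 s) p.2) =
      (fun q : C(ℝ≥0, F) × ℝ≥0 => a q.2 q.1) ∘ (fun p => (stp s p.2, min p.1 s)) := by
    ext p
    simp only [Function.comp]
    rw [← h.aa (min p.1 s) (stp s p.2), stp_stp_of_le (min_le_right _ _), h.aa]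
  rw [e]
  refine h.am.comp ?_
  have h1 : @Measurable _ _ (shiftSig F 0 s) _ (stp (F := F) s) :=
    (measurable_stp_canon s).mono (canon_le_shift s) le_rfl
  refine Measurable.prodMk ?_ ?_
  · exact h1.comp (@measurable_snd _ _ _ (shiftSig F 0 s))
  · exact Measurable.min (@measurable_fst _ _ _ (shiftSig F 0 s)) measurable_const

lemma PD.tauTime {a : ℝ≥0 → C(ℝ≥0, F) → 𝕂} {b : ℝ≥0 → C(ℝ≥0, F) → ℝ≥0} (h : PD a b) (n : ℕ) :
    IsStoppingTimeOn (shiftSig F 0) (fun ω => tau (fun r => b r ω) n) := by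
  intro t
  have hm : Measurable fun ω => tau (fun r => b r ω) n := tau_meas (b := fun ω r => b r ω) h.bm h.bg n
  rw [shiftSig_zero]
  simp only [MeasurableSpace.measurableSet_iInf]
  intro r hr
  refine canon_of_stp (measurableSet_le hm measurable_const) fun ω => ?_
  have hr' : t < r := hr
  have := tau_min (h.bg (stp r ω)) (h.bg ω) (s := r) (Eventually.of_forall fun v hv => by
    rw [← h.ba v (stp r ω), stp_stp_of_le hv, h.ba]) n
  simp only [mem_setOf_eq]
  constructor
  · intro h1
    rw [min_eq_right (h1.trans hr'.le)] at this
    by_contra h2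
    rw [this, not_le] at *
    rcases min_lt_iff.1 (lt_of_le_of_lt h1 hr') with h3 | h3
    · exact absurd h3 (lt_irrefl _)
    · rw [min_eq_right h3.le] at h1; exact absurd h2 (not_lt.2 h1)
  · intro h1
    rw [min_eq_right (h1.trans hr'.le)] at this
    by_contra h2
    rw [not_le] at h2
    have : t < min r (tau (fun v => b v (stp r ω)) n) := lt_min hr' h2
    order

lemma Adm.mem (hS : Std Y y Θ₀) {x : F} {P : ProbabilityMeasure C(ℝ≥0, F)}
    {a : U → ℝ≥0 → C(ℝ≥0, F) → 𝕂} {b : U → ℝ≥0 → C(ℝ≥0, F) → ℝ≥0}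
    (h : Adm y Θ₀ x (P : Measure C(ℝ≥0, F)) a b) : P ∈ RSet Y Θ₀ x := by
  obtain ⟨h1, h2, h3⟩ := h
  refine ⟨?_, a, fun u => (h2 u).prog, fun u => ?_, fun u => ?_, ?_⟩
  · simpa [nonpos_iff_eq_zero] using h1
  · filter_upwards [(h2 u).ai] with ω hω s
    exact hω.on s
  · have hf := (h2 u).full (hS.meas u) (hS.rc u)
    refine ⟨fun n ω => tau (fun r => b u r ω) n, (h2 u).tauTime, fun n ω => tau_mono ((h2 u).bg ω) n.le_succ,
      (h2 u).lim, fun n => ?_⟩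
    have e : (fun (s : ℝ≥0) (ω : C(ℝ≥0, F)) => (fun (s : ℝ≥0) (ω' : C(ℝ≥0, F)) => Y u (s + 0) ω' - Y u 0 ω' - ∫ r in Set.Iic s, a u r ω' ∂leb)
        (min s (tau (fun r => b u r ω) n)) ω) = NP (y u) (a u) (b u) n := by
      ext s ω
      simp [NP, NS, NN, hS.eq]
    rw [e]
    refine ⟨fun s => ?_, (hf n).1, (hf n).2⟩
    exact (((h2 u).canon (hS.meas u) n s).mono (canon_le_shift s) le_rfl).stronglyMeasurable
  · have hm : MeasurableSet {p : ℝ≥0 × C(ℝ≥0, F) | (fun u => a u p.1 p.2) ∈ Θ₀ (p.2 p.1)} :=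
      hS.gr_meas (a := fun u (p : ℝ≥0 × C(ℝ≥0, F)) => a u p.1 p.2)
        (fun u => (h2 u).am.comp measurable_swap) measurable_fst measurable_snd
    simp only [add_zero]
    exact (ae_swap hm).2 h3

end Adms

end PartT2

section PartT3

open TopologicalSpace (denseSeq denseRange_denseSeq)
section Code

variable {F : Type*} [TopologicalSpace F] [PolishSpace F] [MeasurableSpace F] [BorelSpace F]
  [MeasurableSpace C(ℝ≥0, F)] [BorelSpace C(ℝ≥0, F)]
  {𝕂 : Type*} [RCLike 𝕂] [MeasurableSpace 𝕂] [BorelSpace 𝕂] {U : Type*} [Countable U]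

/-- codes -/
abbrev Wd := ℕ → ℕ → ℕ
abbrev Cd (U : Type*) := (U → Wd) × (U → Wd) × Wd

instance instCd1 : PolishSpace Wd := inferInstance
instance instCd2 : PolishSpace (U → Wd) := inferInstance
instance instCd3 : SecondCountableTopology (U → Wd) := inferInstance
instance instCd4 : BorelSpace Wd := inferInstance
instance instCd5 : BorelSpace (U → Wd) := Pi.borelSpace
instance instCd8b : SecondCountableTopology ((U → Wd) × Wd) := inferInstance
instance instCd8a : TopologicalSpace.IsCompletelyMetrizableSpace ((U → Wd) × Wd) := inferInstance
instance instCd8 : PolishSpace ((U → Wd) × Wd) := PolishSpace.mk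
instance instCd9 : SecondCountableTopology ((U → Wd) × Wd) := inferInstance
instance instCd10 : BorelSpace ((U → Wd) × Wd) := inferInstance
instance instCd6b : SecondCountableTopology (Cd U) := inferInstance
instance instCd6a : TopologicalSpace.IsCompletelyMetrizableSpace (Cd U) := inferInstance
instance instCd6 : PolishSpace (Cd U) := PolishSpace.mk
instance instCd7 : BorelSpace (Cd U) := inferInstance
instance instNeC [Nonempty F] : Nonempty C(ℝ≥0, F) := ⟨ContinuousMap.const _ (Classical.arbitrary F)⟩

def ca (F : Type*) [TopologicalSpace F] [PolishSpace F] [MeasurableSpace C(ℝ≥0, F)] [BorelSpace C(ℝ≥0, F)]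
    (𝕂 : Type*) [RCLike 𝕂] [MeasurableSpace 𝕂] [BorelSpace 𝕂] (k : Wd) (r : ℝ≥0) (ω : C(ℝ≥0, F)) : 𝕂 :=
  dec (ℝ≥0 × C(ℝ≥0, F)) 𝕂 k (r, stp r ω)

def cb (F : Type*) [TopologicalSpace F] [PolishSpace F] [MeasurableSpace C(ℝ≥0, F)] [BorelSpace C(ℝ≥0, F)]
    (k : Wd) (r : ℝ≥0) (ω : C(ℝ≥0, F)) : ℝ≥0 :=
  max (dec (ℝ≥0 × C(ℝ≥0, F)) ℝ≥0 k (r, stp r ω)) r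

lemma ca_meas : Measurable fun p : Wd × C(ℝ≥0, F) × ℝ≥0 => ca F 𝕂 p.1 p.2.2 p.2.1 := by
  unfold ca
  have h : Measurable fun p : Wd × C(ℝ≥0, F) × ℝ≥0 => (p.1, (p.2.2, stp p.2.2 p.2.1)) :=
    measurable_fst.prodMk (measurable_snd.snd.prodMk
      (measurable_stp2.comp (measurable_snd.snd.prodMk measurable_snd.fst)))
  exact dec_meas.comp h

lemma cb_meas : Measurable fun p : Wd × C(ℝ≥0, F) × ℝ≥0 => cb F p.1 p.2.2 p.2.1 := by
  unfold cb
  have h : Measurable fun p : Wd × C(ℝ≥0, F) × ℝ≥0 => (p.1, (p.2.2, stp p.2.2 p.2.1)) :=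
    measurable_fst.prodMk (measurable_snd.snd.prodMk
      (measurable_stp2.comp (measurable_snd.snd.prodMk measurable_snd.fst)))
  exact (dec_meas.comp h).max measurable_snd.snd

lemma ca_stp (k : Wd) (r : ℝ≥0) (ω : C(ℝ≥0, F)) : ca F 𝕂 k r (stp r ω) = ca F 𝕂 k r ω := by
  simp [ca, stp_stp]
lemma cb_stp (k : Wd) (r : ℝ≥0) (ω : C(ℝ≥0, F)) : cb F k r (stp r ω) = cb F k r ω := by
  simp [cb, stp_stp]
lemma cb_gr (k : Wd) (ω : C(ℝ≥0, F)) : ∀ r, r ≤ cb F k r ω := fun r => le_max_right _ _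
lemma cb_Gr (k : Wd) (ω : C(ℝ≥0, F)) : Gr fun r => cb F k r ω := ⟨0, fun r => by simpa using cb_gr k ω r⟩

lemma cPD (k l : Wd) : PD (ca F 𝕂 k) (cb F l) where
  am := ca_meas.comp (measurable_const.prodMk measurable_id)
  aa := ca_stp k
  bm := cb_meas.comp (measurable_const.prodMk measurable_id)
  ba := cb_stp l
  bg := cb_Gr l

def cP (F : Type*) [TopologicalSpace F] [PolishSpace F] [MeasurableSpace C(ℝ≥0, F)] [BorelSpace C(ℝ≥0, F)]
    [Nonempty F] (c : Wd) : Measure C(ℝ≥0, F) := mc C(ℝ≥0, F) c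

instance [Nonempty F] (c : Wd) : IsProbabilityMeasure (cP F c) := by unfold cP; infer_instance

def BAdm [Nonempty F] (y : U → F → 𝕂) (Θ₀ : F → Set (U → 𝕂)) (x : F) (z : Cd U) : Prop :=
  Adm y Θ₀ x (cP F z.2.2) (fun u => ca F 𝕂 (z.1 u)) (fun u => cb F (z.2.1 u)) ∧
    ∀ u n i, ∫⁻ ω, ‖NP (y u) (ca F 𝕂 (z.1 u)) (cb F (z.2.1 u)) n (denseSeq ℝ≥0 i) ω‖ₑ ∂(cP F z.2.2) ≤ n

section Gen
variable {Z : Type*} [MeasurableSpace Z] {Ω' : Type*} [MeasurableSpace Ω']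
  {κ : ProbabilityTheory.Kernel Z Ω'} [ProbabilityTheory.IsMarkovKernel κ]

lemma meas_ae {q : Z × Ω' → Prop} (hq : MeasurableSet {p | q p}) :
    MeasurableSet {z | ∀ᵐ ω ∂(κ z), q (z, ω)} := by
  have : Measurable fun z => κ z (Prod.mk z ⁻¹' {p | ¬ q p}) :=
    ProbabilityTheory.Kernel.measurable_kernel_prodMk_left hq.compl
  exact this (measurableSet_singleton 0)

lemma meas_ae_leb {q : Ω' × ℝ≥0 → Prop} (hq : MeasurableSet {p | q p}) :
    MeasurableSet {ω | ∀ᵐ r ∂leb, q (ω, r)} := by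
  have : Measurable fun z => leb (Prod.mk z ⁻¹' {p | ¬ q p}) :=
    measurable_measure_prodMk_left hq.compl
  exact this (measurableSet_singleton 0)

lemma meas_locInt {f : Ω' → ℝ≥0 → 𝕂} (hf : Measurable fun p : Ω' × ℝ≥0 => f p.1 p.2) :
    MeasurableSet {ω | LocInt (f ω)} := by
  have : {ω | LocInt (f ω)} = ⋂ n : ℕ, {ω | ∫⁻ r in Iic (n : ℝ≥0), ‖f ω r‖ₑ ∂leb < ⊤} := by
    ext ω
    simp only [mem_setOf_eq, mem_iInter, LocInt]
    refine forall_congr' fun n => ?_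
    constructor
    · exact fun h => h.2
    · intro h
      exact ⟨(hf.comp (measurable_const.prodMk measurable_id)).aestronglyMeasurable, h⟩
  rw [this]
  refine MeasurableSet.iInter fun n => measurableSet_lt ?_ measurable_const
  exact Measurable.lintegral_prod_right' (f := fun p : Ω' × ℝ≥0 => ‖f p.1 p.2‖ₑ) hf.enorm

lemma meas_lim {b : Ω' → ℝ≥0 → ℝ≥0} (hb : Measurable fun p : Ω' × ℝ≥0 => b p.1 p.2) (hg : ∀ ω, Gr (b ω)) :
    MeasurableSet {ω | Tendsto (fun n => tau (b ω) n) atTop atTop} := by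
  have : {ω | Tendsto (fun n => tau (b ω) n) atTop atTop} = ⋂ m : ℕ, ⋃ n : ℕ, {ω | (m : ℝ≥0) ≤ tau (b ω) n} := by
    ext ω
    simp only [mem_setOf_eq, mem_iInter, mem_iUnion]
    constructor
    · intro h m
      exact (h.eventually_ge_atTop (m : ℝ≥0)).exists
    · intro h
      refine tendsto_atTop_atTop_of_monotone (fun n m hnm => tau_mono (hg ω) hnm) fun c => ?_
      obtain ⟨m, hm⟩ := exists_nat_ge c
      obtain ⟨n, hn⟩ := h m
      exact ⟨n, hm.trans hn⟩
  rw [this]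
  exact MeasurableSet.iInter fun m => MeasurableSet.iUnion fun n =>
    measurableSet_le measurable_const (tau_meas hb hg n)

end Gen

variable {Y : U → ℝ≥0 → C(ℝ≥0, F) → 𝕂} {y : U → F → 𝕂} {Θ₀ : F → Set (U → 𝕂)}

def cK (F : Type*) [TopologicalSpace F] [PolishSpace F] [MeasurableSpace F] [BorelSpace F]
  [MeasurableSpace C(ℝ≥0, F)] [BorelSpace C(ℝ≥0, F)]
    [Nonempty F] (U : Type*) : ProbabilityTheory.Kernel (F × Cd U) C(ℝ≥0, F) where
  toFun p := cP F p.2.2.2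
  measurable' := mc_meas.comp measurable_snd.snd.snd

instance [Nonempty F] : ProbabilityTheory.IsMarkovKernel (cK F U) := ⟨fun p => by
  show IsProbabilityMeasure (cP F p.2.2.2); infer_instance⟩

lemma BAdm_meas [Nonempty F] (hS : Std Y y Θ₀) : MeasurableSet {p : F × Cd U | BAdm y Θ₀ p.1 p.2} := by
  have hA : ∀ u, Measurable fun p : ((F × Cd U) × C(ℝ≥0, F)) × ℝ≥0 => ca F 𝕂 (p.1.1.2.1 u) p.2 p.1.2 := by
    intro u
    refine ca_meas.comp (Measurable.prodMk ?_ (measurable_fst.snd.prodMk measurable_snd))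
    exact (measurable_pi_apply u).comp measurable_fst.fst.snd.fst
  have hB : ∀ u, Measurable fun p : ((F × Cd U) × C(ℝ≥0, F)) × ℝ≥0 => cb F (p.1.1.2.2.1 u) p.2 p.1.2 := by
    intro u
    refine cb_meas.comp (Measurable.prodMk ?_ (measurable_fst.snd.prodMk measurable_snd))
    exact (measurable_pi_apply u).comp measurable_fst.fst.snd.snd.fst
  have hN : ∀ u n (s : ℝ≥0), Measurable fun p : (F × Cd U) × C(ℝ≥0, F) =>
      NP (y u) (ca F 𝕂 (p.1.2.1 u)) (cb F (p.1.2.2.1 u)) n s p.2 := by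
    intro u n s
    exact NS_meas (hS.meas u) (a := fun (p : (F × Cd U) × C(ℝ≥0, F)) r => ca F 𝕂 (p.1.2.1 u) r p.2)
      (b := fun (p : (F × Cd U) × C(ℝ≥0, F)) r => cb F (p.1.2.2.1 u) r p.2) (hA u) (hB u)
      (fun p => cb_Gr _ _) measurable_snd n measurable_const
  have e : {p : F × Cd U | BAdm y Θ₀ p.1 p.2} =
      {p | ∀ᵐ ω ∂(cK F U p), ω 0 = p.1} ∩
      (⋂ u, {p | ∀ᵐ ω ∂(cK F U p), LocInt fun r => ca F 𝕂 (p.2.1 u) r ω}) ∩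
      (⋂ u, {p | ∀ᵐ ω ∂(cK F U p), Tendsto (fun n => tau (fun r => cb F (p.2.2.1 u) r ω) n) atTop atTop}) ∩
      (⋂ u, ⋂ n : ℕ, ⋂ i, {p | ∫⁻ ω, ‖NP (y u) (ca F 𝕂 (p.2.1 u)) (cb F (p.2.2.1 u)) n (denseSeq ℝ≥0 i) ω‖ₑ ∂(cK F U p) ≤ n}) ∩
      (⋂ u, ⋂ n, ⋂ i, ⋂ j, ⋂ (_ : denseSeq ℝ≥0 i ≤ denseSeq ℝ≥0 j), ⋂ k, {p |
        ∫ ω, (stp (denseSeq ℝ≥0 i) ⁻¹' (alg C(ℝ≥0, F) k)).indicator (NP (y u) (ca F 𝕂 (p.2.1 u)) (cb F (p.2.2.1 u)) n (denseSeq ℝ≥0 j)) ω ∂(cK F U p) =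
        ∫ ω, (stp (denseSeq ℝ≥0 i) ⁻¹' (alg C(ℝ≥0, F) k)).indicator (NP (y u) (ca F 𝕂 (p.2.1 u)) (cb F (p.2.2.1 u)) n (denseSeq ℝ≥0 i)) ω ∂(cK F U p)}) ∩
      {p | ∀ᵐ ω ∂(cK F U p), ∀ᵐ r ∂leb, (fun u => ca F 𝕂 (p.2.1 u) r ω) ∈ Θ₀ (ω r)} := by
    ext p
    have hk : cK F U p = cP F p.2.2.2 := rfl
    have h0 : (∀ᵐ ω ∂(cP F p.2.2.2), ω 0 = p.1) ↔ cP F p.2.2.2 {ω | ω 0 = p.1} = 1 := by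
      rw [← prob_compl_eq_zero_iff]
      · rfl
      · exact measurable_eval 0 (measurableSet_singleton _)
    have hms : ∀ i k, MeasurableSet (stp (denseSeq ℝ≥0 i) ⁻¹' (alg C(ℝ≥0, F) k)) := fun i k =>
      measurable_stp _ (alg_meas k)
    simp only [mem_inter_iff, mem_iInter, mem_setOf_eq, hk, h0, integral_indicator (hms _ _)]
    constructor
    · rintro ⟨⟨h1, h2, h3⟩, h4⟩
      exact ⟨⟨⟨⟨⟨h1, fun u => (h2 u).ai⟩, fun u => (h2 u).lim⟩, h4⟩, fun u n i j hij k => (h2 u).mart n i j hij k⟩, h3⟩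
    · rintro ⟨⟨⟨⟨⟨h1, h2⟩, h3⟩, h4⟩, h5⟩, h6⟩
      refine ⟨⟨h1, fun u => ⟨cPD _ _, h2 u, h3 u, fun n i => ⟨?_, ?_⟩, h5 u⟩, h6⟩, h4⟩
      · exact ((cPD _ _).meas (hS.meas u) n _).aestronglyMeasurable
      · exact lt_of_le_of_lt (h4 u n i) (ENNReal.natCast_lt_top n)
  rw [e]
  refine ((((MeasurableSet.inter ?_ ?_).inter ?_).inter ?_).inter ?_).inter ?_
  · refine meas_ae (κ := cK F U) (q := fun p => p.2 0 = p.1.1) ?_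
    exact measurableSet_eq_fun ((measurable_eval 0).comp measurable_snd) measurable_fst.fst
  · refine MeasurableSet.iInter fun u => meas_ae (κ := cK F U) (q := fun p => LocInt fun r => ca F 𝕂 (p.1.2.1 u) r p.2) ?_
    exact meas_locInt (hA u)
  · refine MeasurableSet.iInter fun u => meas_ae (κ := cK F U) (q := fun p => Tendsto (fun n => tau (fun r => cb F (p.1.2.2.1 u) r p.2) n) atTop atTop) ?_
    exact meas_lim (hB u) (fun p => cb_Gr _ _)
  · refine MeasurableSet.iInter fun u => MeasurableSet.iInter fun n => MeasurableSet.iInter fun i =>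
      measurableSet_le ?_ measurable_const
    exact Measurable.lintegral_kernel_prod_right' (κ := cK F U) (hN u n _).enorm
  · refine MeasurableSet.iInter fun u => MeasurableSet.iInter fun n => MeasurableSet.iInter fun i =>
      MeasurableSet.iInter fun j => MeasurableSet.iInter fun hij => MeasurableSet.iInter fun k => ?_
    have hms : MeasurableSet (stp (denseSeq ℝ≥0 i) ⁻¹' (alg C(ℝ≥0, F) k)) :=
      measurable_stp _ (alg_meas k)
    have hh : ∀ s, Measurable fun p : F × Cd U => ∫ ω, (stp (denseSeq ℝ≥0 i) ⁻¹' (alg C(ℝ≥0, F) k)).indicator (NP (y u) (ca F 𝕂 (p.2.1 u)) (cb F (p.2.2.1 u)) n s) ω ∂(cK F U p) := by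
      intro s
      have h1 : Measurable fun p : (F × Cd U) × C(ℝ≥0, F) => (stp (denseSeq ℝ≥0 i) ⁻¹' (alg C(ℝ≥0, F) k)).indicator (NP (y u) (ca F 𝕂 (p.1.2.1 u)) (cb F (p.1.2.2.1 u)) n s) p.2 := by
        have e2 : (fun p : (F × Cd U) × C(ℝ≥0, F) => (stp (denseSeq ℝ≥0 i) ⁻¹' (alg C(ℝ≥0, F) k)).indicator (NP (y u) (ca F 𝕂 (p.1.2.1 u)) (cb F (p.1.2.2.1 u)) n s) p.2) = (Prod.snd ⁻¹' (stp (denseSeq ℝ≥0 i) ⁻¹' (alg C(ℝ≥0, F) k))).indicator (fun p : (F × Cd U) × C(ℝ≥0, F) => NP (y u) (ca F 𝕂 (p.1.2.1 u)) (cb F (p.1.2.2.1 u)) n s p.2) := by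
          funext p
          rfl
        rw [e2]
        exact (hN u n s).indicator (measurable_snd hms)
      exact (h1.stronglyMeasurable.integral_kernel_prod_right' (κ := cK F U)).measurable
    exact measurableSet_eq_fun (hh _) (hh _)
  · refine meas_ae (κ := cK F U) (q := fun p => ∀ᵐ r ∂leb, (fun u => ca F 𝕂 (p.1.2.1 u) r p.2) ∈ Θ₀ (p.2 r)) ?_
    refine meas_ae_leb (q := fun p : ((F × Cd U) × C(ℝ≥0, F)) × ℝ≥0 => (fun u => ca F 𝕂 (p.1.1.2.1 u) p.2 p.1.2) ∈ Θ₀ (p.1.2 p.2)) ?_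
    exact hS.gr_meas (a := fun u (p : ((F × Cd U) × C(ℝ≥0, F)) × ℝ≥0) => ca F 𝕂 (p.1.1.2.1 u) p.2 p.1.2) hA measurable_snd measurable_fst.snd

end Code

end PartT3

section PartT4

open TopologicalSpace (denseSeq denseRange_denseSeq)
section Pred

variable {F : Type*} [TopologicalSpace F] [PolishSpace F] [MeasurableSpace F] [BorelSpace F]
  [MeasurableSpace C(ℝ≥0, F)] [BorelSpace C(ℝ≥0, F)]
  {𝕂 : Type*} [RCLike 𝕂] [MeasurableSpace 𝕂] [BorelSpace 𝕂] {U : Type*} [Countable U]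

lemma dec_pred {X : Type*} [MeasurableSpace X] [StandardBorelSpace X] [Nonempty X]
    {f : ℝ≥0 × C(ℝ≥0, F) → X} (hf : Measurable f) (hs : ∀ r ω, f (r, stp r ω) = f (r, ω))
    (P : Measure C(ℝ≥0, F)) [IsProbabilityMeasure P] :
    ∃ k, ∀ᵐ ω ∂P, ∀ᵐ r ∂leb, dec (ℝ≥0 × C(ℝ≥0, F)) X k (r, stp r ω) = f (r, ω) := by
  let g : C(ℝ≥0, F) × ℝ≥0 → ℝ≥0 × C(ℝ≥0, F) := fun p => (p.2, stp p.2 p.1)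
  have hg : Measurable g := measurable_snd.prodMk (measurable_stp2.comp measurable_swap)
  obtain ⟨k, hk⟩ := dec_surj (((P.prod leb).toFinite).map g) hf
  refine ⟨k, ?_⟩
  have h1 := ae_of_ae_map hg.aemeasurable hk
  have h2 : ∀ᵐ p ∂(P.prod leb), dec (ℝ≥0 × C(ℝ≥0, F)) X k (g p) = f (g p) := by
    exact (absolutelyContinuous_toFinite _).ae_le h1
  filter_upwards [Measure.ae_ae_of_ae_prod h2] with ω hω
  filter_upwards [hω] with r hr
  rw [← hs]; exact hr

lemma pred_version {a : ℝ≥0 → C(ℝ≥0, F) → 𝕂} (ha : ProgMeasOn (shiftSig F 0) a) :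
    ∃ a' : ℝ≥0 → C(ℝ≥0, F) → 𝕂, (Measurable fun p : ℝ≥0 × C(ℝ≥0, F) => a' p.1 p.2) ∧
      (∀ r ω, a' r (stp r ω) = a' r ω) ∧ ∀ ω, LocInt (fun r => a r ω) → ∀ᵐ r ∂leb, a' r ω = a r ω := by
  have hmin : ∀ s, Measurable fun p : ℝ≥0 × C(ℝ≥0, F) => a (min p.1 s) p.2 := by
    intro s
    exact (ha s).mono (sup_le_sup le_rfl (MeasurableSpace.comap_mono (shift_le s))) le_rfl
  have hm : Measurable fun p : ℝ≥0 × C(ℝ≥0, F) => a p.1 p.2 := by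
    refine measurable_of_tendsto_metrizable (fun n : ℕ => hmin n) (tendsto_pi_nhds.2 fun p => ?_)
    obtain ⟨N, hN⟩ := exists_nat_ge p.1
    refine tendsto_atTop_of_eventually_const (i₀ := N) fun n hn => ?_
    rw [min_eq_left (hN.trans (by exact_mod_cast hn))]
  set A : ℝ≥0 → C(ℝ≥0, F) → 𝕂 := fun v ω => ∫ r in Iic v, a r ω ∂leb with hA
  have hAm : Measurable fun p : ℝ≥0 × C(ℝ≥0, F) => A p.1 p.2 := by
    have e : (fun p : ℝ≥0 × C(ℝ≥0, F) => A p.1 p.2) =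
        fun p => ∫ r, ({q : (ℝ≥0 × C(ℝ≥0, F)) × ℝ≥0 | q.2 ≤ q.1.1}.indicator (fun q => a q.2 q.1.2)) (p, r) ∂leb := by
      funext p
      simp only [hA]
      rw [← integral_indicator measurableSet_Iic]
      rfl
    rw [e]
    refine (StronglyMeasurable.integral_prod_right' (ν := leb) (Measurable.stronglyMeasurable ?_)).measurable
    exact (hm.comp (measurable_snd.prodMk measurable_fst.snd)).indicator
      (measurableSet_le measurable_snd measurable_fst.fst)
  have hAc : ∀ v, Measurable[shiftSig F 0 v] (A v) := by
    intro v
    have e : A v = fun ω => ∫ r, a (min r v) ω ∂(leb.restrict (Iic v)) := by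
      funext ω
      exact setIntegral_congr_fun measurableSet_Iic fun r (hr : r ≤ v) => by simp [hr]
    rw [e]
    have := @StronglyMeasurable.integral_prod_left' ℝ≥0 C(ℝ≥0, F) 𝕂 _ (shiftSig F 0 v) (leb.restrict (Iic v)) _ _ _ _ (ha v).stronglyMeasurable
    exact this.measurable
  have hAs : ∀ v r ω, v < r → A v (stp r ω) = A v ω := fun v r ω h =>
    canon_fun ((hAc v).mono (shift_le_canon h) le_rfl) le_rfl ω
  have hA0 : ∀ ω, A 0 ω = 0 := by intro ω; simp [hA, leb_Iic_zero]
  have hAs' : ∀ v r ω, v < r ∨ v = 0 → A v (stp r ω) = A v ω := by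
    rintro v r ω (h | rfl)
    · exact hAs v r ω h
    · rw [hA0, hA0]
  let q : ℕ → ℝ≥0 → C(ℝ≥0, F) → 𝕂 := fun n s ω => ((n : ℝ) + 1) • (A (s - ((n : ℝ≥0) + 1)⁻¹) ω - A (s - 2 * ((n : ℝ≥0) + 1)⁻¹) ω)
  have hsub : ∀ s c : ℝ≥0, 0 < c → s - c < s ∨ s - c = 0 := by
    intro s c hc
    rcases eq_or_ne s 0 with rfl | hs
    · right; simp
    · left; exact tsub_lt_self (pos_iff_ne_zero.2 hs) hc
  refine ⟨fun s ω => limUnder atTop (fun n => q n s ω), ?_, fun r ω => ?_, fun ω hω => ?_⟩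
  · refine (StronglyMeasurable.limUnder (f := fun n (p : ℝ≥0 × C(ℝ≥0, F)) => q n p.1 p.2) fun n => Measurable.stronglyMeasurable ?_).measurable
    refine Measurable.const_smul (Measurable.sub ?_ ?_) _
    · exact hAm.comp ((measurable_fst.sub_const _).prodMk measurable_snd)
    · exact hAm.comp ((measurable_fst.sub_const _).prodMk measurable_snd)
  · have : (fun n => q n r (stp r ω)) = fun n => q n r ω := by
      funext n
      simp only [q]
      rw [hAs' _ r ω (hsub r _ (by positivity)), hAs' _ r ω (hsub r _ (by positivity))]
    simp only [this]
  · filter_upwards [hω.diff] with r hr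
    exact hr.limUnder_eq

lemma ae_Iic_iff {v m : ℝ≥0} : (∀ᵐ r ∂leb, r ≤ v → r ≤ m) ↔ v ≤ m := by
  constructor
  · intro h
    by_contra hc
    rw [not_le] at hc
    have h1 : leb (Iic v \ Iic m) = 0 := by
      have : {r | ¬ (r ≤ v → r ≤ m)} = Iic v \ Iic m := by
        ext r; simp [and_comm]
      rw [← this]; exact h
    rw [measure_sdiff (Iic_subset_Iic.2 hc.le) measurableSet_Iic.nullMeasurableSet (by rw [leb_Iic]; simp),
      leb_Iic, leb_Iic] at h1
    rw [tsub_eq_zero_iff_le] at h1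
    exact absurd h1 (by simpa using hc)
  · intro h
    exact Eventually.of_forall fun r hr => hr.trans h

lemma tau_eq {b : ℝ≥0 → ℝ≥0} (hb : Gr b) {n : ℕ} {m : ℝ≥0} (h : ∀ᵐ r ∂leb, b r ≤ n ↔ r ≤ m) : tau b n = m := by
  refine eq_of_forall_le_iff fun v => ?_
  rw [le_tau_iff hb, ← ae_Iic_iff]
  constructor <;> intro h2 <;> filter_upwards [h, h2] with r h3 h4 h5
  · exact h3.1 (h4 h5)
  · exact h3.2 (h4 h5)

end Pred

end PartT4

section PartT5

open TopologicalSpace (denseSeq denseRange_denseSeq)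
section Lem2

variable {F : Type*} [TopologicalSpace F] [PolishSpace F] [MeasurableSpace F] [BorelSpace F]
  [MeasurableSpace C(ℝ≥0, F)] [BorelSpace C(ℝ≥0, F)]
  {𝕂 : Type*} [RCLike 𝕂] [MeasurableSpace 𝕂] [BorelSpace 𝕂] {U : Type*} [Countable U]

lemma stop_stp {σ : C(ℝ≥0, F) → ℝ≥0} (h : IsStoppingTimeOn (shiftSig F 0) σ) (s : ℝ≥0) (ω : C(ℝ≥0, F)) :
    σ (stp s ω) < s ↔ σ ω < s := by
  constructor
  · intro h1
    have := (canon_mem (shift_le_canon h1 _ (h (σ (stp s ω)))) le_rfl ω).1 (le_refl (σ (stp s ω)))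
    exact lt_of_le_of_lt this h1
  · intro h1
    have := (canon_mem (shift_le_canon h1 _ (h (σ ω))) le_rfl ω).2 (le_refl (σ ω))
    exact lt_of_le_of_lt this h1

lemma stop_meas {σ : C(ℝ≥0, F) → ℝ≥0} (h : IsStoppingTimeOn (shiftSig F 0) σ) : Measurable σ :=
  measurable_of_Iic fun t => shift_le t _ (h t)

open Classical in
/-- the controlling process -/
def bs (σ : ℕ → C(ℝ≥0, F) → ℝ≥0) (G : ℕ → ℝ≥0) (s : ℝ≥0) (ω : C(ℝ≥0, F)) : ℝ≥0∞ :=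
  ⨆ n : ℕ, if min (σ n ω) n < s then (G (n + 1) : ℝ≥0∞) else 0

lemma bs_meas {σ : ℕ → C(ℝ≥0, F) → ℝ≥0} (h : ∀ n, Measurable (σ n)) (G : ℕ → ℝ≥0) :
    Measurable fun p : ℝ≥0 × C(ℝ≥0, F) => bs σ G p.1 p.2 := by
  classical
  unfold bs
  refine Measurable.iSup fun n => ?_
  refine Measurable.ite ?_ measurable_const measurable_const
  exact measurableSet_lt (((h n).comp measurable_snd).min measurable_const) measurable_fst

lemma bs_stp {σ : ℕ → C(ℝ≥0, F) → ℝ≥0} (h : ∀ n, IsStoppingTimeOn (shiftSig F 0) (σ n)) (G : ℕ → ℝ≥0)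
    (s : ℝ≥0) (ω : C(ℝ≥0, F)) : bs σ G s (stp s ω) = bs σ G s ω := by
  unfold bs
  refine iSup_congr fun n => ?_
  simp only [min_lt_iff, stop_stp (h n)]

lemma bs_le {σ : ℕ → C(ℝ≥0, F) → ℝ≥0} {G : ℕ → ℝ≥0} {s N : ℝ≥0} {ω : C(ℝ≥0, F)}
    (hmono : ∀ n ω, σ n ω ≤ σ (n + 1) ω) {j : ℕ} (hj : N < G (j + 1)) (hj2 : ∀ i < j, G (i + 1) ≤ N) :
    bs σ G s ω ≤ N ↔ s ≤ min (σ j ω) j := by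
  classical
  have hm : Monotone fun n => min (σ n ω) (n : ℝ≥0) := by
    refine monotone_nat_of_le_succ fun n => min_le_min (hmono n ω) (by simp)
  unfold bs
  rw [iSup_le_iff]
  constructor
  · intro h
    by_contra hc
    have := h j
    rw [if_pos (not_le.1 hc)] at this
    exact absurd (ENNReal.coe_le_coe.1 this) (not_le.2 hj)
  · intro h n
    split_ifs with h1
    · rcases lt_or_ge n j with h2 | h2
      · exact_mod_cast hj2 n h2
      · exact absurd (h.trans (hm h2)) (not_le.2 h1)
    · exact zero_le

lemma bs_top {σ : ℕ → C(ℝ≥0, F) → ℝ≥0} {G : ℕ → ℝ≥0} {s : ℝ≥0} {ω : C(ℝ≥0, F)}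
    (hmono : ∀ n ω, σ n ω ≤ σ (n + 1) ω) (h : Tendsto (fun n => σ n ω) atTop atTop) : bs σ G s ω ≠ ⊤ := by
  classical
  obtain ⟨J, hJ⟩ := ((h.eventually_ge_atTop s).and (tendsto_natCast_atTop_atTop.eventually_ge_atTop s)).exists
  have hm : Monotone fun n => min (σ n ω) (n : ℝ≥0) := by
    refine monotone_nat_of_le_succ fun n => min_le_min (hmono n ω) (by simp)
  have : bs σ G s ω ≤ ((∑ i ∈ Finset.range J, G (i + 1) : ℝ≥0) : ℝ≥0∞) := by
    refine iSup_le fun n => ?_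
    split_ifs with h1
    · rcases lt_or_ge n J with h2 | h2
      · exact_mod_cast Finset.single_le_sum (f := fun i => G (i + 1)) (fun i _ => zero_le) (Finset.mem_range.2 h2)
      · exact absurd ((le_min hJ.1 hJ.2).trans (hm h2)) (not_le.2 h1)
    · exact zero_le
  exact ne_top_of_le_ne_top ENNReal.coe_ne_top this

lemma single {y : F → 𝕂} (hy : Measurable y) {P : Measure C(ℝ≥0, F)} [IsProbabilityMeasure P]
    {a : ℝ≥0 → C(ℝ≥0, F) → 𝕂} (ha : ProgMeasOn (shiftSig F 0) a)
    (hai : ∀ᵐ ω ∂P, LocInt fun r => a r ω)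
    (hloc : IsLocalMartingaleOn P (shiftSig F 0) (fun s ω => NN y (fun r => a r ω) ω s)) :
    ∃ k l, GD y P (ca F 𝕂 k) (cb F l) ∧
      (∀ n i, ∫⁻ ω, ‖NP y (ca F 𝕂 k) (cb F l) n (denseSeq ℝ≥0 i) ω‖ₑ ∂P ≤ n) ∧
      ∀ᵐ ω ∂P, ∀ᵐ r ∂leb, ca F 𝕂 k r ω = a r ω := by
  classical
  obtain ⟨a', ha'm, ha's, ha'e⟩ := pred_version ha
  obtain ⟨k, hk⟩ := dec_pred ha'm ha's P
  obtain ⟨σ, hσs, hσm, hσl, hM⟩ := hloc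
  set M : ℕ → ℝ≥0 → C(ℝ≥0, F) → 𝕂 := fun n s ω => NN y (fun r => a r ω) ω (min s (σ n ω)) with hMdef
  let G : ℕ → ℝ≥0 := fun n => n + (∫ ω, ‖M n n ω‖ ∂P).toNNReal
  have hGn : ∀ n : ℕ, (n : ℝ≥0) ≤ G n := fun n => le_add_of_nonneg_right zero_le
  have hGD : ∀ n : ℕ, ∫ ω, ‖M n n ω‖ ∂P ≤ G n := by
    intro n
    simp only [G, NNReal.coe_add]
    have := Real.le_coe_toNNReal (∫ ω, ‖M n n ω‖ ∂P)
    have h2 : (0:ℝ) ≤ ((n : ℝ≥0) : ℝ) := NNReal.coe_nonneg _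
    linarith
  have hbm : Measurable fun p : ℝ≥0 × C(ℝ≥0, F) => (bs σ G p.1 p.2).toNNReal :=
    (bs_meas (fun n => stop_meas (hσs n)) G).ennreal_toNNReal
  obtain ⟨l, hl⟩ := dec_pred hbm (fun r ω => by simp only [bs_stp hσs]) P
  have hex : ∀ N : ℕ, ∃ n, (N : ℝ≥0) < G (n + 1) := fun N => ⟨N, lt_of_lt_of_le (by exact_mod_cast N.lt_succ_self) (hGn (N + 1))⟩
  let J : ℕ → ℕ := fun N => Nat.find (hex N)
  have hJ1 : ∀ N : ℕ, (N : ℝ≥0) < G (J N + 1) := fun N => Nat.find_spec (hex N)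
  have hJ2 : ∀ N : ℕ, ∀ i < J N, G (i + 1) ≤ N := fun N i hi => not_lt.1 (Nat.find_min (hex N) hi)
  have hca : ∀ᵐ ω ∂P, ∀ᵐ r ∂leb, ca F 𝕂 k r ω = a r ω := by
    filter_upwards [hk, hai] with ω h1 h2
    filter_upwards [h1, ha'e ω h2] with r h3 h4
    exact h3.trans h4
  have htau : ∀ᵐ ω ∂P, ∀ N, tau (fun r => cb F l r ω) N = min (σ (J N) ω) (min (J N : ℝ≥0) N) := by
    filter_upwards [hl, hσl] with ω h1 h2 N
    refine tau_eq (cb_Gr l ω) ?_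
    filter_upwards [h1] with r hr
    unfold cb
    rw [hr, max_le_iff, ← min_assoc, le_min_iff, ← bs_le hσm (hJ1 N) (hJ2 N)]
    refine and_congr_left fun _ => ?_
    rw [← ENNReal.coe_le_coe, ENNReal.coe_toNNReal (bs_top hσm h2)]
  have hNP : ∀ N s, NP y (ca F 𝕂 k) (cb F l) N s =ᵐ[P] M (J N) (min s (min (J N : ℝ≥0) N)) := by
    intro N s
    filter_upwards [hca, htau] with ω h1 h2
    simp only [NP, NS, hMdef, h2]
    have e : min s (min (σ (J N) ω) (min (J N : ℝ≥0) N)) = min (min s (min (J N : ℝ≥0) N)) (σ (J N) ω) := by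
      rw [min_assoc, min_comm (σ (J N) ω)]
    rw [e]
    refine NN_congr_le le_rfl ?_ (fun _ _ => rfl)
    filter_upwards [h1] with r hr _ using hr
  refine ⟨k, l, ⟨cPD k l, ?_, ?_, ?_, ?_⟩, ?_, hca⟩
  · filter_upwards [hca, hai] with ω h1 h2 n
    exact (h2 n).congr (ae_restrict_of_ae (h1.mono fun r hr => hr.symm))
  · filter_upwards [htau, hσl] with ω h1 h2
    refine tendsto_atTop_atTop_of_monotone (fun n m hnm => tau_mono (cb_Gr l ω) hnm) fun c => ?_
    obtain ⟨I, hI⟩ := ((h2.eventually_ge_atTop c).and (tendsto_natCast_atTop_atTop.eventually_ge_atTop c)).exists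
    obtain ⟨N, hN⟩ := exists_nat_ge (c + ∑ i ∈ Finset.range I, G (i + 1))
    have hIN : I ≤ J N := by
      by_contra hc
      have h3 := Finset.single_le_sum (f := fun i => G (i + 1)) (fun i _ => zero_le) (Finset.mem_range.2 (not_le.1 hc))
      have h4 : G (J N + 1) ≤ N := (h3.trans (le_add_of_nonneg_left zero_le)).trans hN
      exact absurd h4 (not_le.2 (hJ1 N))
    have hmono : Monotone fun n => σ n ω := monotone_nat_of_le_succ fun n => hσm n ω
    refine ⟨N, ?_⟩
    rw [h1]
    exact le_min (hI.1.trans (hmono hIN)) (le_min (hI.2.trans (by exact_mod_cast hIN)) ((le_add_of_nonneg_right zero_le).trans hN))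
  · intro n i
    exact ((hM (J n)).2.1 _).congr (hNP n _).symm
  · intro n i j hij k'
    rw [setIntegral_congr_ae (measurable_stp _ (alg_meas k')) ((hNP n _).mono fun _ h _ => h),
      setIntegral_congr_ae (measurable_stp _ (alg_meas k')) ((hNP n _).mono fun _ h _ => h)]
    rcases le_total (denseSeq ℝ≥0 i) (min (J n : ℝ≥0) n) with h | h
    · rw [min_eq_left h]
      exact (hM (J n)).2.2 _ _ (le_min hij h) _ (canon_le_shift _ _ (measurable_stp_canon _ (alg_meas k')))
    · rw [min_eq_right h, min_eq_right (h.trans hij)]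
  · intro n i
    have e : ∫⁻ ω, ‖NP y (ca F 𝕂 k) (cb F l) n (denseSeq ℝ≥0 i) ω‖ₑ ∂P =
        ∫⁻ ω, ‖M (J n) (min (denseSeq ℝ≥0 i) (min (J n : ℝ≥0) n)) ω‖ₑ ∂P :=
      lintegral_congr_ae ((hNP n (denseSeq ℝ≥0 i)).mono fun ω h => by simp only [h])
    rw [e]
    set v := min (denseSeq ℝ≥0 i) (min (J n : ℝ≥0) n) with hv
    have hvJ : v ≤ J n := (min_le_right _ _).trans (min_le_left _ _)
    rcases Nat.eq_zero_or_pos (J n) with h0 | h0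
    · have hv0 : v = 0 := by
        rw [h0] at hvJ; simpa using hvJ
      have : ∀ ω, M (J n) v ω = 0 := by
        intro ω
        simp only [hMdef, hv0]
        simp [NN_zero]
      simp [this]
    · have h1 := integral_norm_mart_le (shift_le v) ((hM (J n)).2.1 (J n)) ((hM (J n)).1 v) ((hM (J n)).2.1 v)
        (fun A hA => ((hM (J n)).2.2 v (J n) hvJ A hA).symm)
      have h2 : G (J n) ≤ n := by
        have := hJ2 n (J n - 1) (by omega)
        rwa [Nat.sub_add_cancel h0] at this
      have h3 : ∫ ω, ‖M (J n) v ω‖ ∂P ≤ (n : ℝ) := h1.trans ((hGD (J n)).trans (by exact_mod_cast h2))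
      rw [← ofReal_integral_norm_eq_lintegral_enorm ((hM (J n)).2.1 v)]
      exact (ENNReal.ofReal_le_ofReal h3).trans (by simp)

variable {Y : U → ℝ≥0 → C(ℝ≥0, F) → 𝕂} {y : U → F → 𝕂} {Θ₀ : F → Set (U → 𝕂)}

lemma exists_code [Nonempty F] (hS : Std Y y Θ₀) {x : F} {P : ProbabilityMeasure C(ℝ≥0, F)} (hP : P ∈ RSet Y Θ₀ x) :
    ∃ z : Cd U, BAdm y Θ₀ x z ∧ cP F z.2.2 = P := by
  obtain ⟨h0, a, h1, h2, h3, h4⟩ := hP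
  have h2' : ∀ u, ∀ᵐ ω ∂(P : Measure C(ℝ≥0, F)), LocInt fun r => a u r ω := fun u =>
    (h2 u).mono fun ω h n => h n
  have h3' : ∀ u, IsLocalMartingaleOn (P : Measure C(ℝ≥0, F)) (shiftSig F 0) (fun s ω => NN (y u) (fun r => a u r ω) ω s) := by
    intro u
    have := h3 u
    simp only [hS.eq, add_zero] at this
    exact this
  choose k l hg hb he using fun u => single (hS.meas u) (h1 u) (h2' u) (h3' u)
  obtain ⟨c, hc⟩ := mc_surj (P : Measure C(ℝ≥0, F))
  have hc' : cP F c = P := hc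
  refine ⟨(k, l, c), ⟨⟨?_, ?_, ?_⟩, ?_⟩, hc⟩ <;> simp only [hc']
  · simpa using h0
  · exact hg
  · have hsw : ∀ᵐ p ∂((P : Measure C(ℝ≥0, F)).prod leb), (fun u => a u p.2 p.1) ∈ Θ₀ (p.1 p.2) := by
      have := (Measure.measurePreserving_swap (μ := (P : Measure C(ℝ≥0, F))) (ν := leb)).quasiMeasurePreserving.ae h4
      simpa using this
    filter_upwards [Measure.ae_ae_of_ae_prod hsw, ae_all_iff.2 he] with ω hω h5
    filter_upwards [hω, ae_all_iff.2 h5] with r hr h6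
    simp only [h6]; exact hr
  · exact hb

end Lem2

end PartT5

section PartT6

open TopologicalSpace (denseSeq denseRange_denseSeq)
section NlE

variable {F : Type*} [TopologicalSpace F] [PolishSpace F] [MeasurableSpace F] [BorelSpace F]
  [MeasurableSpace C(ℝ≥0, F)] [BorelSpace C(ℝ≥0, F)]
  {𝕂 : Type*} [RCLike 𝕂] [MeasurableSpace 𝕂] [BorelSpace 𝕂] {U : Type*} [Countable U]
  {Y : U → ℝ≥0 → C(ℝ≥0, F) → 𝕂} {y : U → F → 𝕂} {Θ₀ : F → Set (U → 𝕂)} {ψ : C(ℝ≥0, F) → ℝ} {M : ℝ}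

lemma analytic_inter {X : Type*} [TopologicalSpace X] [T2Space X] {s t : Set X} (h1 : AnalyticSet s) (h2 : AnalyticSet t) :
    AnalyticSet (s ∩ t) := by
  rw [inter_eq_iInter]
  exact AnalyticSet.iInter fun b => by cases b <;> assumption

lemma abs_integral_le {Ω' : Type*} [MeasurableSpace Ω'] {P : Measure Ω'} [IsProbabilityMeasure P] {f : Ω' → ℝ}
    (hM : ∀ ω, |f ω| ≤ M) : |∫ ω, f ω ∂P| ≤ M := by
  have := norm_integral_le_of_norm_le_const (μ := P) (f := f) (C := M) (Eventually.of_forall hM)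
  simpa using this

lemma nl_bdd (hM : ∀ ω, |ψ ω| ≤ M) (x : F) : BddAbove ((fun P : ProbabilityMeasure C(ℝ≥0, F) =>
    ∫ ω', ψ ω' ∂(P : Measure C(ℝ≥0, F))) '' RSet Y Θ₀ x) := by
  refine ⟨M, ?_⟩
  rintro _ ⟨P, -, rfl⟩
  exact (le_abs_self _).trans (abs_integral_le hM)

lemma le_nl (hM : ∀ ω, |ψ ω| ≤ M) {x : F} {P : ProbabilityMeasure C(ℝ≥0, F)} (hP : P ∈ RSet Y Θ₀ x) :
    ∫ ω', ψ ω' ∂(P : Measure C(ℝ≥0, F)) ≤ nlExp Y Θ₀ ψ x :=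
  le_csSup (nl_bdd hM x) ⟨P, hP, rfl⟩

lemma nl_abs (hM : ∀ ω, |ψ ω| ≤ M) {x : F} (hne : (RSet Y Θ₀ x).Nonempty) : |nlExp Y Θ₀ ψ x| ≤ M := by
  rw [abs_le]
  constructor
  · obtain ⟨P, hP⟩ := hne
    exact (abs_le.1 (abs_integral_le hM)).1.trans (le_nl hM hP)
  · refine csSup_le (hne.image _) ?_
    rintro _ ⟨P, -, rfl⟩
    exact (le_abs_self _).trans (abs_integral_le hM)

lemma lt_nl [Nonempty F] (hS : Std Y y Θ₀) (hM : ∀ ω, |ψ ω| ≤ M) {x : F} (hne : (RSet Y Θ₀ x).Nonempty) (c : ℝ) :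
    c < nlExp Y Θ₀ ψ x ↔ ∃ z : Cd U, BAdm y Θ₀ x z ∧ c < ∫ ω, ψ ω ∂(cP F z.2.2) := by
  unfold nlExp
  rw [lt_csSup_iff (nl_bdd hM x) (hne.image _)]
  constructor
  · rintro ⟨_, ⟨P, hP, rfl⟩, h⟩
    obtain ⟨z, hz, e⟩ := exists_code hS hP
    exact ⟨z, hz, by rw [e]; exact h⟩
  · rintro ⟨z, hz, h⟩
    exact ⟨_, ⟨⟨cP F z.2.2, inferInstance⟩, Adm.mem hS hz.1, rfl⟩, h⟩

lemma cPmeas [Nonempty F] : Measurable (cP F) := mc_meas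

lemma code_analytic [Nonempty F] (hS : Std Y y Θ₀) (hM : ∀ ω, |ψ ω| ≤ M) (hψ : UpperSemianalytic ψ) (c : ℝ) :
    AnalyticSet {p : F × Cd U | BAdm y Θ₀ p.1 p.2 ∧ c < ∫ ω, ψ ω ∂(cP F p.2.2.2)} := by
  have h1 : AnalyticSet {p : F × Cd U | BAdm y Θ₀ p.1 p.2} := (BAdm_meas hS).analyticSet
  have h2 : AnalyticSet {p : F × Cd U | c < ∫ ω, ψ ω ∂(cP F p.2.2.2)} :=
    analyticSet_lt_integral hψ hM (fun p : F × Cd U => cP F p.2.2.2)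
      (cPmeas.comp measurable_snd.snd.snd) c
  exact analytic_inter h1 h2

lemma nl_usa [Nonempty F] (hS : Std Y y Θ₀) (hM : ∀ ω, |ψ ω| ≤ M) (hψ : UpperSemianalytic ψ)
    (hne : ∀ x, (RSet Y Θ₀ x).Nonempty) (c : ℝ) : AnalyticSet {x | c < nlExp Y Θ₀ ψ x} := by
  have : {x | c < nlExp Y Θ₀ ψ x} = Prod.fst '' {p : F × Cd U | BAdm y Θ₀ p.1 p.2 ∧ c < ∫ ω, ψ ω ∂(cP F p.2.2.2)} := by
    ext x
    simp only [mem_setOf_eq, mem_image, Prod.exists, exists_and_right, exists_eq_right, lt_nl hS hM (hne x) c]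
  rw [this]
  exact (code_analytic hS hM hψ c).image_of_continuous continuous_fst

lemma nl_aem [Nonempty F] (hS : Std Y y Θ₀) (hM : ∀ ω, |ψ ω| ≤ M) (hψ : UpperSemianalytic ψ)
    (hne : ∀ x, (RSet Y Θ₀ x).Nonempty) (μ : Measure F) [IsFiniteMeasure μ] : AEMeasurable (nlExp Y Θ₀ ψ) μ :=
  aemeas_of_analytic (nl_usa hS hM hψ hne) μ

lemma nl_select [Nonempty F] (hS : Std Y y Θ₀) (hM : ∀ ω, |ψ ω| ≤ M) (hψ : UpperSemianalytic ψ)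
    (hne : ∀ x, (RSet Y Θ₀ x).Nonempty) (μ : Measure F) [IsFiniteMeasure μ] {ε : ℝ} (hε : 0 < ε) :
    ∃ f : F → Cd U, Measurable f ∧ ∀ᵐ x ∂μ, BAdm y Θ₀ x (f x) ∧
      nlExp Y Θ₀ ψ x - ε < ∫ ω, ψ ω ∂(cP F (f x).2.2) := by
  have ham := nl_aem hS hM hψ hne μ
  set h := ham.mk _ with hh
  have hm : Measurable h := ham.measurable_mk
  have hS' : AnalyticSet {p : F × Cd U | BAdm y Θ₀ p.1 p.2 ∧ h p.1 - ε < ∫ ω, ψ ω ∂(cP F p.2.2.2)} := by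
    have e : {p : F × Cd U | BAdm y Θ₀ p.1 p.2 ∧ h p.1 - ε < ∫ ω, ψ ω ∂(cP F p.2.2.2)} =
        ⋃ q : ℚ, {p : F × Cd U | h p.1 - ε < q} ∩ {p : F × Cd U | BAdm y Θ₀ p.1 p.2 ∧ (q : ℝ) < ∫ ω, ψ ω ∂(cP F p.2.2.2)} := by
      ext p
      simp only [mem_setOf_eq, mem_iUnion, mem_inter_iff]
      constructor
      · rintro ⟨h1, h2⟩
        obtain ⟨q, hq1, hq2⟩ := exists_rat_btwn h2
        exact ⟨q, hq1, h1, hq2⟩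
      · rintro ⟨q, hq1, h1, hq2⟩
        exact ⟨h1, hq1.trans hq2⟩
    rw [e]
    refine AnalyticSet.iUnion fun q => analytic_inter (MeasurableSet.analyticSet ?_) (code_analytic hS hM hψ q)
    exact measurableSet_lt ((hm.comp measurable_fst).sub_const ε) measurable_const
  obtain ⟨f, hf, hf2⟩ := measurable_selection hS' μ (by
    filter_upwards [ham.ae_eq_mk] with x hx
    have : h x - ε < nlExp Y Θ₀ ψ x := by rw [hx]; linarith
    exact (lt_nl hS hM (hne x) _).1 this)
  refine ⟨f, hf, ?_⟩
  filter_upwards [hf2, ham.ae_eq_mk] with x hx hx2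
  rw [hx2]; exact hx

end NlE

end PartT6

section PartT7

open TopologicalSpace (denseSeq denseRange_denseSeq)
open ProbabilityTheory (Kernel IsMarkovKernel)
open scoped ProbabilityTheory
section Dis

variable {F : Type*} [TopologicalSpace F] [PolishSpace F] [MeasurableSpace F] [BorelSpace F]
  [MeasurableSpace C(ℝ≥0, F)] [BorelSpace C(ℝ≥0, F)]
  {𝕂 : Type*} [RCLike 𝕂] [MeasurableSpace 𝕂] [BorelSpace 𝕂] {U : Type*} [Countable U]

/-- disintegration at time `t` -/
def Dis (t : ℝ≥0) (P π : Measure C(ℝ≥0, F)) (κ : Kernel C(ℝ≥0, F) C(ℝ≥0, F)) : Prop :=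
  π ⊗ₘ κ = P.map (fun ω => (stp t ω, theta t ω))

variable {t : ℝ≥0} {P π : Measure C(ℝ≥0, F)} [IsProbabilityMeasure P] [IsProbabilityMeasure π]
  {κ : Kernel C(ℝ≥0, F) C(ℝ≥0, F)} [IsMarkovKernel κ]

lemma meas_st (t : ℝ≥0) : Measurable fun ω : C(ℝ≥0, F) => (stp t ω, theta t ω) :=
  (measurable_stp t).prodMk (measurable_theta t)

lemma exists_dis (t : ℝ≥0) (P : Measure C(ℝ≥0, F)) [IsProbabilityMeasure P] :
    ∃ κ : Kernel C(ℝ≥0, F) C(ℝ≥0, F), IsMarkovKernel κ ∧ Dis t P (P.map (stp t)) κ := by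
  haveI : Nonempty C(ℝ≥0, F) := P.nonempty_of_neZero
  haveI : IsProbabilityMeasure (P.map (fun ω : C(ℝ≥0, F) => (stp t ω, theta t ω))) :=
    Measure.isProbabilityMeasure_map (meas_st t).aemeasurable
  set m := P.map (fun ω : C(ℝ≥0, F) => (stp t ω, theta t ω)) with hm
  refine ⟨m.condKernel, inferInstance, ?_⟩
  unfold Dis
  have : P.map (stp t) = m.fst := by
    rw [hm, Measure.fst, Measure.map_map measurable_fst (meas_st t)]; rfl
  rw [this]
  exact m.disintegrate m.condKernel

lemma Dis.fst (h : Dis t P π κ) : π = P.map (stp t) := by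
  have : (π ⊗ₘ κ).fst = π := Measure.fst_compProd π κ
  rw [← this, h, Measure.fst, Measure.map_map measurable_fst (meas_st t)]; rfl

lemma Dis.map_cat (h : Dis t P π κ) : (π ⊗ₘ κ).map (fun p => cat t p.1 p.2) = P := by
  rw [h, Measure.map_map (measurable_cat t) (meas_st t)]
  have : ((fun p : C(ℝ≥0, F) × C(ℝ≥0, F) => cat t p.1 p.2) ∘ fun ω => (stp t ω, theta t ω)) = id := by
    ext1 ω; exact cat_stp_theta t ω
  rw [this, Measure.map_id]

lemma Dis.ae (h : Dis t P π κ) {p : C(ℝ≥0, F) → Prop} (hp : ∀ᵐ ω ∂P, p ω) :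
    ∀ᵐ η ∂π, ∀ᵐ ω ∂(κ η), p (cat t η ω) := by
  rw [← h.map_cat] at hp
  exact Measure.ae_ae_of_ae_compProd (p := fun q => p (cat t q.1 q.2))
    (ae_of_ae_map (measurable_cat t).aemeasurable hp)

lemma Dis.ae0 (h : Dis t P π κ) : ∀ᵐ η ∂π, ∀ᵐ ω ∂(κ η), η t = ω 0 := by
  refine Measure.ae_ae_of_ae_compProd (p := fun q : C(ℝ≥0, F) × C(ℝ≥0, F) => q.1 t = q.2 0) ?_
  rw [h, ae_map_iff (meas_st t).aemeasurable]
  · exact Eventually.of_forall fun ω => by simp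
  · exact measurableSet_eq_fun ((measurable_eval t).comp measurable_fst) ((measurable_eval 0).comp measurable_snd)

lemma Dis.int (h : Dis t P π κ) {g : C(ℝ≥0, F) → 𝕂} (hg : Integrable g P) :
    Integrable (fun q : C(ℝ≥0, F) × C(ℝ≥0, F) => g (cat t q.1 q.2)) (π ⊗ₘ κ) := by
  rw [← h.map_cat] at hg
  exact hg.comp_measurable (measurable_cat t)

lemma Dis.int_ae (h : Dis t P π κ) {g : C(ℝ≥0, F) → 𝕂} (hg : Integrable g P) :
    ∀ᵐ η ∂π, Integrable (fun ω => g (cat t η ω)) (κ η) :=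
  ((Measure.integrable_compProd_iff (h.int hg).1).1 (h.int hg)).1

lemma Dis.zero (h : Dis t P π κ) {g : C(ℝ≥0, F) → 𝕂} (hg : Integrable g P)
    (h0 : ∀ B, MeasurableSet B → ∫ ω in stp t ⁻¹' B, g ω ∂P = 0) :
    ∀ᵐ η ∂π, ∫ ω, g (cat t η ω) ∂(κ η) = 0 := by
  have hi := h.int hg
  have hi2 : Integrable (fun η => ∫ ω, g (cat t η ω) ∂(κ η)) π := by
    have := ((Measure.integrable_compProd_iff hi.1).1 hi).2
    have hi' : Integrable (fun q : C(ℝ≥0, F) × C(ℝ≥0, F) => g (cat t q.1 q.2)) ((Kernel.const Unit π ⊗ₖ Kernel.prodMkLeft Unit κ) ()) := hi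
    exact hi'.integral_compProd
  refine hi2.ae_eq_zero_of_forall_setIntegral_eq_zero fun B hB _ => ?_
  rw [← h0 B hB]
  have := Measure.setIntegral_compProd hB MeasurableSet.univ hi.integrableOn
  simp only [Measure.restrict_univ] at this
  rw [← this]
  have e : P = (π ⊗ₘ κ).map (fun p => cat t p.1 p.2) := h.map_cat.symm
  have hg' := hg.1
  rw [h, setIntegral_map (hB.prod MeasurableSet.univ) _ (meas_st t).aemeasurable]
  · simp only [cat_stp_theta]
    congr 2
    ext ω; simp
  · rw [← h]; exact hi.1

end Dis

end PartT7

section PartT8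

open TopologicalSpace (denseSeq denseRange_denseSeq)
open ProbabilityTheory (Kernel IsMarkovKernel)
open scoped ProbabilityTheory
section Shc

variable {F : Type*} [TopologicalSpace F] [PolishSpace F] [MeasurableSpace F] [BorelSpace F]
  [MeasurableSpace C(ℝ≥0, F)] [BorelSpace C(ℝ≥0, F)]
  {𝕂 : Type*} [RCLike 𝕂] [MeasurableSpace 𝕂] [BorelSpace 𝕂] {U : Type*} [Countable U]
  {t : ℝ≥0} {y : F → 𝕂} {a : ℝ≥0 → C(ℝ≥0, F) → 𝕂} {b : ℝ≥0 → C(ℝ≥0, F) → ℝ≥0} {η : C(ℝ≥0, F)}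

lemma Gr.max {b : ℝ≥0 → ℝ≥0} (hb : Gr b) (N : ℝ≥0) : Gr fun r => max (b r) N := by
  obtain ⟨c, hc⟩ := hb
  exact ⟨c, fun r => (hc r).trans (by gcongr; exact le_max_left _ _)⟩

lemma tau_max_ge {b : ℝ≥0 → ℝ≥0} {n N : ℕ} (h : N ≤ n) : tau (fun r => max (b r) N) n = tau b n := by
  unfold tau
  congr 1
  ext v
  have : (N : ℝ≥0) ≤ n := by exact_mod_cast h
  simp [this]

lemma tau_max_lt {b : ℝ≥0 → ℝ≥0} (hb : Gr b) {n N : ℕ} (h : n < N) : tau (fun r => max (b r) N) n = 0 := by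
  have h1 := (le_tau_iff (hb.max N)).1 (le_refl (tau (fun r => max (b r) N) n))
  have h2 : ¬ ((N : ℝ≥0) ≤ n) := by
    rw [not_le]; exact_mod_cast h
  simp only [max_le_iff, h2, and_false, imp_false] at h1
  have : leb (Iic (tau (fun r => max (b r) N) n)) = 0 := by
    rw [ae_iff] at h1
    simp only [not_not] at h1
    exact h1
  rw [leb_Iic] at this
  exact_mod_cast this

lemma PD.stpb (h : PD a b) {r s : ℝ≥0} (hr : r ≤ s) {ω ω' : C(ℝ≥0, F)} (e : stp s ω = stp s ω') : b r ω = b r ω' := by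
  rw [← h.ba r ω, ← h.ba r ω', ← stp_stp_of_le hr ω, ← stp_stp_of_le hr ω', e]

lemma PD.stpa (h : PD a b) {r s : ℝ≥0} (hr : r ≤ s) {ω ω' : C(ℝ≥0, F)} (e : stp s ω = stp s ω') : a r ω = a r ω' := by
  rw [← h.aa r ω, ← h.aa r ω', ← stp_stp_of_le hr ω, ← stp_stp_of_le hr ω', e]

lemma PD.tau_stp (h : PD a b) {s : ℝ≥0} {ω ω' : C(ℝ≥0, F)} (e : stp s ω = stp s ω') (n : ℕ) :
    min s (tau (fun r => b r ω) n) = min s (tau (fun r => b r ω') n) :=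
  tau_min (h.bg _) (h.bg _) (Eventually.of_forall fun r hr => h.stpb hr e) n

lemma PD.le_tau_stp (h : PD a b) {s : ℝ≥0} {ω ω' : C(ℝ≥0, F)} (e : stp s ω = stp s ω') (n : ℕ) :
    s ≤ tau (fun r => b r ω) n ↔ s ≤ tau (fun r => b r ω') n := by
  rw [← min_eq_left_iff, ← min_eq_left_iff, h.tau_stp e]

lemma PD.shiftc (h : PD a b) (t : ℝ≥0) (η : C(ℝ≥0, F)) (N : ℕ) :
    PD (fun r ω => a (r + t) (cat t η ω)) (fun r ω => max (b (r + t) (cat t η ω)) N) := by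
  have hm : Measurable fun p : C(ℝ≥0, F) × ℝ≥0 => (cat t η p.1, p.2 + t) :=
    ((measurable_cat t).comp (measurable_const.prodMk measurable_fst)).prodMk (measurable_snd.add_const t)
  refine ⟨h.am.comp hm, fun r ω => ?_, (h.bm.comp hm).max measurable_const, fun r ω => ?_, fun ω => ?_⟩
  · exact h.stpa le_rfl (stp_cat_stp t r η ω)
  · simp only [h.stpb le_rfl (stp_cat_stp t r η ω)]
  · exact ((h.bg _).shift t).max N

lemma LocInt.shift {f : ℝ≥0 → 𝕂} (h : LocInt f) (t : ℝ≥0) : LocInt fun r => f (r + t) := by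
  intro n
  exact (intOn_shift (f := f) (s := n) (t := t)).1 (h.on _) |>.2

lemma NP_shiftc (h : PD a b) {N : ℕ} (hN : t ≤ tau (fun r => b r η) N) {ω : C(ℝ≥0, F)} (h0 : η t = ω 0)
    (hl : LocInt fun r => a r (cat t η ω)) {n : ℕ} (hn : N ≤ n) (s : ℝ≥0) :
    NP y (fun r ω => a (r + t) (cat t η ω)) (fun r ω => max (b (r + t) (cat t η ω)) N) n s ω =
      NP y a b n (s + t) (cat t η ω) - NP y a b n t (cat t η ω) := by
  have h1 : t ≤ tau (fun r => b r (cat t η ω)) n := by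
    rw [h.le_tau_stp (stp_cat t t le_rfl η ω)]
    exact hN.trans (tau_mono (h.bg _) hn)
  simp only [NP]
  rw [NS_shift hl (h.bg _) h1, add_sub_cancel_left, theta_cat h0]
  unfold NS
  rw [tau_max_ge hn]

lemma NP_shiftc_lt (h : PD a b) {N : ℕ} {n : ℕ} (hn : n < N) (s : ℝ≥0) (ω : C(ℝ≥0, F)) :
    NP y (fun r ω => a (r + t) (cat t η ω)) (fun r ω => max (b (r + t) (cat t η ω)) N) n s ω = 0 := by
  simp only [NP]
  unfold NS
  rw [tau_max_lt ((h.bg _).shift t) hn, min_eq_right zero_le, NN_zero]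

lemma PD.gd (h : PD a b) {ν : Measure C(ℝ≥0, F)} [IsProbabilityMeasure ν] {N : ℕ} (hN : t ≤ tau (fun r => b r η) N)
    (h0 : ∀ᵐ ω ∂ν, η t = ω 0) (hai : ∀ᵐ ω ∂ν, LocInt fun r => a r (cat t η ω))
    (hlim : ∀ᵐ ω ∂ν, Tendsto (fun n => tau (fun r => b r (cat t η ω)) n) atTop atTop)
    (hi0 : ∀ n, Integrable (fun ω => NP y a b n t (cat t η ω)) ν)
    (hi : ∀ n i, Integrable (fun ω => NP y a b n (denseSeq ℝ≥0 i + t) (cat t η ω)) ν)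
    (hm : ∀ n i j, denseSeq ℝ≥0 i ≤ denseSeq ℝ≥0 j → ∀ k,
      ∫ ω, ((theta t ⁻¹' (stp (denseSeq ℝ≥0 i) ⁻¹' (alg C(ℝ≥0, F) k))).indicator
        (fun ω => NP y a b n (denseSeq ℝ≥0 j + t) ω - NP y a b n (denseSeq ℝ≥0 i + t) ω)) (cat t η ω) ∂ν = 0) :
    GD y ν (fun r ω => a (r + t) (cat t η ω)) (fun r ω => max (b (r + t) (cat t η ω)) N) := by
  have hI : ∀ n i, Integrable (NP y (fun r ω => a (r + t) (cat t η ω)) (fun r ω => max (b (r + t) (cat t η ω)) N) n (denseSeq ℝ≥0 i)) ν := by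
    intro n i
    rcases lt_or_ge n N with hn | hn
    · have : NP y (fun r ω => a (r + t) (cat t η ω)) (fun r ω => max (b (r + t) (cat t η ω)) N) n (denseSeq ℝ≥0 i) = 0 := by
        ext1 ω; exact NP_shiftc_lt h hn _ ω
      rw [this]; exact integrable_zero _ _ _
    · refine ((hi n i).sub (hi0 n)).congr ?_
      filter_upwards [h0, hai] with ω h1 h2
      exact (NP_shiftc h hN h1 h2 hn _).symm
  refine ⟨h.shiftc t η N, ?_, ?_, hI, ?_⟩
  · filter_upwards [hai] with ω hω
    exact hω.shift t
  · filter_upwards [hlim] with ω hω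
    refine tendsto_atTop.2 fun c => ?_
    filter_upwards [tendsto_atTop.1 hω (c + t), eventually_ge_atTop N] with n h1 h2
    rw [tau_max_ge h2]
    rw [tau_shift (h.bg _) (le_add_self.trans h1)] at h1
    exact le_of_add_le_add_right h1
  · intro n i j hij k
    have hA : MeasurableSet (stp (F := F) (denseSeq ℝ≥0 i) ⁻¹' (alg C(ℝ≥0, F) k)) := measurable_stp _ (alg_meas k)
    rcases lt_or_ge n N with hn | hn
    · simp only [NP_shiftc_lt h hn]
    · rw [← sub_eq_zero, ← integral_sub (hI n j).integrableOn (hI n i).integrableOn, ← hm n i j hij k,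
        ← integral_indicator hA]
      refine integral_congr_ae ?_
      filter_upwards [h0, hai] with ω h1 h2
      have e1 := NP_shiftc (y := y) h hN h1 h2 hn (denseSeq ℝ≥0 i)
      have e2 := NP_shiftc (y := y) h hN h1 h2 hn (denseSeq ℝ≥0 j)
      by_cases hω : ω ∈ stp (F := F) (denseSeq ℝ≥0 i) ⁻¹' (alg C(ℝ≥0, F) k)
      · have hω' : cat t η ω ∈ theta t ⁻¹' (stp (F := F) (denseSeq ℝ≥0 i) ⁻¹' (alg C(ℝ≥0, F) k)) := by
          rw [mem_preimage, theta_cat h1]; exact hω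
        rw [indicator_of_mem hω, indicator_of_mem hω', e1, e2]; ring
      · have hω' : cat t η ω ∉ theta t ⁻¹' (stp (F := F) (denseSeq ℝ≥0 i) ⁻¹' (alg C(ℝ≥0, F) k)) := by
          rw [mem_preimage, theta_cat h1]; exact hω
        rw [indicator_of_notMem hω, indicator_of_notMem hω']

end Shc

end PartT8

section PartT9

open TopologicalSpace (denseSeq denseRange_denseSeq)
open ProbabilityTheory (Kernel IsMarkovKernel)
open scoped ProbabilityTheory
section MLe

variable {F : Type*} [TopologicalSpace F] [PolishSpace F] [MeasurableSpace F] [BorelSpace F]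
  [MeasurableSpace C(ℝ≥0, F)] [BorelSpace C(ℝ≥0, F)]
  {𝕂 : Type*} [RCLike 𝕂] [MeasurableSpace 𝕂] [BorelSpace 𝕂] {U : Type*} [Countable U]
  {Y : U → ℝ≥0 → C(ℝ≥0, F) → 𝕂} {y : U → F → 𝕂} {Θ₀ : F → Set (U → 𝕂)} {ψ : C(ℝ≥0, F) → ℝ} {M : ℝ}
  {t : ℝ≥0} {P π : Measure C(ℝ≥0, F)} [IsProbabilityMeasure P] [IsProbabilityMeasure π]
  {κ : Kernel C(ℝ≥0, F) C(ℝ≥0, F)} [IsMarkovKernel κ] {x : F}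
  {a : U → ℝ≥0 → C(ℝ≥0, F) → 𝕂} {b : U → ℝ≥0 → C(ℝ≥0, F) → ℝ≥0}

lemma prob_eval_iff {ν : Measure C(ℝ≥0, F)} [IsProbabilityMeasure ν] {s : ℝ≥0} :
    ν {ω | ω s = x} = 1 ↔ ∀ᵐ ω ∂ν, ω s = x :=
  (mem_ae_iff_prob_eq_one (measurable_eval s (measurableSet_singleton x))).symm

lemma Dis.gd (h : Dis t P π κ) {y : F → 𝕂} (hy : Measurable y)
    (hyc : ∀ ω : C(ℝ≥0, F), ∀ s, ContinuousWithinAt (fun s => y (ω s)) (Ici s) s)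
    {a : ℝ≥0 → C(ℝ≥0, F) → 𝕂} {b : ℝ≥0 → C(ℝ≥0, F) → ℝ≥0} (hG : GD y P a b) :
    ∀ᵐ η ∂π, ∃ N : ℕ, GD y (κ η) (fun r ω => a (r + t) (cat t η ω)) (fun r ω => max (b (r + t) (cat t η ω)) N) := by
  have hf := hG.full hy hyc
  have hm : ∀ᵐ η ∂π, ∀ n i j, denseSeq ℝ≥0 i ≤ denseSeq ℝ≥0 j → ∀ k,
      ∫ ω, ((theta t ⁻¹' (stp (denseSeq ℝ≥0 i) ⁻¹' (alg C(ℝ≥0, F) k))).indicator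
        (fun ω => NP y a b n (denseSeq ℝ≥0 j + t) ω - NP y a b n (denseSeq ℝ≥0 i + t) ω)) (cat t η ω) ∂(κ η) = 0 := by
    simp only [ae_all_iff]
    intro n i j hij k
    have hA : MeasurableSet (theta (F := F) t ⁻¹' (stp (denseSeq ℝ≥0 i) ⁻¹' (alg C(ℝ≥0, F) k))) :=
      measurable_theta t (measurable_stp _ (alg_meas k))
    refine h.zero ((((hf n).1 _).sub ((hf n).1 _)).indicator hA) fun B hB => ?_
    have hB' := measurable_stp (F := F) t hB
    rw [setIntegral_indicator hA, integral_sub ((hf n).1 _).integrableOn ((hf n).1 _).integrableOn, sub_eq_zero]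
    refine (hf n).2 _ _ (by gcongr) _ (canon_le_shift _ _ (canon_of_stp (hB'.inter hA) fun ω => ?_))
    simp only [mem_inter_iff, mem_preimage, theta_stp, stp_stp_of_le (le_refl (denseSeq ℝ≥0 i)),
      stp_stp_of_le (le_add_self : t ≤ denseSeq ℝ≥0 i + t)]
  have hi : ∀ᵐ η ∂π, ∀ n i, Integrable (fun ω => NP y a b n (denseSeq ℝ≥0 i + t) (cat t η ω)) (κ η) := by
    simp only [ae_all_iff]
    intro n i
    exact h.int_ae ((hf n).1 _)
  have hi0 : ∀ᵐ η ∂π, ∀ n, Integrable (fun ω => NP y a b n t (cat t η ω)) (κ η) := by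
    simp only [ae_all_iff]
    intro n
    exact h.int_ae ((hf n).1 _)
  filter_upwards [hm, hi, hi0, h.ae hG.ai, h.ae hG.lim, h.ae0] with η h1 h2 h3 h4 h5 h6
  obtain ⟨ω, hω⟩ := h5.exists
  obtain ⟨N, hN⟩ := (tendsto_atTop.1 hω t).exists
  rw [hG.le_tau_stp (stp_cat t t le_rfl η ω)] at hN
  exact ⟨N, hG.toPD.gd hN h6 h4 h5 h3 h2 h1⟩

lemma Dis.mem (h : Dis t P π κ) (hS : Std Y y Θ₀) (hA : Adm y Θ₀ x P a b) :
    ∀ᵐ η ∂π, (⟨κ η, inferInstance⟩ : ProbabilityMeasure C(ℝ≥0, F)) ∈ RSet Y Θ₀ (η t) := by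
  have h1 : ∀ᵐ η ∂π, ∀ u, ∃ N : ℕ, GD (y u) (κ η) (fun r ω => a u (r + t) (cat t η ω))
      (fun r ω => max (b u (r + t) (cat t η ω)) N) := by
    rw [ae_all_iff]
    intro u
    exact h.gd (hS.meas u) (hS.rc u) (hA.2.1 u)
  filter_upwards [h1, h.ae hA.2.2, h.ae0] with η h2 h3 h4
  choose N hN using h2
  refine Adm.mem (y := y) (a := fun u r ω => a u (r + t) (cat t η ω))
    (b := fun u r ω => max (b u (r + t) (cat t η ω)) (N u)) hS ⟨?_, hN, ?_⟩
  · show κ η _ = 1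
    rw [prob_eval_iff]
    filter_upwards [h4] with ω hω using hω.symm
  · show ∀ᵐ ω ∂(κ η), _
    filter_upwards [h3, h4] with ω h5 h6
    have := ((ae_shift (t := t)).1 h5).2
    filter_upwards [this] with r hr
    rw [cat_apply_add h6] at hr
    exact hr

lemma usa_aem (hψ : UpperSemianalytic ψ) (ν : Measure C(ℝ≥0, F)) [IsFiniteMeasure ν] : AEMeasurable ψ ν :=
  aemeas_of_analytic hψ ν

lemma nl_int [Nonempty F] (hS : Std Y y Θ₀) (hM : ∀ ω, |ψ ω| ≤ M) (hψ : UpperSemianalytic ψ)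
    (hne : ∀ x, (RSet Y Θ₀ x).Nonempty) (ν : Measure C(ℝ≥0, F)) [IsProbabilityMeasure ν] (t : ℝ≥0) :
    Integrable (fun ω => nlExp Y Θ₀ ψ (ω t)) ν := by
  haveI : IsProbabilityMeasure (ν.map fun ω => ω t) := Measure.isProbabilityMeasure_map (measurable_eval t).aemeasurable
  have := (nl_aem hS hM hψ hne (ν.map fun ω => ω t)).comp_measurable (measurable_eval t)
  exact Integrable.of_bound this.aestronglyMeasurable M (Eventually.of_forall fun ω => nl_abs hM (hne _))

lemma markov_le [Nonempty F] (hS : Std Y y Θ₀) (hM : ∀ ω, |ψ ω| ≤ M) (hψ : UpperSemianalytic ψ)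
    (hne : ∀ x, (RSet Y Θ₀ x).Nonempty) {P : ProbabilityMeasure C(ℝ≥0, F)} (hP : P ∈ RSet Y Θ₀ x) (t : ℝ≥0) :
    ∫ ω, ψ (theta t ω) ∂(P : Measure C(ℝ≥0, F)) ≤ ∫ ω, nlExp Y Θ₀ ψ (ω t) ∂(P : Measure C(ℝ≥0, F)) := by
  obtain ⟨z, hz, e⟩ := exists_code hS hP
  have hA := hz.1
  rw [e] at hA
  obtain ⟨κ, hκ, h⟩ := exists_dis t (P : Measure C(ℝ≥0, F))
  haveI : IsProbabilityMeasure ((P : Measure C(ℝ≥0, F)).map (stp t)) :=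
    Measure.isProbabilityMeasure_map (measurable_stp t).aemeasurable
  set π := (P : Measure C(ℝ≥0, F)).map (stp t) with hπ
  haveI : IsProbabilityMeasure ((P : Measure C(ℝ≥0, F)).map (theta t)) :=
    Measure.isProbabilityMeasure_map (measurable_theta t).aemeasurable
  have hs : (P : Measure C(ℝ≥0, F)).map (theta t) = (π ⊗ₘ κ).map Prod.snd := by
    rw [h, Measure.map_map measurable_snd (meas_st t)]; rfl
  have hψ1 := usa_aem hψ ((P : Measure C(ℝ≥0, F)).map (theta t))
  have hψ2 := hψ1
  rw [hs] at hψ2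
  have hi : Integrable (fun p : C(ℝ≥0, F) × C(ℝ≥0, F) => ψ p.2) (π ⊗ₘ κ) :=
    Integrable.of_bound (hψ2.comp_measurable measurable_snd).aestronglyMeasurable M (Eventually.of_forall fun p => hM _)
  have hi2 : Integrable (fun η => ∫ ω, ψ ω ∂(κ η)) π := by
    have hi' : Integrable (fun p : C(ℝ≥0, F) × C(ℝ≥0, F) => ψ p.2) ((Kernel.const Unit π ⊗ₖ Kernel.prodMkLeft Unit κ) ()) := hi
    exact hi'.integral_compProd
  calc ∫ ω, ψ (theta t ω) ∂(P : Measure C(ℝ≥0, F))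
      = ∫ ω, ψ ω ∂((P : Measure C(ℝ≥0, F)).map (theta t)) :=
        (integral_map (measurable_theta t).aemeasurable hψ1.aestronglyMeasurable).symm
    _ = ∫ p, ψ p.2 ∂(π ⊗ₘ κ) := by
        rw [hs, integral_map measurable_snd.aemeasurable hψ2.aestronglyMeasurable]
    _ = ∫ η, ∫ ω, ψ ω ∂(κ η) ∂π := Measure.integral_compProd hi
    _ ≤ ∫ η, nlExp Y Θ₀ ψ (η t) ∂π := by
        refine integral_mono_ae hi2 (nl_int hS hM hψ hne π t) ?_
        filter_upwards [h.mem hS hA] with η hη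
        exact le_nl hM hη
    _ = ∫ ω, nlExp Y Θ₀ ψ (ω t) ∂(P : Measure C(ℝ≥0, F)) := by
        rw [hπ, integral_map (measurable_stp t).aemeasurable (nl_int hS hM hψ hne π t).1]
        simp

end MLe

end PartT9

section PartT10

open TopologicalSpace (denseSeq denseRange_denseSeq)
open ProbabilityTheory (Kernel IsMarkovKernel)
open scoped ProbabilityTheory
section Hat

variable {F : Type*} [TopologicalSpace F]

/-- pasting of processes at time `t` -/
def hat {E : Type*} (t : ℝ≥0) (a : ℝ≥0 → C(ℝ≥0, F) → E) (a' : F → ℝ≥0 → C(ℝ≥0, F) → E) (r : ℝ≥0)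
    (ω : C(ℝ≥0, F)) : E := if r ≤ t then a r ω else a' (ω t) (r - t) (theta t ω)

lemma hat_le {E : Type*} {t : ℝ≥0} {a : ℝ≥0 → C(ℝ≥0, F) → E} {a' : F → ℝ≥0 → C(ℝ≥0, F) → E} {r : ℝ≥0}
    (h : r ≤ t) (ω : C(ℝ≥0, F)) : hat t a a' r ω = a r ω := if_pos h

lemma hat_add {E : Type*} {t : ℝ≥0} {a : ℝ≥0 → C(ℝ≥0, F) → E} {a' : F → ℝ≥0 → C(ℝ≥0, F) → E} {r : ℝ≥0}
    (h : r ≠ 0) (ω : C(ℝ≥0, F)) : hat t a a' (r + t) ω = a' (ω t) r (theta t ω) := by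
  unfold hat
  rw [if_neg, add_tsub_cancel_right]
  simpa using h

lemma ae_ne_zero : ∀ᵐ r ∂leb, r ≠ 0 := by rw [ae_iff]; simp

lemma hat_add_ae {E : Type*} {t : ℝ≥0} {a : ℝ≥0 → C(ℝ≥0, F) → E} {a' : F → ℝ≥0 → C(ℝ≥0, F) → E}
    (ω : C(ℝ≥0, F)) : ∀ᵐ r ∂leb, hat t a a' (r + t) ω = a' (ω t) r (theta t ω) := by
  filter_upwards [ae_ne_zero] with r hr
  exact hat_add hr ω

variable [PolishSpace F] [MeasurableSpace F] [BorelSpace F]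
  [MeasurableSpace C(ℝ≥0, F)] [BorelSpace C(ℝ≥0, F)]
  {𝕂 : Type*} [RCLike 𝕂] [MeasurableSpace 𝕂] [BorelSpace 𝕂] {U : Type*} [Countable U]
  {t : ℝ≥0} {y : F → 𝕂} {a : ℝ≥0 → C(ℝ≥0, F) → 𝕂} {b : ℝ≥0 → C(ℝ≥0, F) → ℝ≥0}
  {a' : F → ℝ≥0 → C(ℝ≥0, F) → 𝕂} {b' : F → ℝ≥0 → C(ℝ≥0, F) → ℝ≥0}

lemma hat_meas {E : Type*} [MeasurableSpace E] (t : ℝ≥0) {a : ℝ≥0 → C(ℝ≥0, F) → E} {a' : F → ℝ≥0 → C(ℝ≥0, F) → E}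
    (ha : Measurable fun p : C(ℝ≥0, F) × ℝ≥0 => a p.2 p.1)
    (ha' : Measurable fun p : F × C(ℝ≥0, F) × ℝ≥0 => a' p.1 p.2.2 p.2.1) :
    Measurable fun p : C(ℝ≥0, F) × ℝ≥0 => hat t a a' p.2 p.1 := by
  unfold hat
  refine Measurable.ite (measurableSet_le measurable_snd measurable_const) ha ?_
  have : Measurable fun p : C(ℝ≥0, F) × ℝ≥0 => (p.1 t, theta t p.1, p.2 - t) :=
    ((measurable_eval t).comp measurable_fst).prodMk (((measurable_theta t).comp measurable_fst).prodMk
      (measurable_snd.sub_const t))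
  exact ha'.comp this

lemma hat_stp {E : Type*} {t : ℝ≥0} {a : ℝ≥0 → C(ℝ≥0, F) → E} {a' : F → ℝ≥0 → C(ℝ≥0, F) → E}
    (h1 : ∀ r ω, a r (stp r ω) = a r ω) (h2 : ∀ x r ω, a' x r (stp r ω) = a' x r ω) (r : ℝ≥0) (ω : C(ℝ≥0, F)) :
    hat t a a' r (stp r ω) = hat t a a' r ω := by
  unfold hat
  split_ifs with h
  · exact h1 r ω
  · have h' := (not_le.1 h).le
    obtain ⟨v, rfl⟩ := exists_add_of_le h'
    rw [add_comm t v, theta_stp, add_tsub_cancel_right, h2]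
    simp

/-- data after the pasting time -/
structure HD (a' : F → ℝ≥0 → C(ℝ≥0, F) → 𝕂) (b' : F → ℝ≥0 → C(ℝ≥0, F) → ℝ≥0) : Prop where
  am : Measurable fun p : F × C(ℝ≥0, F) × ℝ≥0 => a' p.1 p.2.2 p.2.1
  bm : Measurable fun p : F × C(ℝ≥0, F) × ℝ≥0 => b' p.1 p.2.2 p.2.1
  aa : ∀ x r ω, a' x r (stp r ω) = a' x r ω
  ba : ∀ x r ω, b' x r (stp r ω) = b' x r ω
  bg : ∀ x r ω, r ≤ b' x r ω

lemma HD.pd (h : HD a' b') (x : F) : PD (a' x) (b' x) :=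
  ⟨h.am.comp (measurable_const.prodMk measurable_id), h.aa x, h.bm.comp (measurable_const.prodMk measurable_id), h.ba x,
    fun ω => ⟨0, fun r => by simpa using h.bg x r ω⟩⟩

lemma PD.hat (h : PD a b) (h' : HD a' b') (t : ℝ≥0) : PD (hat t a a') (hat t b b') := by
  refine ⟨hat_meas t h.am h'.am, hat_stp h.aa h'.aa, hat_meas t h.bm h'.bm, hat_stp h.ba h'.ba, fun ω => ?_⟩
  obtain ⟨c, hc⟩ := h.bg ω
  refine ⟨c + t, fun r => ?_⟩
  unfold NLSP.hat
  beta_reduce at hc ⊢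
  split_ifs with h1
  · exact (hc r).trans (by gcongr; exact le_self_add)
  · have := h'.bg (ω t) (r - t) (theta t ω)
    calc r = (r - t) + t := (tsub_add_cancel_of_le (not_le.1 h1).le).symm
      _ ≤ _ := add_le_add this le_add_self

section path
variable {ω ω' : C(ℝ≥0, F)}

lemma hat_cat_le {E : Type*} {t : ℝ≥0} {a : ℝ≥0 → C(ℝ≥0, F) → E} {a' : F → ℝ≥0 → C(ℝ≥0, F) → E}
    (h1 : ∀ r ω, a r (stp r ω) = a r ω) {r : ℝ≥0} (hr : r ≤ t) : hat t a a' r (cat t ω ω') = a r ω := by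
  rw [hat_le hr, ← h1, stp_cat t r hr, h1]

lemma hat_cat_add {E : Type*} {t : ℝ≥0} {a : ℝ≥0 → C(ℝ≥0, F) → E} {a' : F → ℝ≥0 → C(ℝ≥0, F) → E}
    (h0 : ω t = ω' 0) : ∀ᵐ r ∂leb, hat t a a' (r + t) (cat t ω ω') = a' (ω t) r ω' := by
  filter_upwards [hat_add_ae (a := a) (a' := a') (t := t) (cat t ω ω')] with r hr
  rw [hr, theta_cat h0, cat_apply_le le_rfl]

lemma hat_locInt (h : PD a b) (h0 : ω t = ω' 0) (h1 : LocInt fun r => a r ω)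
    (h2 : LocInt fun r => a' (ω t) r ω') : LocInt fun r => hat t a a' r (cat t ω ω') := by
  intro n
  refine IntegrableOn.mono_set (t := Iic ((n : ℝ≥0) + t)) ?_ (Iic_subset_Iic.2 le_self_add)
  rw [intOn_shift]
  constructor
  · refine (h1.on t).congr_fun (fun r hr => (hat_cat_le h.aa hr).symm) measurableSet_Iic
  · refine (h2.on n).congr_fun_ae ?_
    filter_upwards [ae_restrict_of_ae (hat_cat_add (a := a) (a' := a') h0)] with r hr
    exact hr.symm

lemma hat_tau_le (h : PD a b) (h' : HD a' b') (n : ℕ) :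
    t ≤ tau (fun r => hat t b b' r (cat t ω ω')) n ↔ t ≤ tau (fun r => b r ω) n := by
  rw [le_tau_iff ((h.hat h' t).bg _), le_tau_iff (h.bg _)]
  refine eventually_congr (Eventually.of_forall fun r => ?_)
  refine forall_congr' fun hr => ?_
  rw [hat_cat_le h.ba hr]

lemma hat_tau (h : PD a b) (h' : HD a' b') (h0 : ω t = ω' 0) {n : ℕ} (hn : t ≤ tau (fun r => b r ω) n) :
    tau (fun r => hat t b b' r (cat t ω ω')) n = tau (fun r => b' (ω t) r ω') n + t := by
  rw [tau_shift ((h.hat h' t).bg _) ((hat_tau_le h h' n).2 hn)]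
  congr 1
  exact tau_congr (hat_cat_add h0) n

lemma hat_NP_le (h : PD a b) (h' : HD a' b') {s : ℝ≥0} (hs : s ≤ t) (n : ℕ) :
    NP y (hat t a a') (hat t b b') n s (cat t ω ω') = NP y a b n s ω := by
  refine NS_congr_le ((h.hat h' t).bg _) (h.bg _) (Eventually.of_forall fun r hr => ?_)
    (Eventually.of_forall fun r hr => ?_) (fun r hr => ?_)
  · exact hat_cat_le h.aa (hr.trans hs)
  · exact hat_cat_le h.ba (hr.trans hs)
  · exact cat_apply_le (hr.trans hs) _ _

lemma NS_congr_ae {a a' : ℝ≥0 → 𝕂} {b b' : ℝ≥0 → ℝ≥0} (h : ∀ᵐ r ∂leb, a r = a' r)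
    (h2 : ∀ᵐ r ∂leb, b r = b' r) (n : ℕ) (s : ℝ≥0) : NS y a b ω n s = NS y a' b' ω n s := by
  unfold NS
  rw [tau_congr h2]
  exact NN_congr_le (s := min s (tau b' n)) le_rfl (h.mono fun r hr _ => hr) fun _ _ => rfl

open Classical in
lemma hat_NP_add (h : PD a b) (h' : HD a' b') (h0 : ω t = ω' 0) (h1 : LocInt fun r => a r ω)
    (h2 : LocInt fun r => a' (ω t) r ω') (n : ℕ) (s : ℝ≥0) :
    NP y (hat t a a') (hat t b b') n (s + t) (cat t ω ω') = NP y a b n t ω +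
      if t ≤ tau (fun r => b r ω) n then NP y (a' (ω t)) (b' (ω t)) n s ω' else 0 := by
  rw [← hat_NP_le (y := y) (ω' := ω') h h' le_rfl]
  split_ifs with hn
  · simp only [NP]
    rw [NS_shift (hat_locInt h h0 h1 h2) ((h.hat h' t).bg _) ((hat_tau_le h h' n).2 hn), theta_cat h0]
    congr 1
    exact NS_congr_ae (hat_cat_add h0) (hat_cat_add h0) n s
  · rw [add_zero]
    refine NS_shift_lt ?_
    rw [← hat_tau_le (ω' := ω') h h'] at hn
    exact (not_le.1 hn).le

end path
end Hat

end PartT10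

section PartT11

open TopologicalSpace (denseSeq denseRange_denseSeq)
open ProbabilityTheory (Kernel IsMarkovKernel)
open scoped ProbabilityTheory
section Pst

variable {F : Type*} [TopologicalSpace F] [PolishSpace F] [MeasurableSpace F] [BorelSpace F]
  [MeasurableSpace C(ℝ≥0, F)] [BorelSpace C(ℝ≥0, F)]
  {𝕂 : Type*} [RCLike 𝕂] [MeasurableSpace 𝕂] [BorelSpace 𝕂] {U : Type*} [Countable U]
  {t : ℝ≥0} {P : Measure C(ℝ≥0, F)} [IsProbabilityMeasure P]
  {κ : Kernel C(ℝ≥0, F) C(ℝ≥0, F)} [IsMarkovKernel κ]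

/-- the pasted measure -/
def pst (t : ℝ≥0) (P : Measure C(ℝ≥0, F)) (κ : Kernel C(ℝ≥0, F) C(ℝ≥0, F)) : Measure C(ℝ≥0, F) :=
  (P ⊗ₘ κ).map (fun p => cat t p.1 p.2)

instance instPst : IsProbabilityMeasure (pst t P κ) :=
  Measure.isProbabilityMeasure_map (measurable_cat t).aemeasurable

lemma pst_ae {p : C(ℝ≥0, F) → Prop} (hp : MeasurableSet {ω | p ω})
    (h : ∀ᵐ ω ∂P, ∀ᵐ ω' ∂(κ ω), p (cat t ω ω')) : ∀ᵐ ω ∂(pst t P κ), p ω := by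
  unfold pst
  rw [ae_map_iff (measurable_cat t).aemeasurable hp, Measure.ae_compProd_iff]
  · exact h
  · exact measurable_cat t hp

lemma pst_int {g : C(ℝ≥0, F) → 𝕂} (hg : Integrable g (pst t P κ)) :
    ∫ ω, g ω ∂(pst t P κ) = ∫ ω, ∫ ω', g (cat t ω ω') ∂(κ ω) ∂P := by
  unfold pst at hg ⊢
  rw [integral_map (measurable_cat t).aemeasurable hg.1]
  exact Measure.integral_compProd (hg.comp_measurable (measurable_cat t))

lemma pst_integrable {g : C(ℝ≥0, F) → 𝕂} (hg : Measurable g) {c : C(ℝ≥0, F) → ℝ} (hc : Integrable c P)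
    (h1 : ∀ᵐ ω ∂P, Integrable (fun ω' => g (cat t ω ω')) (κ ω) ∧ ∫ ω', ‖g (cat t ω ω')‖ ∂(κ ω) ≤ c ω) :
    Integrable g (pst t P κ) := by
  unfold pst
  rw [integrable_map_measure hg.aestronglyMeasurable (measurable_cat t).aemeasurable]
  have hm : Measurable (g ∘ fun p : C(ℝ≥0, F) × C(ℝ≥0, F) => cat t p.1 p.2) := hg.comp (measurable_cat t)
  rw [Measure.integrable_compProd_iff hm.aestronglyMeasurable]
  refine ⟨h1.mono fun ω h => h.1, hc.mono' ?_ ?_⟩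
  · have := hm.norm.stronglyMeasurable.integral_kernel_prod_right' (κ := κ)
    exact this.aestronglyMeasurable
  · filter_upwards [h1] with ω h
    rw [Real.norm_of_nonneg (integral_nonneg fun _ => norm_nonneg _)]
    exact h.2

lemma pst_set_le {g g0 : C(ℝ≥0, F) → 𝕂} (hg : Integrable g (pst t P κ)) (h : ∀ ω ω', g (cat t ω ω') = g0 ω)
    {A : Set C(ℝ≥0, F)} (hA : MeasurableSet[canonicalSig F t] A) :
    ∫ ω in A, g ω ∂(pst t P κ) = ∫ ω in A, g0 ω ∂P := by
  have hA' := canon_le _ A hA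
  rw [← integral_indicator hA', pst_int (hg.indicator hA'), ← integral_indicator hA']
  have : ∀ ω ω', A.indicator g (cat t ω ω') = A.indicator g0 ω := by
    intro ω ω'
    have e : cat t ω ω' ∈ A ↔ ω ∈ A := by
      rw [← canon_mem hA le_rfl, stp_cat t t le_rfl, canon_mem hA le_rfl]
    by_cases hω : ω ∈ A
    · rw [indicator_of_mem (e.2 hω), indicator_of_mem hω, h]
    · rw [indicator_of_notMem (fun h => hω (e.1 h)), indicator_of_notMem hω]
  simp [this]

variable {y : F → 𝕂} {a : ℝ≥0 → C(ℝ≥0, F) → 𝕂} {b : ℝ≥0 → C(ℝ≥0, F) → ℝ≥0}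
  {a' : F → ℝ≥0 → C(ℝ≥0, F) → 𝕂} {b' : F → ℝ≥0 → C(ℝ≥0, F) → ℝ≥0}

lemma GD.bound {ν : Measure C(ℝ≥0, F)} [IsProbabilityMeasure ν] (h : GD y ν a b) (hy : Measurable y)
    (hyc : ∀ ω : C(ℝ≥0, F), ∀ s, ContinuousWithinAt (fun s => y (ω s)) (Ici s) s) {n : ℕ}
    (hb : ∀ i, ∫⁻ ω, ‖NP y a b n (denseSeq ℝ≥0 i) ω‖ₑ ∂ν ≤ n) (s : ℝ≥0) : ∫ ω, ‖NP y a b n s ω‖ ∂ν ≤ n := by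
  obtain ⟨i, hi, _⟩ := exists_dense_right s
  have hf := h.full hy hyc n
  have h1 : ∫ ω, ‖NP y a b n s ω‖ ∂ν ≤ ∫ ω, ‖NP y a b n (denseSeq ℝ≥0 (i 0)) ω‖ ∂ν :=
    integral_norm_mart_le (canon_le s) (hf.1 _) (h.canon hy n s).stronglyMeasurable (hf.1 _)
      (fun A hA => (hf.2 s _ (hi 0).le A (canon_le_shift _ _ hA)).symm)
  refine h1.trans ?_
  have h2 := hb (i 0)
  rw [integral_norm_eq_lintegral_enorm (hf.1 _).1]
  exact ENNReal.toReal_le_of_le_ofReal (Nat.cast_nonneg n) (by simpa using h2)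

/-- hypothesis on the kernel -/
def KH (t : ℝ≥0) (y : F → 𝕂) (P : Measure C(ℝ≥0, F)) (κ : Kernel C(ℝ≥0, F) C(ℝ≥0, F))
    (a' : F → ℝ≥0 → C(ℝ≥0, F) → 𝕂) (b' : F → ℝ≥0 → C(ℝ≥0, F) → ℝ≥0) : Prop :=
  ∀ᵐ ω ∂P, (∀ᵐ ω' ∂(κ ω), ω t = ω' 0) ∧ GD y (κ ω) (a' (ω t)) (b' (ω t)) ∧
    ∀ n i, ∫⁻ ω', ‖NP y (a' (ω t)) (b' (ω t)) n (denseSeq ℝ≥0 i) ω'‖ₑ ∂(κ ω) ≤ n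

open Classical in
lemma KH.eq (hG : GD y P a b) (h' : HD a' b') (hK : KH t y P κ a' b') : ∀ᵐ ω ∂P, ∀ᵐ ω' ∂(κ ω), ∀ n s,
    NP y (hat t a a') (hat t b b') n (s + t) (cat t ω ω') = NP y a b n t ω +
      if t ≤ tau (fun r => b r ω) n then NP y (a' (ω t)) (b' (ω t)) n s ω' else 0 := by
  filter_upwards [hG.ai, hK] with ω h1 ⟨h2, h3, _⟩
  filter_upwards [h2, h3.ai] with ω' h4 h5 n s
  exact hat_NP_add hG.toPD h' h4 h1 h5 n s

lemma KH.int (hG : GD y P a b) (h' : HD a' b') (hK : KH t y P κ a' b') (hy : Measurable y)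
    (hyc : ∀ ω : C(ℝ≥0, F), ∀ s, ContinuousWithinAt (fun s => y (ω s)) (Ici s) s) (n : ℕ) (s : ℝ≥0) :
    Integrable (NP y (hat t a a') (hat t b b') n s) (pst t P κ) := by
  classical
  have hm := (hG.toPD.hat h' t).meas hy n s
  rcases le_total s t with hs | hs
  · refine pst_integrable hm ((hG.full hy hyc n).1 s).norm (Eventually.of_forall fun ω => ?_)
    have e : (fun ω' => NP y (hat t a a') (hat t b b') n s (cat t ω ω')) = fun _ => NP y a b n s ω :=
      funext fun ω' => hat_NP_le hG.toPD h' hs n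
    constructor
    · rw [e]; exact integrable_const _
    · have : ∀ ω', ‖NP y (hat t a a') (hat t b b') n s (cat t ω ω')‖ = ‖NP y a b n s ω‖ := fun ω' => by
        rw [hat_NP_le hG.toPD h' hs n]
      rw [integral_congr_ae (Eventually.of_forall this)]
      rw [integral_const]; simp
  · obtain ⟨r, rfl⟩ := exists_add_of_le hs
    rw [add_comm t r] at hm ⊢
    refine pst_integrable hm (((hG.full hy hyc n).1 t).norm.add (integrable_const (n : ℝ))) ?_
    filter_upwards [hK.eq hG h', hK] with ω h1 ⟨h2, h3, h4⟩
    have hi := (h3.full hy hyc n).1 r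
    have hb := h3.bound hy hyc (h4 n) r
    have e : (fun ω' => NP y (hat t a a') (hat t b b') n (r + t) (cat t ω ω')) =ᵐ[κ ω] fun ω' => NP y a b n t ω +
      if t ≤ tau (fun r => b r ω) n then NP y (a' (ω t)) (b' (ω t)) n r ω' else 0 := by
      filter_upwards [h1] with ω' h using h n r
    by_cases hn : t ≤ tau (fun r => b r ω) n
    · simp only [if_pos hn] at e
      refine ⟨((integrable_const _).add hi).congr e.symm, ?_⟩
      refine (integral_congr_ae (e.fun_comp norm)).trans_le ?_
      simp only [Function.comp_apply, Pi.add_apply]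
      calc _ ≤ ∫ ω', (‖NP y a b n t ω‖ + ‖NP y (a' (ω t)) (b' (ω t)) n r ω'‖) ∂(κ ω) :=
            integral_mono ((integrable_const _).add hi).norm ((integrable_const _).add hi.norm) fun ω' => norm_add_le _ _
        _ ≤ _ := by
            rw [integral_add (integrable_const _) hi.norm, integral_const]
            simpa using hb
    · simp only [if_neg hn, add_zero] at e
      refine ⟨(integrable_const _).congr e.symm, ?_⟩
      refine (integral_congr_ae (e.fun_comp norm)).trans_le ?_
      simp only [Function.comp_apply, Pi.add_apply]
      simp

lemma KH.mart_le (hG : GD y P a b) (h' : HD a' b') (hK : KH t y P κ a' b') (hy : Measurable y)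
    (hyc : ∀ ω : C(ℝ≥0, F), ∀ s, ContinuousWithinAt (fun s => y (ω s)) (Ici s) s) (n : ℕ) {s r : ℝ≥0} (hsr : s ≤ r)
    (hr : r ≤ t) {A : Set C(ℝ≥0, F)} (hA : MeasurableSet[canonicalSig F s] A) :
    ∫ ω in A, NP y (hat t a a') (hat t b b') n r ω ∂(pst t P κ) =
    ∫ ω in A, NP y (hat t a a') (hat t b b') n s ω ∂(pst t P κ) := by
  have hA' := canon_mono (hsr.trans hr) A hA
  rw [pst_set_le (hK.int hG h' hy hyc n r) (fun ω ω' => hat_NP_le hG.toPD h' hr n) hA',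
    pst_set_le (hK.int hG h' hy hyc n s) (fun ω ω' => hat_NP_le hG.toPD h' (hsr.trans hr) n) hA']
  exact (hG.full hy hyc n).2 _ _ hsr A (canon_le_shift _ _ hA)

lemma KH.mart_ge (hG : GD y P a b) (h' : HD a' b') (hK : KH t y P κ a' b') (hy : Measurable y)
    (hyc : ∀ ω : C(ℝ≥0, F), ∀ s, ContinuousWithinAt (fun s => y (ω s)) (Ici s) s) (n : ℕ) {s r : ℝ≥0} (hsr : s ≤ r)
    {A : Set C(ℝ≥0, F)} (hA : MeasurableSet[canonicalSig F (s + t)] A) :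
    ∫ ω in A, NP y (hat t a a') (hat t b b') n (r + t) ω ∂(pst t P κ) =
    ∫ ω in A, NP y (hat t a a') (hat t b b') n (s + t) ω ∂(pst t P κ) := by
  classical
  have hAm := canon_le _ A hA
  have i1 := hK.int hG h' hy hyc n (r + t)
  have i2 := hK.int hG h' hy hyc n (s + t)
  rw [← sub_eq_zero, ← integral_sub i1.integrableOn i2.integrableOn, ← integral_indicator hAm]
  refine (pst_int ((i1.sub i2).indicator hAm)).trans ?_
  refine integral_eq_zero_of_ae ?_
  filter_upwards [hK.eq hG h', hK] with ω h1 ⟨h2, h3, h4⟩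
  have hf := h3.full hy hyc n
  set B : Set C(ℝ≥0, F) := {ω' | cat t ω ω' ∈ A} with hB
  have hBm : MeasurableSet B := (measurable_cat t).comp (measurable_const.prodMk measurable_id) hAm
  have hBc : MeasurableSet[canonicalSig F s] B := canon_of_stp hBm fun ω' => by
    show cat t ω (stp s ω') ∈ A ↔ cat t ω ω' ∈ A
    rw [← canon_mem hA le_rfl, stp_cat_stp, canon_mem hA le_rfl]
  have hm := hf.2 s r hsr B (canon_le_shift _ _ hBc)
  replace h1 := h1.mono fun _ h => h n
  by_cases hn : t ≤ tau (fun r => b r ω) n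
  · simp only [if_pos hn] at h1
    have e : (fun ω' => A.indicator (fun a_1 => NP y (hat t a a') (hat t b b') n (r + t) a_1 -
        NP y (hat t a a') (hat t b b') n (s + t) a_1) (cat t ω ω')) =ᵐ[κ ω]
        B.indicator fun ω' => NP y (a' (ω t)) (b' (ω t)) n r ω' - NP y (a' (ω t)) (b' (ω t)) n s ω' := by
      filter_upwards [h1] with ω' h
      by_cases hω : cat t ω ω' ∈ A
      · rw [indicator_of_mem hω, indicator_of_mem (show ω' ∈ B from hω), h, h]; ring
      · rw [indicator_of_notMem hω, indicator_of_notMem (show ω' ∉ B from hω)]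
    refine (integral_congr_ae e).trans ?_
    rw [integral_indicator hBm, integral_sub (hf.1 _).integrableOn (hf.1 _).integrableOn, hm]
    simp
  · simp only [if_neg hn, add_zero] at h1
    refine integral_eq_zero_of_ae ?_
    filter_upwards [h1] with ω' h
    by_cases hω : cat t ω ω' ∈ A
    · rw [indicator_of_mem hω, Pi.sub_apply, h, h]; simp
    · rw [indicator_of_notMem hω]; rfl

lemma KH.gd (hG : GD y P a b) (h' : HD a' b') (hK : KH t y P κ a' b') (hy : Measurable y)
    (hyc : ∀ ω : C(ℝ≥0, F), ∀ s, ContinuousWithinAt (fun s => y (ω s)) (Ici s) s) :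
    GD y (pst t P κ) (hat t a a') (hat t b b') where
  toPD := hG.toPD.hat h' t
  ai := by
    refine pst_ae (meas_locInt (f := fun ω r => hat t a a' r ω) (hG.toPD.hat h' t).am) ?_
    filter_upwards [hG.ai, hK] with ω h1 ⟨h2, h3, _⟩
    filter_upwards [h2, h3.ai] with ω' h4 h5
    exact hat_locInt hG.toPD h4 h1 h5
  lim := by
    refine pst_ae (meas_lim (b := fun ω r => hat t b b' r ω) (hG.toPD.hat h' t).bm (hG.toPD.hat h' t).bg) ?_
    filter_upwards [hG.lim, hK] with ω h1 ⟨h2, h3, _⟩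
    filter_upwards [h2, h3.lim] with ω' h4 h5
    refine tendsto_atTop_mono' _ ?_ h5
    filter_upwards [h1.eventually_ge_atTop t] with n hn
    rw [hat_tau hG.toPD h' h4 hn]
    exact le_self_add
  int := fun n i => hK.int hG h' hy hyc n _
  mart := by
    intro n i j hij k
    have hA : MeasurableSet[canonicalSig F (denseSeq ℝ≥0 i)] (stp (denseSeq ℝ≥0 i) ⁻¹' (alg C(ℝ≥0, F) k)) :=
      measurable_stp_canon _ (alg_meas k)
    generalize stp (denseSeq ℝ≥0 i) ⁻¹' (alg C(ℝ≥0, F) k) = A at hA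
    generalize denseSeq ℝ≥0 i = s at *
    generalize denseSeq ℝ≥0 j = r at *
    rcases le_total r t with hr | hr
    · exact hK.mart_le hG h' hy hyc n hij hr hA
    · obtain ⟨r, rfl⟩ := exists_add_of_le hr
      rw [add_comm t r] at *
      rcases le_total s t with hs | hs
      · rw [← hK.mart_le hG h' hy hyc n hs le_rfl hA]
        have := hK.mart_ge hG h' hy hyc n (zero_le : 0 ≤ r) (A := A) (by rw [zero_add]; exact canon_mono hs A hA)
        rwa [zero_add] at this
      · obtain ⟨s, rfl⟩ := exists_add_of_le hs
        rw [add_comm t s] at *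
        exact hK.mart_ge hG h' hy hyc n (by simpa using hij) hA

end Pst

end PartT11

section PartT12

open TopologicalSpace (denseSeq denseRange_denseSeq)
open ProbabilityTheory (Kernel IsMarkovKernel)
open scoped ProbabilityTheory
section MGe

variable {F : Type*} [TopologicalSpace F] [PolishSpace F] [MeasurableSpace F] [BorelSpace F]
  [MeasurableSpace C(ℝ≥0, F)] [BorelSpace C(ℝ≥0, F)]
  {𝕂 : Type*} [RCLike 𝕂] [MeasurableSpace 𝕂] [BorelSpace 𝕂] {U : Type*} [Countable U]
  {Y : U → ℝ≥0 → C(ℝ≥0, F) → 𝕂} {y : U → F → 𝕂} {Θ₀ : F → Set (U → 𝕂)} {ψ : C(ℝ≥0, F) → ℝ} {M : ℝ}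
  {t : ℝ≥0} {x : F}

lemma pst_adm (hS : Std Y y Θ₀) {P : Measure C(ℝ≥0, F)} [IsProbabilityMeasure P]
    {κ : Kernel C(ℝ≥0, F) C(ℝ≥0, F)} [IsMarkovKernel κ]
    {a : U → ℝ≥0 → C(ℝ≥0, F) → 𝕂} {b : U → ℝ≥0 → C(ℝ≥0, F) → ℝ≥0}
    {a' : U → F → ℝ≥0 → C(ℝ≥0, F) → 𝕂} {b' : U → F → ℝ≥0 → C(ℝ≥0, F) → ℝ≥0}
    (hA : Adm y Θ₀ x P a b) (h' : ∀ u, HD (a' u) (b' u))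
    (hK : ∀ᵐ ω ∂P, Adm y Θ₀ (ω t) (κ ω) (fun u => a' u (ω t)) (fun u => b' u (ω t)) ∧
      ∀ u n i, ∫⁻ ω', ‖NP (y u) (a' u (ω t)) (b' u (ω t)) n (denseSeq ℝ≥0 i) ω'‖ₑ ∂(κ ω) ≤ n) :
    Adm y Θ₀ x (pst t P κ) (fun u => hat t (a u) (a' u)) (fun u => hat t (b u) (b' u)) := by
  have hK0 : ∀ᵐ ω ∂P, ∀ᵐ ω' ∂(κ ω), ω t = ω' 0 := by
    filter_upwards [hK] with ω h
    filter_upwards [prob_eval_iff.1 h.1.1] with ω' h0 using h0.symm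
  refine ⟨?_, fun u => ?_, ?_⟩
  · rw [prob_eval_iff]
    refine pst_ae (measurable_eval 0 (measurableSet_singleton x)) ?_
    filter_upwards [prob_eval_iff.1 hA.1] with ω hω
    refine Eventually.of_forall fun ω' => ?_
    rw [cat_apply_le zero_le, hω]
  · refine KH.gd (hA.2.1 u) (h' u) ?_ (hS.meas u) (hS.rc u)
    filter_upwards [hK, hK0] with ω h h0
    exact ⟨h0, h.1.2.1 u, h.2 u⟩
  · refine pst_ae (meas_ae_leb (hS.gr_meas (W := C(ℝ≥0, F) × ℝ≥0)
      (a := fun u p => hat t (a u) (a' u) p.2 p.1)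
      (fun u => ((hA.2.1 u).toPD.hat (h' u) t).am) measurable_snd measurable_fst)) ?_
    filter_upwards [hA.2.2, hK, hK0] with ω h1 h2 h3
    filter_upwards [h2.1.2.2, h3] with ω' h4 h5
    rw [ae_shift (t := t)]
    constructor
    · filter_upwards [h1] with r hr hrt
      rw [cat_apply_le hrt]
      have e : (fun u => hat t (a u) (a' u) r (cat t ω ω')) = fun u => a u r ω :=
        funext fun u => hat_cat_le (hA.2.1 u).aa hrt
      show (fun u => hat t (a u) (a' u) r (cat t ω ω')) ∈ _
      rw [e]; exact hr
    · have h6 : ∀ᵐ r ∂leb, ∀ u, hat t (a u) (a' u) (r + t) (cat t ω ω') = a' u (ω t) r ω' :=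
        ae_all_iff.2 fun u => hat_cat_add h5
      filter_upwards [h4, h6] with r hr h7
      rw [cat_apply_add h5]
      show (fun u => hat t (a u) (a' u) (r + t) (cat t ω ω')) ∈ _
      rw [funext h7]; exact hr

lemma markov_ge [Nonempty F] (hS : Std Y y Θ₀) (hM : ∀ ω, |ψ ω| ≤ M) (hψ : UpperSemianalytic ψ)
    (hne : ∀ x, (RSet Y Θ₀ x).Nonempty) {P : ProbabilityMeasure C(ℝ≥0, F)} (hP : P ∈ RSet Y Θ₀ x) (t : ℝ≥0)
    {ε : ℝ} (hε : 0 < ε) : ∃ Q ∈ RSet Y Θ₀ x, ∫ ω, nlExp Y Θ₀ ψ (ω t) ∂(P : Measure C(ℝ≥0, F)) - ε ≤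
      ∫ ω, ψ (theta t ω) ∂(Q : Measure C(ℝ≥0, F)) := by
  obtain ⟨z, hz, e⟩ := exists_code hS hP
  have hA := hz.1
  rw [e] at hA
  obtain ⟨f, hf, hsel⟩ := nl_select hS hM hψ hne ((P : Measure C(ℝ≥0, F)).map fun ω => ω t) hε
  have hsel' := ae_of_ae_map (measurable_eval t).aemeasurable hsel
  let κ : Kernel C(ℝ≥0, F) C(ℝ≥0, F) := ⟨fun ω => cP F (f (ω t)).2.2,
    cPmeas.comp ((hf.comp (measurable_eval t)).snd.snd)⟩
  have hκe : ∀ ω, κ ω = cP F (f (ω t)).2.2 := fun ω => rfl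
  haveI : IsMarkovKernel κ := ⟨fun ω => by rw [hκe]; infer_instance⟩
  have hfu : ∀ u, Measurable fun x => (f x).1 u := fun u => (measurable_pi_apply u).comp hf.fst
  have hfb : ∀ u, Measurable fun x => (f x).2.1 u := fun u => (measurable_pi_apply u).comp hf.snd.fst
  have h' : ∀ u, HD (fun x => ca F 𝕂 ((f x).1 u)) (fun x => cb F ((f x).2.1 u)) := fun u =>
    ⟨ca_meas.comp (((hfu u).comp measurable_fst).prodMk measurable_snd),
     cb_meas.comp (((hfb u).comp measurable_fst).prodMk measurable_snd),
     fun x r ω => ca_stp _ r ω, fun x r ω => cb_stp _ r ω, fun x r ω => cb_gr _ ω r⟩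
  have hK : ∀ᵐ ω ∂(P : Measure C(ℝ≥0, F)), Adm y Θ₀ (ω t) (κ ω) (fun u => ca F 𝕂 ((f (ω t)).1 u)) (fun u => cb F ((f (ω t)).2.1 u)) ∧
      ∀ u n i, ∫⁻ ω', ‖NP (y u) (ca F 𝕂 ((f (ω t)).1 u)) (cb F ((f (ω t)).2.1 u)) n (denseSeq ℝ≥0 i) ω'‖ₑ ∂(κ ω) ≤ n := by
    filter_upwards [hsel'] with ω h using h.1
  have hadm := pst_adm hS hA h' hK
  have hK0 : ∀ᵐ ω ∂(P : Measure C(ℝ≥0, F)), ∀ᵐ ω' ∂(κ ω), ω t = ω' 0 := by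
    filter_upwards [hK] with ω h
    filter_upwards [prob_eval_iff.1 h.1.1] with ω' h0 using h0.symm
  refine ⟨⟨pst t P κ, inferInstance⟩, Adm.mem hS hadm, ?_⟩
  show _ ≤ ∫ ω, ψ (theta t ω) ∂(pst t P κ)
  haveI : IsProbabilityMeasure ((pst t (P : Measure C(ℝ≥0, F)) κ).map (theta t)) :=
    Measure.isProbabilityMeasure_map (measurable_theta t).aemeasurable
  have hi : Integrable (fun ω => ψ (theta t ω)) (pst t (P : Measure C(ℝ≥0, F)) κ) :=
    Integrable.of_bound ((usa_aem hψ ((pst t (P : Measure C(ℝ≥0, F)) κ).map (theta t))).comp_measurable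
      (measurable_theta t)).aestronglyMeasurable M (Eventually.of_forall fun p => hM _)
  have hi3 : Integrable (fun q : C(ℝ≥0, F) × C(ℝ≥0, F) => ψ (theta t (cat t q.1 q.2))) ((P : Measure C(ℝ≥0, F)) ⊗ₘ κ) := by
    unfold pst at hi
    exact hi.comp_measurable (measurable_cat t)
  have hi2 : Integrable (fun ω => ∫ ω', ψ (theta t (cat t ω ω')) ∂(κ ω)) (P : Measure C(ℝ≥0, F)) := by
    have hi' : Integrable (fun q : C(ℝ≥0, F) × C(ℝ≥0, F) => ψ (theta t (cat t q.1 q.2)))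
      ((Kernel.const Unit (P : Measure C(ℝ≥0, F)) ⊗ₖ Kernel.prodMkLeft Unit κ) ()) := hi3
    exact hi'.integral_compProd
  have hn := nl_int hS hM hψ hne (P : Measure C(ℝ≥0, F)) t
  rw [pst_int (𝕂 := ℝ) hi]
  calc ∫ ω, nlExp Y Θ₀ ψ (ω t) ∂(P : Measure C(ℝ≥0, F)) - ε
      = ∫ ω, (nlExp Y Θ₀ ψ (ω t) - ε) ∂(P : Measure C(ℝ≥0, F)) := by
        rw [integral_sub hn (integrable_const _)]; simp
    _ ≤ _ := by
        refine integral_mono_ae (hn.sub (integrable_const _)) hi2 ?_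
        filter_upwards [hsel', hK0] with ω h1 h2
        have e : ∫ ω', ψ (theta t (cat t ω ω')) ∂(κ ω) = ∫ ω', ψ ω' ∂(κ ω) := by
          refine integral_congr_ae ?_
          filter_upwards [h2] with ω' h3
          rw [theta_cat h3]
        show nlExp Y Θ₀ ψ (ω t) - ε ≤ _
        rw [e]
        exact h1.2.le

lemma mk_std (hY_cadlag : ∀ u ω, Cadlag fun s => Y u s ω)
    (hY_adapted : ∀ u s, Measurable[canonicalSig F s] (Y u s))
    (hY_shift : ∀ (u : U) (s t : ℝ≥0) (ω : C(ℝ≥0, F)), Y u (s + t) ω = Y u s (theta t ω))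
    (hgraph : MeasurableSet {p : ℝ≥0 × C(ℝ≥0, F) × (U → 𝕂) | p.2.2 ∈ Θ₀ (p.2.1 p.1)}) :
    Std Y (fun u x => Y u 0 (ContinuousMap.const ℝ≥0 x)) Θ₀ := by
  have e : ∀ u s ω, Y u s ω = Y u 0 (ContinuousMap.const ℝ≥0 (ω s)) := by
    intro u s ω
    have h1 := hY_shift u 0 s ω
    rw [zero_add] at h1
    rw [h1, ← canon_fun (hY_adapted u 0) le_rfl]
    congr 1
    ext v; simp
  refine ⟨e, fun u => ?_, fun u ω s => ?_, hgraph⟩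
  · have h1 : Measurable (Y u 0) := (hY_adapted u 0).mono (canon_le 0) le_rfl
    exact h1.comp (measurable_path fun s => measurable_id)
  · have := (hY_cadlag u ω).1 s
    rw [show (fun s => Y u s ω) = fun s => Y u 0 (ContinuousMap.const ℝ≥0 (ω s)) from funext fun s => e u s ω] at this
    exact this

lemma markov_final (hY_cadlag : ∀ u ω, Cadlag fun s => Y u s ω)
    (hY_adapted : ∀ u s, Measurable[canonicalSig F s] (Y u s))
    (hY_shift : ∀ (u : U) (s t : ℝ≥0) (ω : C(ℝ≥0, F)), Y u (s + t) ω = Y u s (theta t ω))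
    (hgraph : MeasurableSet {p : ℝ≥0 × C(ℝ≥0, F) × (U → 𝕂) | p.2.2 ∈ Θ₀ (p.2.1 p.1)})
    (hne : ∀ (t : ℝ≥0) (ω : C(ℝ≥0, F)),
      (CSet Y (fun s ω' => Θ₀ (ω' s)) t ω).Nonempty)
    (hψb : ∃ M : ℝ, ∀ ω, |ψ ω| ≤ M)
    (hψa : UpperSemianalytic ψ) (t : ℝ≥0) (x : F) :
    sSup ((fun P : ProbabilityMeasure C(ℝ≥0, F) =>
        ∫ ω', ψ (theta t ω') ∂(P : Measure C(ℝ≥0, F))) '' RSet Y Θ₀ x) =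
      sSup ((fun P : ProbabilityMeasure C(ℝ≥0, F) =>
        ∫ ω', nlExp Y Θ₀ ψ (ω' t) ∂(P : Measure C(ℝ≥0, F))) '' RSet Y Θ₀ x) := by
  have hS := mk_std hY_cadlag hY_adapted hY_shift hgraph
  obtain ⟨M, hM⟩ := hψb
  haveI : Nonempty F := ⟨x⟩
  have hne' : ∀ x, (RSet Y Θ₀ x).Nonempty := fun x => hne 0 _
  have b1 : BddAbove ((fun P : ProbabilityMeasure C(ℝ≥0, F) =>
      ∫ ω', ψ (theta t ω') ∂(P : Measure C(ℝ≥0, F))) '' RSet Y Θ₀ x) := by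
    refine ⟨M, ?_⟩
    rintro _ ⟨P, -, rfl⟩
    exact (le_abs_self _).trans (abs_integral_le fun ω => hM _)
  have b2 : BddAbove ((fun P : ProbabilityMeasure C(ℝ≥0, F) =>
      ∫ ω', nlExp Y Θ₀ ψ (ω' t) ∂(P : Measure C(ℝ≥0, F))) '' RSet Y Θ₀ x) := by
    refine ⟨M, ?_⟩
    rintro _ ⟨P, -, rfl⟩
    exact (le_abs_self _).trans (abs_integral_le fun ω => nl_abs hM (hne' _))
  apply le_antisymm
  · refine csSup_le ((hne' x).image _) ?_
    rintro _ ⟨P, hP, rfl⟩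
    exact (markov_le hS hM hψa hne' hP t).trans (le_csSup b2 ⟨P, hP, rfl⟩)
  · refine csSup_le ((hne' x).image _) ?_
    rintro _ ⟨P, hP, rfl⟩
    refine le_of_forall_pos_le_add fun ε hε => ?_
    obtain ⟨Q, hQ, h⟩ := markov_ge hS hM hψa hne' hP t hε
    have := le_csSup b1 ⟨Q, hQ, rfl⟩
    beta_reduce at this ⊢
    linarith

end MGe

end PartT12

section Markov

variable {F : Type*} [TopologicalSpace F] [PolishSpace F]
  [MeasurableSpace C(ℝ≥0, F)] [BorelSpace C(ℝ≥0, F)]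
  {𝕂 : Type*} [RCLike 𝕂] [MeasurableSpace 𝕂] [BorelSpace 𝕂]
  {U : Type*} [Countable U]

/-- **Nonlinear Markov property**: `ℰ^x(ψ ∘ θ_t) = ℰ^x(ℰ^{X_t}(ψ))`. -/
theorem nonlinear_markov_property
    (Y : U → ℝ≥0 → C(ℝ≥0, F) → 𝕂)
    (hY_cadlag : ∀ u ω, Cadlag fun s => Y u s ω)
    (hY_adapted : ∀ u s, Measurable[canonicalSig F s] (Y u s))
    (hY_shift : ∀ (u : U) (s t : ℝ≥0) (ω : C(ℝ≥0, F)), Y u (s + t) ω = Y u s (theta t ω))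
    (Θ₀ : F → Set (U → 𝕂))
    (hgraph : MeasurableSet {p : ℝ≥0 × C(ℝ≥0, F) × (U → 𝕂) | p.2.2 ∈ Θ₀ (p.2.1 p.1)})
    (hne : ∀ (t : ℝ≥0) (ω : C(ℝ≥0, F)),
      (CSet Y (fun s ω' => Θ₀ (ω' s)) t ω).Nonempty)
    (ψ : C(ℝ≥0, F) → ℝ) (hψb : ∃ M : ℝ, ∀ ω, |ψ ω| ≤ M)
    (hψa : UpperSemianalytic ψ) (t : ℝ≥0) (x : F) :
    sSup ((fun P : ProbabilityMeasure C(ℝ≥0, F) =>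
        ∫ ω', ψ (theta t ω') ∂(P : Measure C(ℝ≥0, F))) '' RSet Y Θ₀ x) =
      sSup ((fun P : ProbabilityMeasure C(ℝ≥0, F) =>
        ∫ ω', nlExp Y Θ₀ ψ (ω' t) ∂(P : Measure C(ℝ≥0, F))) '' RSet Y Θ₀ x) := by
  borelize F
  exact markov_final hY_cadlag hY_adapted hY_shift hgraph hne hψb hψa t x

end Markov

end NLSP
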